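/- For every integer d ≥ 6, the number of isomorphism classes of (3;5,d)-cages equals: d − ⌊d/10⌋ if d ≡ 1 (mod 5); 1 if d ≡ 2 (mod 5); 4 if d ≡ 3 (mod 5); 10 if d ≡ 4 (mod 5); (1280 + 113d)/10 if d ≡ 0 (mod 10); and (1385 + 113d)/10 if d ≡ 5 (mod 10). -/

import Mathlib

/-- A graph is `k`-regular: every vertex has exactly `k` neighbours. -/
def IsRegular' (k : ℕ) {V : Type*} (G : SimpleGraph V) : Prop :=
  ∀ v : V, (G.neighborSet v).ncard = k

/-- A `(k; g, d)`-graph: a `k`-regular simple graph of girth exactly `g` and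
diameter exactly `d`. -/
def IsKGDGraph (k g d : ℕ) {V : Type*} (G : SimpleGraph V) : Prop :=
  IsRegular' k G ∧ G.egirth = g ∧ G.ediam = d

/-- `n(k; g, d)`: the minimum order of a `(k; g, d)`-graph. -/
noncomputable def minOrderKGD (k g d : ℕ) : ℕ :=
  sInf {n : ℕ | ∃ G : SimpleGraph (Fin n), IsKGDGraph k g d G}

/-- The number of isomorphism classes of `(k; g, d)`-cages, i.e. of `(k; g, d)`-graphs
with the minimum possible number `n(k; g, d)` of vertices. -/
noncomputable def numCages (k g d : ℕ) : ℕ :=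
  Nat.card (Quot (fun G H : {G : SimpleGraph (Fin (minOrderKGD k g d)) // IsKGDGraph k g d G} =>
    Nonempty (G.1 ≃g H.1)))

namespace CageCount

open SimpleGraph

/-- `lay` is the breadth-first layering of `G` from `r`. -/
structure Layered {V : Type*} (G : SimpleGraph V) (r : V) (lay : V → ℕ) : Prop where
  root : lay r = 0
  lip : ∀ ⦃x y⦄, G.Adj x y → lay y ≤ lay x + 1
  back : ∀ x, x ≠ r → ∃ y, G.Adj x y ∧ lay y + 1 = lay x

/-- No triangles and no quadrilaterals. -/
structure Sparse {V : Type*} (G : SimpleGraph V) : Prop where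
  tri : ∀ ⦃a b c⦄, G.Adj a b → G.Adj b c → G.Adj c a → False
  sq : ∀ ⦃a b c d⦄, G.Adj a b → G.Adj b c → G.Adj c d → G.Adj d a → a ≠ c → b ≠ d → False

section Layering

variable {V W : Type*} {G : SimpleGraph V} {r : V} {lay : V → ℕ}

lemma walk_lip {f : V → ℕ} (hf : ∀ ⦃x y⦄, G.Adj x y → f y ≤ f x + 1) {x y : V}
    (p : G.Walk x y) : f y ≤ f x + p.length := by
  induction p with
  | nil => simp
  | cons h p ih => have := hf h; simp only [Walk.length_cons]; omega

lemma le_dist_of_lip (hG : G.Connected) {f : V → ℕ}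
    (hf : ∀ ⦃x y⦄, G.Adj x y → f y ≤ f x + 1) (x y : V) : f y ≤ f x + G.dist x y := by
  obtain ⟨p, hp⟩ := hG.exists_walk_length_eq_dist x y
  exact hp ▸ walk_lip hf p

lemma Layered.exists_walk (h : Layered G r lay) :
    ∀ n x, lay x = n → ∃ p : G.Walk r x, p.length = n := by
  intro n
  induction n with
  | zero =>
    intro x hx
    by_cases hr : x = r
    · subst hr; exact ⟨.nil, rfl⟩
    · obtain ⟨y, -, hy⟩ := h.back x hr; omega
  | succ n ih =>
    intro x hx
    have hr : x ≠ r := by rintro rfl; have := h.root; omega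
    obtain ⟨y, hxy, hy⟩ := h.back x hr
    obtain ⟨p, hp⟩ := ih y (by omega)
    exact ⟨p.concat hxy.symm, by simp [hp]⟩

lemma Layered.eq_zero_iff (h : Layered G r lay) {x : V} : lay x = 0 ↔ x = r := by
  constructor
  · intro hx
    by_contra hr
    obtain ⟨y, -, hy⟩ := h.back x hr; omega
  · rintro rfl; exact h.root

lemma Layered.connected (h : Layered G r lay) : G.Connected := by
  have hr : ∀ x, G.Reachable r x := fun x => by
    obtain ⟨p, -⟩ := h.exists_walk _ x rfl; exact ⟨p⟩
  have := Nonempty.intro r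
  exact ⟨fun x y => (hr x).symm.trans (hr y)⟩

lemma Layered.dist_eq (h : Layered G r lay) (x : V) : G.dist r x = lay x := by
  apply le_antisymm
  · obtain ⟨p, hp⟩ := h.exists_walk _ x rfl
    exact hp ▸ dist_le p
  · simpa [h.root] using le_dist_of_lip h.connected h.lip r x

lemma dist_le_succ_of_adj (hG : G.Connected) (r : V) {x y : V} (h : G.Adj x y) :
    G.dist r y ≤ G.dist r x + 1 := by
  have := hG.dist_triangle (u := r) (v := x) (w := y)
  rwa [dist_eq_one_iff_adj.2 h] at this

lemma layered_dist (hG : G.Connected) (r : V) : Layered G r (G.dist r) where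
  root := dist_self
  lip x y h := dist_le_succ_of_adj hG r h
  back x hx := by
    obtain ⟨p, hp⟩ := hG.exists_walk_length_eq_dist x r
    cases p with
    | nil => exact absurd rfl hx
    | @cons _ y _ h q =>
      refine ⟨y, h, le_antisymm ?_ (dist_le_succ_of_adj hG r h.symm)⟩
      have := dist_le q.reverse
      simp only [Walk.length_cons, Walk.length_reverse] at hp this
      rw [dist_comm (v := x)]; omega

lemma Iso.dist_eq {H : SimpleGraph W} (hG : G.Connected) (f : G ≃g H) (x y : V) :
    H.dist (f x) (f y) = G.dist x y := by
  have hH : H.Connected := f.connected_iff.1 hG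
  apply le_antisymm
  · obtain ⟨p, hp⟩ := hG.exists_walk_length_eq_dist x y
    have := dist_le (p.map f.toHom)
    rw [Walk.length_map, hp] at this
    exact this
  · obtain ⟨p, hp⟩ := hH.exists_walk_length_eq_dist (f x) (f y)
    have := dist_le (p.map f.symm.toHom)
    rw [Walk.length_map, hp] at this
    simpa using this

end Layering

section Girth

variable {V : Type*} {G : SimpleGraph V}

lemma isCycle_three {a b c : V} (h1 : G.Adj a b) (h2 : G.Adj b c) (h3 : G.Adj c a) :
    (Walk.cons h1 (.cons h2 (.cons h3 .nil))).IsCycle := by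
  have := h1.ne; have := h2.ne; have := h3.ne
  rw [Walk.isCycle_def, Walk.isTrail_def]
  simp_all [Walk.edges_cons, eq_comm]

lemma isCycle_four {a b c d : V} (h1 : G.Adj a b) (h2 : G.Adj b c) (h3 : G.Adj c d)
    (h4 : G.Adj d a) (hac : a ≠ c) (hbd : b ≠ d) :
    (Walk.cons h1 (.cons h2 (.cons h3 (.cons h4 .nil)))).IsCycle := by
  have := h1.ne; have := h2.ne; have := h3.ne; have := h4.ne
  rw [Walk.isCycle_def, Walk.isTrail_def]
  simp_all [Walk.edges_cons, eq_comm]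

lemma isCycle_five {a b c d e : V} (h1 : G.Adj a b) (h2 : G.Adj b c) (h3 : G.Adj c d)
    (h4 : G.Adj d e) (h5 : G.Adj e a) (hac : a ≠ c) (had : a ≠ d) (hbd : b ≠ d) (hbe : b ≠ e)
    (hce : c ≠ e) :
    (Walk.cons h1 (.cons h2 (.cons h3 (.cons h4 (.cons h5 .nil))))).IsCycle := by
  have := h1.ne; have := h2.ne; have := h3.ne; have := h4.ne; have := h5.ne
  rw [Walk.isCycle_def, Walk.isTrail_def]
  simp_all [Walk.edges_cons, eq_comm]

lemma sparse_of_egirth (h : G.egirth = 5) : Sparse G := by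
  constructor
  · intro a b c h1 h2 h3
    have := egirth_le_length (isCycle_three h1 h2 h3)
    rw [h] at this
    norm_num [Walk.length] at this
  · intro a b c d h1 h2 h3 h4 hac hbd
    have := egirth_le_length (isCycle_four h1 h2 h3 h4 hac hbd)
    rw [h] at this
    norm_num [Walk.length] at this

lemma egirth_eq_five (h : Sparse G) {a b c d e : V} (h1 : G.Adj a b) (h2 : G.Adj b c)
    (h3 : G.Adj c d) (h4 : G.Adj d e) (h5 : G.Adj e a) (hac : a ≠ c) (had : a ≠ d)
    (hbd : b ≠ d) (hbe : b ≠ e) (hce : c ≠ e) : G.egirth = 5 := by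
  apply le_antisymm
  · exact egirth_le_length (isCycle_five h1 h2 h3 h4 h5 hac had hbd hbe hce)
  · rw [le_egirth]
    intro x w hw
    have h3 := hw.three_le_length
    suffices 5 ≤ w.length by exact_mod_cast this
    by_contra hlt
    have : w.length = 3 ∨ w.length = 4 := by omega
    rcases w with _ | ⟨e1, _ | ⟨e2, _ | ⟨e3, _ | ⟨e4, _ | ⟨e5, w⟩⟩⟩⟩⟩
    · simp at h3
    · simp at h3
    · simp at h3
    · exact h.tri e1 e2 e3
    · have hn := hw.support_nodup
      simp at hn
      refine h.sq e1 e2 e3 e4 ?_ ?_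
      · rintro rfl; simp_all
      · rintro rfl; simp_all
    · simp only [Walk.length_cons] at this; omega

lemma ediam_eq_coe_iff [Finite V] [Nonempty V] {d : ℕ} :
    G.ediam = d ↔ G.Connected ∧ (∀ x y, G.dist x y ≤ d) ∧ ∃ x y, G.dist x y = d := by
  constructor
  · intro h
    have hc : G.Connected := connected_iff_ediam_ne_top.2 (by simp [h])
    have key : ∀ x y, (G.dist x y : ℕ∞) = G.edist x y := fun x y => (hc x y).coe_dist_eq_edist
    refine ⟨hc, fun x y => ?_, ?_⟩
    · have := G.edist_le_ediam (u := x) (v := y)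
      rw [h, ← key] at this
      exact_mod_cast this
    · obtain ⟨x, y, hxy⟩ := G.exists_edist_eq_ediam_of_finite
      rw [h, ← key] at hxy
      exact ⟨x, y, by exact_mod_cast hxy⟩
  · rintro ⟨hc, hle, x, y, hxy⟩
    have key : ∀ x y, (G.dist x y : ℕ∞) = G.edist x y := fun x y => (hc x y).coe_dist_eq_edist
    apply le_antisymm
    · refine ediam_le_of_edist_le fun u v => ?_
      rw [← key]; exact_mod_cast hle u v
    · rw [← hxy, key]; exact edist_le_ediam

end Girth

/-! ### A certified search for sparse graphs extending a given partial graph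

Graphs on `{0, …, n - 1}` are given by lists of neighbours. The functions that the kernel has to
evaluate are defined directly through recursors, which speeds up evaluation. -/

noncomputable section

/-- Bit `j` of `m`. -/
def tb (m j : ℕ) : Bool := Nat.beq (Nat.land (Nat.shiftRight m j) 1) 1

/-- Base-32 digit `i` of `c`. -/
def dig (c i : ℕ) : ℕ := Nat.mod (Nat.shiftRight c (Nat.mul 5 i)) 32

/-- Case distinction. -/
def br {α : Type} (b : Bool) (t e : α) : α := @Bool.rec (fun _ => α) e t b

/-- Recursion on lists. -/
def lrec {β α : Type} (a : α) (f : β → List β → α → α) (l : List β) : α :=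
  @List.rec β (fun _ => α) a (fun x t ih => f x t ih) l

/-- Entry `i` of `l`. -/
def ent {β : Type} (d : β) (l : List β) : ℕ → β :=
  lrec (fun _ => d) (fun x _ ih i => @Nat.rec (fun _ => β) x (fun j _ => ih j) i) l

/-- Length of a list. -/
def len {β : Type} (l : List β) : ℕ := lrec 0 (fun _ _ ih => Nat.succ ih) l

/-- Whether all elements satisfy a test. -/
def allB {β : Type} (f : β → Bool) (l : List β) : Bool :=
  lrec true (fun x _ ih => br (f x) ih false) l

/-- Whether some element satisfies a test. -/
def anyB {β : Type} (f : β → Bool) (l : List β) : Bool :=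
  lrec false (fun x _ ih => br (f x) true ih) l

/-- Replace entry `i`. -/
def setAt {β : Type} (y : β) (l : List β) : ℕ → List β :=
  lrec (fun _ => []) (fun x t ih i =>
    @Nat.rec (fun _ => List β) (y :: t) (fun j _ => x :: ih j) i) l

/-- Union of the masks `f x`, `x ∈ l`. -/
def orAll (f : ℕ → ℕ) (l : List ℕ) : ℕ := lrec 0 (fun x _ ih => Nat.lor (f x) ih) l

/-- Membership in a list. -/
def memb (x : ℕ) (l : List ℕ) : Bool := anyB (fun y => Nat.beq x y) l

/-- The neighbours of `i`. -/
def row (A : List (List ℕ)) (i : ℕ) : List ℕ := ent [] A i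

/-- The mask of the vertices at distance at most three from `v`. -/
def ball3 (A : List (List ℕ)) (v : ℕ) : ℕ :=
  Nat.lor (Nat.pow 2 v) (orAll (fun x => Nat.lor (Nat.pow 2 x)
    (orAll (fun y => Nat.lor (Nat.pow 2 y) (orAll (fun z => Nat.pow 2 z) (row A y))) (row A x)))
      (row A v))

/-- A search problem: number of vertices, degrees, colours (adjacent vertices have colours
differing by at most one) and marks, the latter three as lists of digits. -/
structure Prob where
  n : ℕ
  deg : ℕ
  col : ℕ
  mark : ℕ

/-- Add the edge `v w`. -/
def addE (v w : ℕ) (A : List (List ℕ)) : List (List ℕ) :=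
  setAt (v :: row A w) (setAt (w :: row A v) A v) w

/-- Whether `w` may become a new neighbour of `v`, where `b` is the mask of the ball of radius
three around `v`. -/
def cand (p : Prob) (A : List (List ℕ)) (b v w : ℕ) : Bool :=
  br (tb b w) false
    (br (Nat.blt (len (row A w)) (dig p.deg w))
      (br (Nat.ble (dig p.col v) (Nat.succ (dig p.col w)))
        (Nat.ble (dig p.col w) (Nat.succ (dig p.col v))) false) false)

/-- The digits of `c` form a permutation preserving marks. -/
def permOK (p : Prob) (c : ℕ) : Bool :=
  br (Nat.beq (orAll (fun i => Nat.pow 2 (dig c i)) (List.range p.n))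
      (Nat.sub (Nat.pow 2 p.n) 1))
    (allB (fun i => Nat.beq (dig p.mark (dig c i)) (dig p.mark i)) (List.range p.n)) false

/-- The child `C` is a relabelled extension of the representative `R`. -/
def closeOK (p : Prob) (R C : List (List ℕ)) (c : ℕ) : Bool :=
  br (permOK p c)
    (allB (fun i =>
      br (Nat.beq (dig p.deg (dig c i)) (dig p.deg i))
        (br (Nat.beq (dig p.col (dig c i)) (dig p.col i))
          (allB (fun j => memb (dig c j) (row C (dig c i))) (row R i)) false) false)
      (List.range p.n)) false

/-- The full graph `A` is a relabelling of one of the classes. -/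
def leafOK (p : Prob) (cls : List (List (List ℕ))) (A : List (List ℕ)) (c : ℕ) : Bool :=
  let k := Nat.mod c 1024
  let t := Nat.shiftRight c 10
  br (Nat.blt k (len cls))
    (br (permOK p t)
      (allB (fun i =>
        br (Nat.beq (len (row A (dig t i))) (dig p.deg (dig t i)))
          (br (allB (fun j => br (Nat.blt j p.n) (memb (dig t j) (row A (dig t i))) false)
              (row (ent [] cls k) i))
            (allB (fun x => anyB (fun j => Nat.beq (dig t j) x) (row (ent [] cls k) i))
              (row A (dig t i))) false) false) (List.range p.n)) false) false

/-- The children kept as representatives of the next level. -/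
def news (p : Prob) (A : List (List ℕ)) (b v : ℕ) : List ℕ → ℕ → List (List (List ℕ)) :=
  lrec (fun _ => []) fun w _ ih c => br (cand p A b v w)
    (br (Nat.beq (Nat.mod c 32) 0) (addE v w A :: ih (Nat.shiftRight c 5))
      (ih (Nat.shiftRight c (Nat.mul 5 (Nat.add p.n 3)))))
    (ih c)

/-- The children not kept are closed by a representative of the next level. -/
def closes (p : Prob) (nx : List (List (List ℕ))) (A : List (List ℕ)) (b v : ℕ) :
    List ℕ → ℕ → Bool :=
  lrec (fun _ => true) fun w _ ih c => br (cand p A b v w)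
    (br (Nat.beq (Nat.mod c 32) 0) (ih (Nat.shiftRight c 5))
      (br (br (Nat.blt (Nat.mod (Nat.shiftRight c 5) 1024) (len nx))
          (closeOK p (ent [] nx (Nat.mod (Nat.shiftRight c 5) 1024)) (addE v w A)
            (Nat.shiftRight c 15)) false)
        (ih (Nat.shiftRight c (Nat.mul 5 (Nat.add p.n 3)))) false))
    (ih c)

/-- `k n`, arranged so that the kernel evaluates `n` first. -/
def forceNat {α : Type} (k : ℕ → α) (n : ℕ) : α :=
  @Nat.rec (fun _ => α) (k 0) (fun m _ => k (Nat.succ m)) n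

/-- `k l`, arranged so that the kernel evaluates the entries of `l` first. -/
def forceList {β α : Type} (f : β → (β → α) → α) : List β → (List β → α) → α :=
  lrec (fun k => k []) fun x _ ih k => f x fun y => ih fun tl => k (y :: tl)

/-- `k A`, arranged so that the kernel evaluates `A` first. -/
def forceGraph {α : Type} (A : List (List ℕ)) (k : List (List ℕ) → α) : α :=
  forceList (forceList fun n k => forceNat k n) A k

/-- Apply a test to corresponding entries. -/
def all2 {β : Type} (f : β → ℕ → Bool) : List β → List ℕ → Bool
  | [], _ => true
  | _ :: _, [] => false
  | a :: as, c :: cs => br (f a c) (all2 f as cs) false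

/-- Concatenate the results on corresponding entries. -/
def flat2 {β : Type} (f : β → ℕ → List β) : List β → List ℕ → List β
  | a :: as, c :: cs => f a c ++ flat2 f as cs
  | _, _ => []

/-- Representatives of the next level. -/
def nextLevel (p : Prob) (cur : List (List (List ℕ))) (cs : List ℕ) : List (List (List ℕ)) :=
  flat2 (fun A c => forceNat
    (fun b => news p A b (Nat.mod c 32) (List.range p.n) (Nat.shiftRight c 5))
      (ball3 A (Nat.mod c 32))) cur cs

/-- Check one representative against its certificate. -/
def stepOK (p : Prob) (nx : List (List (List ℕ))) (A : List (List ℕ)) (c : ℕ) : Bool :=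
  br (Nat.blt (Nat.mod c 32) p.n)
    (br (Nat.blt (len (row A (Nat.mod c 32))) (dig p.deg (Nat.mod c 32)))
      (forceNat (fun b => closes p nx A b (Nat.mod c 32) (List.range p.n) (Nat.shiftRight c 5))
        (ball3 A (Nat.mod c 32))) false) false

/-- Check a whole search, level by level. -/
def run (p : Prob) (cls : List (List (List ℕ))) (lf : List ℕ) :
    List (List ℕ) → List (List (List ℕ)) → Bool
  | [], cur => all2 (leafOK p cls) cur lf
  | cs :: lv, cur =>
    forceList forceGraph (nextLevel p cur cs) fun nx =>
      br (all2 (stepOK p nx) cur cs) (run p cls lf lv nx) false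

lemma br_eq {α : Type} (b : Bool) (t e : α) : br b t e = cond b t e := by cases b <;> rfl

lemma ent_eq {β : Type} (d : β) (l : List β) : ∀ i, ent d l i = l.getD i d := by
  induction l with
  | nil => intro i; rfl
  | cons x l ih =>
    intro i
    cases i with
    | zero => rfl
    | succ i => rw [List.getD_cons_succ, ← ih]; rfl

lemma len_eq {β : Type} (l : List β) : len l = l.length := by
  induction l with
  | nil => rfl
  | cons x l ih => rw [List.length_cons, ← ih]; rfl

lemma allB_eq {β : Type} (f : β → Bool) (l : List β) : allB f l = l.all f := by
  induction l with
  | nil => rfl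
  | cons x l ih =>
    rw [List.all_cons, ← ih]
    change br (f x) _ _ = _
    rw [br_eq]; cases f x <;> rfl

lemma anyB_eq {β : Type} (f : β → Bool) (l : List β) : anyB f l = l.any f := by
  induction l with
  | nil => rfl
  | cons x l ih =>
    rw [List.any_cons, ← ih]
    change br (f x) _ _ = _
    rw [br_eq]; cases f x <;> rfl

lemma setAt_eq {β : Type} (y : β) (l : List β) : ∀ i, setAt y l i = l.set i y := by
  induction l with
  | nil => intro i; rfl
  | cons x l ih =>
    intro i
    cases i with
    | zero => rfl
    | succ i => rw [List.set_cons_succ, ← ih]; rfl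

lemma orAll_cons (f : ℕ → ℕ) (x : ℕ) (l : List ℕ) :
    orAll f (x :: l) = Nat.lor (f x) (orAll f l) := rfl

lemma row_eq (A : List (List ℕ)) (i : ℕ) : row A i = A.getD i [] := ent_eq _ _ _

lemma news_cons (p : Prob) (A : List (List ℕ)) (b v w : ℕ) (ws : List ℕ) (c : ℕ) :
    news p A b v (w :: ws) c = cond (cand p A b v w)
      (cond (Nat.beq (Nat.mod c 32) 0) (addE v w A :: news p A b v ws (Nat.shiftRight c 5))
        (news p A b v ws (Nat.shiftRight c (Nat.mul 5 (Nat.add p.n 3)))))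
      (news p A b v ws c) := by
  simp only [← br_eq]; rfl

lemma closes_cons (p : Prob) (nx : List (List (List ℕ))) (A : List (List ℕ)) (b v w : ℕ)
    (ws : List ℕ) (c : ℕ) :
    closes p nx A b v (w :: ws) c = cond (cand p A b v w)
      (cond (Nat.beq (Nat.mod c 32) 0) (closes p nx A b v ws (Nat.shiftRight c 5))
        (cond (cond (Nat.blt (Nat.mod (Nat.shiftRight c 5) 1024) (len nx))
            (closeOK p (ent [] nx (Nat.mod (Nat.shiftRight c 5) 1024)) (addE v w A)
              (Nat.shiftRight c 15)) false)
          (closes p nx A b v ws (Nat.shiftRight c (Nat.mul 5 (Nat.add p.n 3)))) false))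
      (closes p nx A b v ws c) := by
  simp only [← br_eq]; rfl

lemma tb_eq (m j : ℕ) : tb m j = m.testBit j := by
  have h : Nat.land (Nat.shiftRight m j) 1 = (m >>> j) % 2 := Nat.and_one_is_mod _
  rw [tb, h, Nat.testBit_eq_decide_div_mod_eq, Nat.shiftRight_eq_div_pow, Bool.eq_iff_iff]
  simp

lemma tb_lor (a b j : ℕ) : tb (Nat.lor a b) j = (tb a j || tb b j) := by
  simp only [tb_eq]; exact Nat.testBit_or _ _ _

lemma tb_orAll (f : ℕ → ℕ) (l : List ℕ) (j : ℕ) :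
    tb (orAll f l) j = true ↔ ∃ x ∈ l, tb (f x) j = true := by
  induction l with
  | nil => simp [orAll, lrec, tb_eq]
  | cons x l ih => rw [orAll_cons, tb_lor]; simp [ih]

lemma tb_pow (v j : ℕ) : tb (Nat.pow 2 v) j = true ↔ v = j := by
  rw [tb_eq]; change (2 ^ v).testBit j = true ↔ _; simp [Nat.testBit_two_pow]

lemma memb_iff {x : ℕ} {l : List ℕ} : memb x l = true ↔ x ∈ l := by
  simp [memb, anyB_eq]

lemma forceNat_eq {α : Type} (k : ℕ → α) (n : ℕ) : forceNat k n = k n := by cases n <;> rfl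

lemma forceList_eq {β α : Type} {f : β → (β → α) → α} (hf : ∀ x k, f x k = k x) (l : List β) :
    ∀ k : List β → α, forceList f l k = k l := by
  induction l with
  | nil => intro k; rfl
  | cons x l ih => intro k; exact (hf _ _).trans (ih _)

lemma forceGraph_eq {α : Type} (A : List (List ℕ)) (k : List (List ℕ) → α) :
    forceGraph A k = k A :=
  forceList_eq (forceList_eq fun _ _ => forceNat_eq _ _) _ _

/-- Well-formed lists of neighbours. -/
structure WF (n : ℕ) (A : List (List ℕ)) : Prop where
  length : A.length = n
  nodup : ∀ i, (row A i).Nodup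
  symm : ∀ i j, j ∈ row A i → i ∈ row A j

lemma row_addE {n : ℕ} {A : List (List ℕ)} (hA : A.length = n) {v w : ℕ} (hv : v < n) (hw : w < n)
    (hvw : v ≠ w) (i : ℕ) : row (addE v w A) i =
      if i = w then v :: row A w else if i = v then w :: row A v else row A i := by
  unfold row addE
  rw [setAt_eq, setAt_eq, ent_eq, List.getD_eq_getElem?_getD, List.getElem?_set, List.getElem?_set]
  subst hA
  simp only [List.length_set, hw, hv, if_true]
  by_cases h1 : i = w
  · subst h1; simp [row]
  · rw [if_neg (Ne.symm h1), if_neg h1]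
    by_cases h2 : i = v
    · subst h2; simp [row]
    · rw [if_neg (Ne.symm h2), if_neg h2, ent_eq, List.getD_eq_getElem?_getD]

lemma WF.addE {n : ℕ} {A : List (List ℕ)} (hA : WF n A) {v w : ℕ} (hv : v < n) (hw : w < n)
    (hvw : v ≠ w) (hn : w ∉ row A v) : WF n (addE v w A) where
  length := by simp [CageCount.addE, setAt_eq, hA.length]
  nodup i := by
    rw [row_addE hA.length hv hw hvw]
    split_ifs
    · exact List.nodup_cons.2 ⟨fun h => hn (hA.symm _ _ h), hA.nodup _⟩
    · exact List.nodup_cons.2 ⟨hn, hA.nodup _⟩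
    · exact hA.nodup _
  symm i j := by
    have := hA.symm i j
    rw [row_addE hA.length hv hw hvw, row_addE hA.length hv hw hvw]
    split_ifs <;> simp_all

lemma not_mem_of_ball3 {A : List (List ℕ)} {v w : ℕ} (h : tb (ball3 A v) w = false) :
    v ≠ w ∧ w ∉ row A v := by
  rw [Bool.eq_false_iff] at h
  simp only [ne_eq, ball3, tb_lor, Bool.or_eq_true, tb_pow, tb_orAll] at h
  exact ⟨fun h' => h (.inl h'), fun h' => h (.inr ⟨w, h', .inl rfl⟩)⟩

lemma WF.of_mem_news {p : Prob} {A : List (List ℕ)} (hA : WF p.n A) {v : ℕ} (hv : v < p.n)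
    {B : List (List ℕ)} : ∀ (ws : List ℕ) (c : ℕ), (∀ w ∈ ws, w < p.n) →
      B ∈ news p A (ball3 A v) v ws c → WF p.n B := by
  intro ws
  induction ws with
  | nil => simp [news, lrec]
  | cons w ws ih =>
    intro c hws hB
    rw [news_cons] at hB
    have ih' := fun c => ih c fun w hw => hws w (List.mem_cons_of_mem _ hw)
    cases hc : cand p A (ball3 A v) v w
    · rw [hc] at hB; exact ih' _ hB
    · rw [hc, cond_true] at hB
      cases hd : Nat.beq (Nat.mod c 32) 0
      · rw [hd] at hB; exact ih' _ hB
      · rw [hd, cond_true] at hB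
        rcases List.mem_cons.1 hB with rfl | hB
        · have : tb (ball3 A v) w = false := by
            by_contra hcon
            rw [Bool.not_eq_false] at hcon
            simp [cand, br_eq, hcon] at hc
          obtain ⟨h1, h2⟩ := not_mem_of_ball3 this
          exact hA.addE hv (hws w (by simp)) h1 h2
        · exact ih' _ hB

section Soundness

variable {V : Type*} {G : SimpleGraph V} {p : Prob}

/-- `l` names the vertices of `G` in accordance with the problem `p`. -/
structure Lab (p : Prob) (G : SimpleGraph V) (l : ℕ → V) : Prop where
  inj : ∀ i < p.n, ∀ j < p.n, l i = l j → i = j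
  surj : ∀ x, ∃ i < p.n, l i = x
  deg : ∀ i < p.n, (G.neighborSet (l i)).ncard = dig p.deg i
  col : ∀ i < p.n, ∀ j < p.n, G.Adj (l i) (l j) → dig p.col i ≤ dig p.col j + 1

/-- The graph `A` is contained in `G` through the names `l`. -/
def Sub (p : Prob) (G : SimpleGraph V) (A : List (List ℕ)) (l : ℕ → V) : Prop :=
  ∀ i < p.n, ∀ j ∈ row A i, j < p.n ∧ G.Adj (l i) (l j)

/-- `G` is isomorphic to one of the classes, with marks preserved. -/
def Classified (p : Prob) (cls : List (List (List ℕ))) (G : SimpleGraph V) (l : ℕ → V) : Prop :=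
  ∃ k < cls.length, ∃ l' : ℕ → V, (∀ i < p.n, ∀ j < p.n, l' i = l' j → i = j) ∧
    (∀ x, ∃ i < p.n, l' i = x) ∧
    (∀ i < p.n, ∀ j < p.n, G.Adj (l' i) (l' j) ↔ j ∈ row (ent [] cls k) i) ∧
    ∀ i < p.n, ∃ j < p.n, l' i = l j ∧ dig p.mark j = dig p.mark i

lemma Lab.finite {l : ℕ → V} (hl : Lab p G l) : Finite V :=
  Finite.of_surjective (fun i : Fin p.n => l i) fun x => by
    obtain ⟨i, hi, rfl⟩ := hl.surj x; exact ⟨⟨i, hi⟩, rfl⟩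

lemma Lab.adj_iff_of_full {l : ℕ → V} (hl : Lab p G l) {A : List (List ℕ)} (hA : Sub p G A l)
    (hW : WF p.n A) {i j : ℕ} (hi : i < p.n) (hj : j < p.n)
    (hfull : dig p.deg i ≤ (row A i).length) :
    G.Adj (l i) (l j) ↔ j ∈ row A i := by
  classical
  refine ⟨fun h => ?_, fun h => (hA i hi j h).2⟩
  have := hl.finite
  have h1 : ((row A i).toFinset.image l : Set V) ⊆ G.neighborSet (l i) := by
    intro x hx
    simp only [Finset.coe_image, Set.mem_image, Finset.mem_coe, List.mem_toFinset] at hx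
    obtain ⟨j, hj, rfl⟩ := hx
    exact (hA i hi j hj).2
  have h2 : ((row A i).toFinset.image l : Set V).ncard = (row A i).length := by
    rw [Set.ncard_coe_finset, Finset.card_image_of_injOn, List.toFinset_card_of_nodup (hW.nodup i)]
    intro a ha b hb hab
    simp only [List.coe_toFinset, Set.mem_ofPred_eq] at ha hb
    exact hl.inj _ (hA i hi a ha).1 _ (hA i hi b hb).1 hab
  have h3 := Set.eq_of_subset_of_ncard_le h1 (by rw [h2, hl.deg i hi]; exact hfull)
    (Set.toFinite _)
  have : l j ∈ ((row A i).toFinset.image l : Set V) := h3 ▸ h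
  simp only [Finset.coe_image, Set.mem_image, Finset.mem_coe, List.mem_toFinset] at this
  obtain ⟨j', hj', he⟩ := this
  exact hl.inj j' (hA i hi j' hj').1 j hj he ▸ hj'

lemma Lab.exists_new {l : ℕ → V} (hl : Lab p G l) {A : List (List ℕ)} {v : ℕ}
    (hv : v < p.n) (hneed : (row A v).length < dig p.deg v) :
    ∃ w < p.n, G.Adj (l v) (l w) ∧ w ∉ row A v := by
  classical
  by_contra! hcon
  have : G.neighborSet (l v) ⊆ ((row A v).toFinset.image l : Set V) := by
    intro x hx
    obtain ⟨w, hw, rfl⟩ := hl.surj x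
    have := hcon w hw hx
    simp only [Finset.coe_image, Set.mem_image, Finset.mem_coe, List.mem_toFinset]
    exact ⟨w, this, rfl⟩
  have h := Set.ncard_le_ncard this (Finset.finite_toSet _)
  rw [hl.deg v hv, Set.ncard_coe_finset] at h
  exact (h.trans (Finset.card_image_le.trans (List.toFinset_card_le _))).not_gt hneed

lemma Lab.cand {l : ℕ → V} (hl : Lab p G l) (hG : Sparse G) {A : List (List ℕ)}
    (hA : Sub p G A l) (hW : WF p.n A) {v w : ℕ} (hv : v < p.n) (hw : w < p.n)
    (h : G.Adj (l v) (l w)) (hb : w ∉ row A v) : cand p A (ball3 A v) v w = true := by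
  have h1 : tb (ball3 A v) w = false := by
    rw [Bool.eq_false_iff]
    intro hcon
    simp only [ball3, tb_lor, Bool.or_eq_true, tb_pow, tb_orAll] at hcon
    rcases hcon with rfl | ⟨x, hx, rfl | ⟨y, hy, rfl | ⟨z, hz, rfl⟩⟩⟩
    · exact h.ne rfl
    · exact hb hx
    · obtain ⟨hx', ex⟩ := hA v hv x hx
      exact hG.tri h (hA x hx' y hy).2.symm ex.symm
    · obtain ⟨hx', ex⟩ := hA v hv x hx
      obtain ⟨hy', ey⟩ := hA x hx' y hy
      obtain ⟨hz', ez⟩ := hA y hy' z hz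
      refine hG.sq ex ey ez h.symm ?_ ?_
      · intro e; rw [← hl.inj _ hv _ hy' e] at hz; exact hb hz
      · intro e; rw [hl.inj _ hx' _ hz' e] at hx; exact hb hx
  have h2 : (row A w).length < dig p.deg w := by
    by_contra hc
    exact hb (hW.symm _ _ ((hl.adj_iff_of_full hA hW hw hv (by omega)).1 h.symm))
  have h3 := hl.col v hv w hw h
  have h4 := hl.col w hw v hv h.symm
  simp only [CageCount.cand, br_eq, len_eq, h1, (Nat.blt_eq ..).mpr h2, cond_true, cond_false]
  rw [Nat.ble_eq_true_of_le h3, cond_true, Nat.ble_eq_true_of_le h4]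

lemma permOK_spec {c : ℕ} (h : permOK p c = true) :
    (∀ i < p.n, dig c i < p.n) ∧
    (∀ j < p.n, ∃ i < p.n, dig c i = j) ∧
    (∀ i < p.n, ∀ j < p.n, dig c i = dig c j → i = j) ∧
    (∀ i < p.n, dig p.mark (dig c i) = dig p.mark i) := by
  simp only [permOK, br_eq, allB_eq, Bool.cond_false_right, Bool.and_eq_true, List.all_eq_true,
    List.mem_range] at h
  obtain ⟨h2, h1⟩ := h
  have hor : ∀ j, (∃ i < p.n, dig c i = j) ↔ j < p.n := fun j => by
    have h3 : tb (orAll (fun i => Nat.pow 2 (dig c i)) (List.range p.n)) j = true ↔ j < p.n := by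
      rw [Nat.eq_of_beq_eq_true h2, tb_eq]
      change (2 ^ p.n - 1).testBit j = true ↔ _
      rw [Nat.testBit_two_pow_sub_one]; simp
    rw [← h3, tb_orAll]
    simp only [tb_pow, List.mem_range]
  have hlt : ∀ i < p.n, dig c i < p.n := fun i hi => (hor _).1 ⟨i, hi, rfl⟩
  have hsurj : ∀ j < p.n, ∃ i < p.n, dig c i = j := fun j hj => (hor j).2 hj
  refine ⟨hlt, hsurj, fun i hi j hj hij => ?_, fun i hi => Nat.eq_of_beq_eq_true (h1 i hi)⟩
  let f : Fin p.n → Fin p.n := fun i => ⟨dig c i, hlt i i.2⟩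
  have hf : Function.Surjective f := fun j => by
    obtain ⟨i, hi, h⟩ := hsurj j j.2
    exact ⟨⟨i, hi⟩, Fin.ext h⟩
  have := Finite.injective_iff_surjective.2 hf (a₁ := ⟨i, hi⟩) (a₂ := ⟨j, hj⟩) (Fin.ext hij)
  exact congrArg Fin.val this

variable (cls : List (List (List ℕ)))

/-- Every graph extending `A` is classified. -/
def Solved (p : Prob) (G : SimpleGraph V) (A : List (List ℕ)) : Prop :=
  ∀ l : ℕ → V, Lab p G l → Sub p G A l → Classified p cls G l

lemma solved_of_closeOK {R C : List (List ℕ)} {c : ℕ} (h : closeOK p R C c = true)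
    (hR : Solved cls p G R) (hWR : WF p.n R) : Solved cls p G C := by
  simp only [closeOK, br_eq, allB_eq, Bool.cond_false_right, Bool.and_eq_true, List.all_eq_true,
    List.mem_range, memb_iff] at h
  obtain ⟨hp, h⟩ := h
  obtain ⟨hlt, hs, hi, hm⟩ := permOK_spec hp
  have hdeg := fun i hi => Nat.eq_of_beq_eq_true (h i hi).1
  have hcol := fun i hi => Nat.eq_of_beq_eq_true (h i hi).2.1
  intro l hl hC
  have hj' : ∀ i j, j ∈ row R i → j < p.n := fun i j hj => by
    by_contra hcon
    have := hWR.symm i j hj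
    rw [row_eq, List.getD_eq_default _ _ (by rw [hWR.length]; omega)] at this
    simp at this
  have := hR (fun i => l (dig c i))
    { inj := fun i hi' j hj' e => hi i hi' j hj' (hl.inj _ (hlt i hi') _ (hlt j hj') e)
      surj := fun x => by
        obtain ⟨j, hj, rfl⟩ := hl.surj x
        obtain ⟨i, hi', rfl⟩ := hs j hj
        exact ⟨i, hi', rfl⟩
      deg := fun i hi' => by rw [hl.deg _ (hlt i hi'), hdeg i hi']
      col := fun i hi' j hj' e => by
        have := hl.col _ (hlt i hi') _ (hlt j hj') e
        rwa [hcol i hi', hcol j hj'] at this }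
    (fun i hi' j hj => ⟨hj' i j hj, (hC _ (hlt i hi') _ ((h i hi').2.2 j hj)).2⟩)
  obtain ⟨k, hk, l', h1, h2, h3, h4⟩ := this
  refine ⟨k, hk, l', h1, h2, h3, fun i hi' => ?_⟩
  obtain ⟨j, hj, h5, h6⟩ := h4 i hi'
  exact ⟨_, hlt j hj, h5, (hm j hj).trans h6⟩

lemma solved_of_leafOK {A : List (List ℕ)} {c : ℕ} (h : leafOK p cls A c = true)
    (hW : WF p.n A) : Solved cls p G A := by
  simp only [leafOK, br_eq, allB_eq, anyB_eq, len_eq, Bool.cond_false_right, Bool.and_eq_true, List.all_eq_true,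
    List.mem_range, memb_iff, List.any_eq_true, Nat.blt_eq] at h
  obtain ⟨hk, hp, h⟩ := h
  obtain ⟨hlt, hs, hi, hm⟩ := permOK_spec hp
  set t := Nat.shiftRight c 10
  intro l hl hA
  refine ⟨Nat.mod c 1024, hk, fun i => l (dig t i),
    fun i hi' j hj' e => hi i hi' j hj' (hl.inj _ (hlt i hi') _ (hlt j hj') e), fun x => ?_,
    fun i hi' j hj' => ?_, fun i hi' => ⟨_, hlt i hi', rfl, hm i hi'⟩⟩
  · obtain ⟨j, hj, rfl⟩ := hl.surj x
    obtain ⟨i, hi', rfl⟩ := hs j hj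
    exact ⟨i, hi', rfl⟩
  · obtain ⟨h1, h2, h3⟩ := h i hi'
    rw [hl.adj_iff_of_full hA hW (hlt i hi') (hlt j hj')
      (Nat.eq_of_beq_eq_true h1).ge]
    refine ⟨fun h4 => ?_, fun h4 => (h2 j h4).2⟩
    obtain ⟨j', hj1, hj2⟩ := h3 _ h4
    exact hi j' (h2 j' hj1).1 j hj' (Nat.eq_of_beq_eq_true hj2) ▸ hj1

lemma mem_news_or {A : List (List ℕ)} {b v : ℕ} {nx : List (List (List ℕ))} {w : ℕ}
    (hc : cand p A b v w = true) :
    ∀ (ws : List ℕ) (c : ℕ), w ∈ ws → closes p nx A b v ws c = true →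
      addE v w A ∈ news p A b v ws c ∨ ∃ R ∈ nx, ∃ c', closeOK p R (addE v w A) c' = true := by
  intro ws
  induction ws with
  | nil => simp
  | cons x ws ih =>
    intro c hw h
    rw [closes_cons] at h
    rw [news_cons]
    by_cases hx : cand p A b v x = true
    · rw [hx, cond_true] at h
      rw [hx, cond_true]
      by_cases hb : Nat.beq (Nat.mod c 32) 0 = true
      · rw [hb, cond_true] at h
        rw [hb, cond_true]
        rcases List.mem_cons.1 hw with rfl | hw
        · exact .inl (by simp)
        · rcases ih _ hw h with h | h
          · exact .inl (List.mem_cons_of_mem _ h)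
          · exact .inr h
      · rw [Bool.not_eq_true] at hb
        simp only [hb, cond_false, Bool.cond_false_right, Bool.and_eq_true] at h
        rw [hb, cond_false]
        rcases List.mem_cons.1 hw with rfl | hw
        · have hk := h.1.1
          rw [Nat.blt_eq, len_eq] at hk
          exact .inr ⟨_, List.getElem_mem hk, _, by
            rw [← List.getD_eq_getElem _ [] hk, ← ent_eq]; exact h.1.2⟩
        · exact ih _ hw h.2
    · have hwx : w ≠ x := by rintro rfl; exact hx hc
      rw [Bool.not_eq_true] at hx
      rw [hx, cond_false] at h
      rw [hx, cond_false]
      exact ih _ ((List.mem_cons.1 hw).resolve_left hwx) h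

lemma all2_flat2 {β : Type} {f : β → ℕ → Bool} {g : β → ℕ → List β} {A : β} :
    ∀ (cur : List β) (cs : List ℕ), all2 f cur cs = true → A ∈ cur →
      ∃ c, f A c = true ∧ ∀ B ∈ g A c, B ∈ flat2 g cur cs := by
  intro cur
  induction cur with
  | nil => simp
  | cons a as ih =>
    intro cs h hA
    cases cs with
    | nil => simp [all2] at h
    | cons c cs =>
      simp only [all2, br_eq, Bool.cond_false_right, Bool.and_eq_true] at h
      rcases List.mem_cons.1 hA with rfl | hA
      · exact ⟨c, h.1, fun B hB => by simp [flat2, hB]⟩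
      · obtain ⟨c', h1, h2⟩ := ih cs h.2 hA
        exact ⟨c', h1, fun B hB => by simp [flat2, h2 B hB]⟩

lemma mem_flat2 {β : Type} {f : β → ℕ → Bool} {g : β → ℕ → List β} {B : β} :
    ∀ (cur : List β) (cs : List ℕ), all2 f cur cs = true → B ∈ flat2 g cur cs →
      ∃ A ∈ cur, ∃ c, f A c = true ∧ B ∈ g A c := by
  intro cur
  induction cur with
  | nil => intro cs _ h; simp [flat2] at h
  | cons a as ih =>
    intro cs h hB
    cases cs with
    | nil => simp [all2] at h
    | cons c cs =>
      simp only [all2, br_eq, Bool.cond_false_right, Bool.and_eq_true] at h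
      rw [flat2, List.mem_append] at hB
      rcases hB with hB | hB
      · exact ⟨a, by simp, c, h.1, hB⟩
      · obtain ⟨A, hA, h'⟩ := ih cs h.2 hB
        exact ⟨A, List.mem_cons_of_mem _ hA, h'⟩

lemma solved_of_stepOK (hG : Sparse G) {nx : List (List (List ℕ))} {A : List (List ℕ)} {c : ℕ}
    (hW : WF p.n A) (h : stepOK p nx A c = true)
    (hnews : ∀ B ∈ news p A (ball3 A (Nat.mod c 32)) (Nat.mod c 32) (List.range p.n)
      (Nat.shiftRight c 5), B ∈ nx)
    (hnx : ∀ B ∈ nx, WF p.n B ∧ Solved cls p G B) : Solved cls p G A := by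
  simp only [stepOK, br_eq, len_eq, forceNat_eq, Bool.cond_false_right, Bool.and_eq_true, Nat.blt_eq] at h
  obtain ⟨hv, hneed, h⟩ := h
  intro l hl hA
  obtain ⟨w, hw, hadj, hb⟩ := hl.exists_new hv hneed
  have hS : Solved cls p G (addE (Nat.mod c 32) w A) := by
    rcases mem_news_or (hl.cand hG hA hW hv hw hadj hb) _ _ (List.mem_range.2 hw) h with
      h | ⟨R, hR, c', h⟩
    · exact (hnx _ (hnews _ h)).2
    · exact solved_of_closeOK cls h (hnx R hR).2 (hnx R hR).1
  have hne : Nat.mod c 32 ≠ w := fun e => by rw [← e] at hadj; exact hadj.ne rfl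
  refine hS l hl fun i hi j hij => ?_
  rw [row_addE hW.length hv hw hne] at hij
  split_ifs at hij with h1 h2
  · subst h1
    rcases List.mem_cons.1 hij with rfl | h
    · exact ⟨hv, hadj.symm⟩
    · exact hA _ hi j h
  · subst h2
    rcases List.mem_cons.1 hij with rfl | h
    · exact ⟨hw, hadj⟩
    · exact hA _ hi j h
  · exact hA i hi j hij

theorem solved_of_run (hG : Sparse G) (lf : List ℕ) :
    ∀ (lv : List (List ℕ)) (cur : List (List (List ℕ))), run p cls lf lv cur = true →
      (∀ A ∈ cur, WF p.n A) → ∀ A ∈ cur, Solved cls p G A := by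
  intro lv
  induction lv with
  | nil =>
    intro cur h hW A hA
    obtain ⟨c, hc, -⟩ := all2_flat2 (g := fun _ _ => []) cur lf h hA
    exact solved_of_leafOK cls hc (hW A hA)
  | cons cs lv ih =>
    intro cur h hW A hA
    simp only [run, br_eq, forceList_eq forceGraph_eq, Bool.cond_false_right, Bool.and_eq_true] at h
    obtain ⟨c, hc, hn⟩ := all2_flat2 (g := fun A c => forceNat
      (fun b => news p A b (Nat.mod c 32) (List.range p.n) (Nat.shiftRight c 5))
        (ball3 A (Nat.mod c 32))) cur cs h.1 hA
    simp only [forceNat_eq] at hn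
    have hWn : ∀ B ∈ nextLevel p cur cs, WF p.n B := fun B hB => by
      obtain ⟨A, hA, c, h1, h2⟩ := mem_flat2 cur cs h.1 hB
      rw [forceNat_eq] at h2
      simp only [stepOK, br_eq, len_eq, Bool.cond_false_right, Bool.and_eq_true, Nat.blt_eq] at h1
      exact (hW A hA).of_mem_news h1.1 _ _ (fun w hw => List.mem_range.1 hw) h2
    exact solved_of_stepOK cls hG (hW A hA) hc (fun B hB => by
      simp only [nextLevel, forceNat_eq]; exact hn B hB)
      (fun B hB => ⟨hWn B hB, ih _ h.2 hWn B hB⟩)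

end Soundness

end

/-! ### Search problems, classes and certificates -/

/-- The graph with the given list of edges. -/
def edgesGraph (n : ℕ) (es : List (ℕ × ℕ)) : List (List ℕ) :=
  es.foldr (fun e A => addE e.1 e.2 A) (List.replicate n [])

/-- Edges of the binary tree with seven vertices rooted at `o`. -/
def treeR (o : ℕ) : List (ℕ × ℕ) :=
  [(o, o + 1), (o, o + 2), (o + 1, o + 3), (o + 1, o + 4), (o + 2, o + 5), (o + 2, o + 6)]

/-- Edges of the ball of radius two around `o`. -/
def treeU (o : ℕ) : List (ℕ × ℕ) :=
  [(o, o + 1), (o, o + 2), (o, o + 3), (o + 1, o + 4), (o + 1, o + 5), (o + 2, o + 6),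
    (o + 2, o + 7), (o + 3, o + 8), (o + 3, o + 9)]

/-- Initial data of the search `P11`. -/
def probP11 : Prob where
  n := 11
  deg := 3486657776028770
  col := 0
  mark := 1

/-- Graphs found by the search `P11`. -/
def clsP11 : List (List (List ℕ)) :=
  [[[5, 7], [2, 3, 4], [1, 5, 6], [1, 7, 8], [1, 9, 10], [0, 2, 9], [2, 8, 10], [0, 3, 10], [3,
    6, 9], [4, 5, 8], [4, 6, 7]]]

/-- Certificate for the search `P11`. -/
def certP11 : List (List ℕ) :=
  [[13863900013224757365309818873436175307434563207629906855490552365061],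
    [433246875413273667620259913628289762163426263589823076736241239040,
    11267831784828404278263813],
    [11267831784828404277215237, 352119743275887633695751, 12145064531473500997671],
    [352119743275887633630216, 9, 9, 9710096634813960161321],
    [9, 8, 6, 7279878804374844082216],
    [6, 6, 11467949305313183279954294803228153952075808, 232844397565273958319104],
    [10, 7, 8570031675756804833312]]

/-- Final certificate for the search `P11`. -/
def leafP11 : List ℕ :=
  [11862734482364727296]

theorem runP11 : run probP11 clsP11 leafP11 certP11 [edgesGraph 11 (treeU 1)] = true := by
  decide +kernel

/-- Initial data of the search `A13`. -/
def probA13 : Prob where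
  n := 13
  deg := 3570337562653461602
  col := 0
  mark := 1

/-- Graphs found by the search `A13`. -/
def clsA13 : List (List (List ℕ)) :=
  [[[1, 2], [0, 7, 9], [0, 8, 11], [4, 5, 6], [3, 7, 8], [3, 9, 10], [3, 11, 12], [1, 4, 10], [2,
    4, 12], [1, 5, 11], [5, 7, 12], [2, 6, 9], [6, 8, 10]],
    [[1, 2], [0, 7, 9], [0, 8, 12], [4, 5, 6], [3, 7, 8], [3, 9, 10], [3, 11, 12], [1, 4, 10], [2,
    4, 11], [1, 5, 11], [5, 7, 12], [6, 8, 9], [2, 6, 10]],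
    [[1, 2], [0, 7, 9], [0, 10, 11], [4, 5, 6], [3, 7, 8], [3, 9, 10], [3, 11, 12], [1, 4, 11],
    [4, 10, 12], [1, 5, 12], [2, 5, 8], [2, 6, 7], [6, 8, 9]],
    [[1, 2], [0, 7, 9], [0, 8, 10], [4, 5, 6], [3, 7, 8], [3, 9, 10], [3, 11, 12], [1, 4, 11], [2,
    4, 12], [1, 5, 12], [2, 5, 11], [6, 7, 10], [6, 8, 9]]]

/-- Certificate for the search `A13`. -/
def certA13 : List (List ℕ) :=
  [[850224321249394567907060852072916108834974144045123781596304525808535604109416173308854885005713853240500728915442905646081],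
    [581921186657134094428226374100176129530197661649872756130285109420964709377],
    [14094006925543780703267749895],
    [14094006925543780703267749897, 14932392933626809086379049],
    [14094006925543780703267749896, 10, 11],
    [11, 11, 11, 11, 12, 10],
    [11, 14934825525978020356030507, 14932392933626809086378018, 2, 8, 8, 2, 8,
    12443849875257153181188130, 318377569630246827922031618, 2],
    [12, 2, 8, 12, 8, 2, 8, 8, 13761246045875137073383458, 13761246045875137073383458]]

/-- Final certificate for the search `A13`. -/
def leafA13 : List ℕ :=
  [14584790552712910503936, 14584790552712910503937, 14584790552712910503938,
    14584790552712910503939]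

theorem runA13 : run probA13 clsA13 leafA13 certA13 [edgesGraph 13 ([(0, 1), (0, 2)] ++ treeU 3)] = true := by
  decide +kernel

/-- Initial data of the search `X17`. -/
def probX17 : Prob where
  n := 17
  deg := 3743770280096916153928802
  col := 0
  mark := 1

/-- Graphs found by the search `X17`. -/
def clsX17 : List (List (List ℕ)) :=
  [[[1, 2], [0, 3, 4], [0, 5, 6], [1, 5, 11], [1, 14, 15], [2, 3, 12], [2, 11, 13], [8, 9, 10],
    [7, 11, 12], [7, 13, 14], [7, 15, 16], [3, 6, 8], [5, 8, 16], [6, 9, 15], [4, 9, 16], [4,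
    10, 13], [10, 12, 14]],
    [[1, 2], [0, 3, 4], [0, 5, 6], [1, 5, 11], [1, 6, 15], [2, 3, 12], [2, 4, 16], [8, 9, 10], [7,
    11, 12], [7, 13, 14], [7, 15, 16], [3, 8, 13], [5, 8, 14], [9, 11, 15], [9, 12, 16], [4,
    10, 13], [6, 10, 14]],
    [[1, 2], [0, 3, 4], [0, 5, 6], [1, 5, 11], [1, 6, 16], [2, 3, 12], [2, 4, 15], [8, 9, 10], [7,
    11, 12], [7, 13, 14], [7, 15, 16], [3, 8, 13], [5, 8, 14], [9, 11, 15], [9, 12, 16], [6,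
    10, 13], [4, 10, 14]],
    [[1, 2], [0, 3, 4], [0, 5, 6], [1, 5, 11], [1, 13, 16], [2, 3, 12], [2, 14, 15], [8, 9, 10],
    [7, 11, 12], [7, 13, 14], [7, 15, 16], [3, 8, 13], [5, 8, 15], [4, 9, 11], [6, 9, 16], [6,
    10, 12], [4, 10, 14]],
    [[1, 2], [0, 3, 4], [0, 5, 6], [1, 5, 11], [1, 13, 16], [2, 3, 12], [2, 14, 16], [8, 9, 10],
    [7, 11, 12], [7, 13, 14], [7, 15, 16], [3, 8, 13], [5, 8, 15], [4, 9, 11], [6, 9, 15],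
    [10, 12, 14], [4, 6, 10]],
    [[1, 2], [0, 3, 4], [0, 5, 6], [1, 5, 11], [1, 14, 15], [2, 3, 12], [2, 13, 16], [8, 9, 10],
    [7, 11, 12], [7, 13, 14], [7, 15, 16], [3, 8, 13], [5, 8, 15], [6, 9, 11], [4, 9, 16], [4,
    10, 12], [6, 10, 14]],
    [[1, 2], [0, 3, 4], [0, 5, 6], [1, 5, 11], [1, 14, 16], [2, 3, 12], [2, 13, 16], [8, 9, 10],
    [7, 11, 12], [7, 13, 14], [7, 15, 16], [3, 8, 13], [5, 8, 15], [6, 9, 11], [4, 9, 15],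
    [10, 12, 14], [4, 6, 10]],
    [[1, 2], [0, 3, 4], [0, 5, 6], [1, 5, 11], [1, 6, 16], [2, 3, 12], [2, 4, 14], [8, 9, 10], [7,
    11, 12], [7, 13, 14], [7, 15, 16], [3, 8, 13], [5, 8, 15], [9, 11, 16], [6, 9, 15], [10,
    12, 14], [4, 10, 13]],
    [[1, 2], [0, 3, 4], [0, 5, 6], [1, 5, 11], [1, 6, 14], [2, 3, 12], [2, 4, 16], [8, 9, 10], [7,
    11, 12], [7, 13, 14], [7, 15, 16], [3, 8, 13], [5, 8, 15], [9, 11, 16], [4, 9, 15], [10,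
    12, 14], [6, 10, 13]],
    [[1, 2], [0, 3, 4], [0, 5, 6], [1, 5, 11], [1, 6, 16], [2, 3, 13], [2, 4, 11], [8, 9, 10], [7,
    11, 12], [7, 13, 14], [7, 15, 16], [3, 6, 8], [8, 14, 15], [5, 9, 15], [9, 12, 16], [10,
    12, 13], [4, 10, 14]],
    [[1, 2], [0, 3, 4], [0, 5, 6], [1, 5, 11], [1, 12, 15], [2, 3, 13], [2, 11, 14], [8, 9, 10],
    [7, 11, 12], [7, 13, 14], [7, 15, 16], [3, 6, 8], [4, 8, 16], [5, 9, 15], [6, 9, 16], [4,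
    10, 13], [10, 12, 14]],
    [[1, 2], [0, 3, 4], [0, 5, 6], [1, 5, 11], [1, 12, 16], [2, 3, 13], [2, 11, 14], [8, 9, 10],
    [7, 11, 12], [7, 13, 14], [7, 15, 16], [3, 6, 8], [4, 8, 15], [5, 9, 15], [6, 9, 16], [10,
    12, 13], [4, 10, 14]],
    [[1, 2], [0, 3, 4], [0, 5, 6], [1, 5, 11], [1, 13, 16], [2, 3, 13], [2, 11, 15], [8, 9, 10],
    [7, 11, 12], [7, 13, 14], [7, 15, 16], [3, 6, 8], [8, 14, 15], [4, 5, 9], [9, 12, 16], [6,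
    10, 12], [4, 10, 14]],
    [[1, 2], [0, 3, 4], [0, 5, 6], [1, 5, 11], [1, 13, 16], [2, 3, 13], [2, 11, 15], [8, 9, 10],
    [7, 11, 12], [7, 13, 14], [7, 15, 16], [3, 6, 8], [8, 14, 16], [4, 5, 9], [9, 12, 15], [6,
    10, 14], [4, 10, 12]],
    [[1, 2], [0, 3, 4], [0, 5, 6], [1, 5, 11], [1, 14, 15], [2, 3, 13], [2, 11, 15], [8, 9, 10],
    [7, 11, 12], [7, 13, 14], [7, 15, 16], [3, 6, 8], [8, 13, 16], [5, 9, 12], [4, 9, 16], [4,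
    6, 10], [10, 12, 14]],
    [[1, 2], [0, 3, 4], [0, 5, 6], [1, 5, 11], [1, 14, 16], [2, 3, 13], [2, 11, 15], [8, 9, 10],
    [7, 11, 12], [7, 13, 14], [7, 15, 16], [3, 6, 8], [8, 13, 16], [5, 9, 12], [4, 9, 15], [6,
    10, 14], [4, 10, 12]],
    [[1, 2], [0, 3, 4], [0, 5, 6], [1, 5, 11], [1, 12, 16], [2, 3, 13], [2, 11, 15], [8, 9, 10],
    [7, 11, 12], [7, 13, 14], [7, 15, 16], [3, 6, 8], [4, 8, 14], [5, 9, 16], [9, 12, 15], [6,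
    10, 14], [4, 10, 13]],
    [[1, 2], [0, 3, 4], [0, 5, 6], [1, 5, 11], [1, 14, 16], [2, 3, 13], [2, 11, 15], [8, 9, 10],
    [7, 11, 12], [7, 13, 14], [7, 15, 16], [3, 6, 8], [8, 14, 15], [5, 9, 16], [4, 9, 12], [6,
    10, 12], [4, 10, 13]],
    [[1, 2], [0, 3, 4], [0, 5, 6], [1, 5, 11], [1, 12, 14], [2, 3, 13], [2, 11, 15], [8, 9, 10],
    [7, 11, 12], [7, 13, 14], [7, 15, 16], [3, 6, 8], [4, 8, 16], [5, 9, 16], [4, 9, 15], [6,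
    10, 14], [10, 12, 13]],
    [[1, 2], [0, 3, 4], [0, 5, 6], [1, 5, 11], [1, 14, 15], [2, 3, 13], [2, 11, 15], [8, 9, 10],
    [7, 11, 12], [7, 13, 14], [7, 15, 16], [3, 6, 8], [8, 14, 16], [5, 9, 16], [4, 9, 12], [4,
    6, 10], [10, 12, 13]],
    [[1, 2], [0, 3, 4], [0, 5, 6], [1, 5, 11], [1, 14, 16], [2, 3, 13], [2, 12, 15], [8, 9, 10],
    [7, 11, 12], [7, 13, 14], [7, 15, 16], [3, 8, 14], [6, 8, 16], [5, 9, 15], [4, 9, 11], [6,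
    10, 13], [4, 10, 12]],
    [[1, 2], [0, 3, 4], [0, 5, 6], [1, 5, 11], [1, 14, 16], [2, 3, 13], [2, 12, 16], [8, 9, 10],
    [7, 11, 12], [7, 13, 14], [7, 15, 16], [3, 8, 14], [6, 8, 15], [5, 9, 15], [4, 9, 11],
    [10, 12, 13], [4, 6, 10]],
    [[1, 2], [0, 3, 4], [0, 5, 6], [1, 5, 11], [1, 12, 15], [2, 3, 13], [2, 14, 16], [8, 9, 10],
    [7, 11, 12], [7, 13, 14], [7, 15, 16], [3, 8, 14], [4, 8, 16], [5, 9, 15], [6, 9, 11], [4,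
    10, 13], [6, 10, 12]],
    [[1, 2], [0, 3, 4], [0, 5, 6], [1, 5, 11], [1, 12, 16], [2, 3, 13], [2, 14, 16], [8, 9, 10],
    [7, 11, 12], [7, 13, 14], [7, 15, 16], [3, 8, 14], [4, 8, 15], [5, 9, 15], [6, 9, 11],
    [10, 12, 13], [4, 6, 10]],
    [[1, 2], [0, 3, 4], [0, 5, 6], [1, 5, 11], [1, 6, 15], [2, 3, 13], [2, 4, 12], [8, 9, 10], [7,
    11, 12], [7, 13, 14], [7, 15, 16], [3, 8, 14], [6, 8, 16], [5, 9, 15], [9, 11, 16], [4,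
    10, 13], [10, 12, 14]],
    [[1, 2], [0, 3, 4], [0, 5, 6], [1, 5, 11], [1, 12, 15], [2, 3, 13], [2, 12, 16], [8, 9, 10],
    [7, 11, 12], [7, 13, 14], [7, 15, 16], [3, 8, 14], [4, 6, 8], [5, 9, 15], [9, 11, 16], [4,
    10, 13], [6, 10, 14]],
    [[1, 2], [0, 3, 4], [0, 5, 6], [1, 5, 11], [1, 6, 12], [2, 3, 13], [2, 4, 15], [8, 9, 10], [7,
    11, 12], [7, 13, 14], [7, 15, 16], [3, 8, 14], [4, 8, 16], [5, 9, 15], [9, 11, 16], [6,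
    10, 13], [10, 12, 14]],
    [[1, 2], [0, 3, 4], [0, 5, 6], [1, 5, 11], [1, 12, 16], [2, 3, 13], [2, 12, 15], [8, 9, 10],
    [7, 11, 12], [7, 13, 14], [7, 15, 16], [3, 8, 14], [4, 6, 8], [5, 9, 15], [9, 11, 16], [6,
    10, 13], [4, 10, 14]],
    [[1, 2], [0, 3, 4], [0, 5, 6], [1, 5, 11], [1, 6, 12], [2, 3, 13], [2, 4, 16], [8, 9, 10], [7,
    11, 12], [7, 13, 14], [7, 15, 16], [3, 8, 14], [4, 8, 15], [5, 9, 15], [9, 11, 16], [10,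
    12, 13], [6, 10, 14]],
    [[1, 2], [0, 3, 4], [0, 5, 6], [1, 5, 11], [1, 6, 16], [2, 3, 13], [2, 4, 12], [8, 9, 10], [7,
    11, 12], [7, 13, 14], [7, 15, 16], [3, 8, 14], [6, 8, 15], [5, 9, 15], [9, 11, 16], [10,
    12, 13], [4, 10, 14]],
    [[1, 2], [0, 3, 4], [0, 5, 6], [1, 5, 11], [1, 6, 12], [2, 3, 13], [2, 4, 16], [8, 9, 10], [7,
    11, 12], [7, 13, 14], [7, 15, 16], [3, 8, 15], [4, 8, 14], [5, 9, 15], [9, 12, 16], [10,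
    11, 13], [6, 10, 14]],
    [[1, 2], [0, 3, 4], [0, 5, 6], [1, 5, 11], [1, 6, 14], [2, 3, 13], [2, 4, 16], [8, 9, 10], [7,
    11, 12], [7, 13, 14], [7, 15, 16], [3, 8, 15], [8, 14, 16], [5, 9, 15], [4, 9, 12], [10,
    11, 13], [6, 10, 12]],
    [[1, 2], [0, 3, 4], [0, 5, 6], [1, 5, 11], [1, 12, 14], [2, 3, 13], [2, 12, 16], [8, 9, 10],
    [7, 11, 12], [7, 13, 14], [7, 15, 16], [3, 8, 15], [4, 6, 8], [5, 9, 15], [4, 9, 16], [10,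
    11, 13], [6, 10, 14]],
    [[1, 2], [0, 3, 4], [0, 5, 6], [1, 5, 11], [1, 12, 14], [2, 3, 13], [2, 14, 16], [8, 9, 10],
    [7, 11, 12], [7, 13, 14], [7, 15, 16], [3, 8, 15], [4, 8, 16], [5, 9, 15], [4, 6, 9], [10,
    11, 13], [6, 10, 12]],
    [[1, 2], [0, 3, 4], [0, 5, 6], [1, 5, 11], [1, 12, 16], [2, 3, 13], [2, 14, 16], [8, 9, 10],
    [7, 11, 12], [7, 13, 14], [7, 15, 16], [3, 8, 15], [4, 8, 14], [5, 9, 15], [6, 9, 12],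
    [10, 11, 13], [4, 6, 10]],
    [[1, 2], [0, 3, 4], [0, 5, 6], [1, 5, 11], [1, 14, 16], [2, 3, 13], [2, 12, 16], [8, 9, 10],
    [7, 11, 12], [7, 13, 14], [7, 15, 16], [3, 8, 15], [6, 8, 14], [5, 9, 15], [4, 9, 12],
    [10, 11, 13], [4, 6, 10]],
    [[1, 2], [0, 3, 4], [0, 5, 6], [1, 5, 11], [1, 12, 15], [2, 3, 13], [2, 14, 16], [8, 9, 10],
    [7, 11, 12], [7, 13, 14], [7, 15, 16], [3, 8, 15], [4, 8, 14], [5, 9, 16], [6, 9, 12], [4,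
    10, 11], [6, 10, 13]],
    [[1, 2], [0, 3, 4], [0, 5, 6], [1, 5, 11], [1, 14, 15], [2, 3, 13], [2, 12, 16], [8, 9, 10],
    [7, 11, 12], [7, 13, 14], [7, 15, 16], [3, 8, 15], [6, 8, 14], [5, 9, 16], [4, 9, 12], [4,
    10, 11], [6, 10, 13]],
    [[1, 2], [0, 3, 4], [0, 5, 6], [1, 5, 11], [1, 6, 15], [2, 3, 13], [2, 4, 14], [8, 9, 10], [7,
    11, 12], [7, 13, 14], [7, 15, 16], [3, 8, 15], [8, 14, 16], [5, 9, 16], [6, 9, 12], [4,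
    10, 11], [10, 12, 13]],
    [[1, 2], [0, 3, 4], [0, 5, 6], [1, 5, 11], [1, 14, 15], [2, 3, 13], [2, 12, 14], [8, 9, 10],
    [7, 11, 12], [7, 13, 14], [7, 15, 16], [3, 8, 15], [6, 8, 16], [5, 9, 16], [4, 6, 9], [4,
    10, 11], [10, 12, 13]],
    [[1, 2], [0, 3, 4], [0, 5, 6], [1, 5, 11], [1, 12, 16], [2, 3, 13], [2, 14, 15], [8, 9, 10],
    [7, 11, 12], [7, 13, 14], [7, 15, 16], [3, 8, 15], [4, 8, 14], [5, 9, 16], [6, 9, 12], [6,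
    10, 11], [4, 10, 13]],
    [[1, 2], [0, 3, 4], [0, 5, 6], [1, 5, 11], [1, 14, 16], [2, 3, 13], [2, 12, 15], [8, 9, 10],
    [7, 11, 12], [7, 13, 14], [7, 15, 16], [3, 8, 15], [6, 8, 14], [5, 9, 16], [4, 9, 12], [6,
    10, 11], [4, 10, 13]],
    [[1, 2], [0, 3, 4], [0, 5, 6], [1, 5, 11], [1, 6, 14], [2, 3, 13], [2, 4, 15], [8, 9, 10], [7,
    11, 12], [7, 13, 14], [7, 15, 16], [3, 8, 15], [8, 14, 16], [5, 9, 16], [4, 9, 12], [6,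
    10, 11], [10, 12, 13]],
    [[1, 2], [0, 3, 4], [0, 5, 6], [1, 5, 11], [1, 12, 14], [2, 3, 13], [2, 14, 15], [8, 9, 10],
    [7, 11, 12], [7, 13, 14], [7, 15, 16], [3, 8, 15], [4, 8, 16], [5, 9, 16], [4, 6, 9], [6,
    10, 11], [10, 12, 13]],
    [[1, 2], [0, 3, 4], [0, 5, 6], [1, 5, 11], [1, 6, 14], [2, 3, 13], [2, 4, 12], [8, 9, 10], [7,
    11, 12], [7, 13, 14], [7, 15, 16], [3, 8, 15], [6, 8, 16], [5, 9, 16], [4, 9, 15], [10,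
    11, 14], [10, 12, 13]],
    [[1, 2], [0, 3, 4], [0, 5, 6], [1, 11, 13], [1, 12, 15], [2, 11, 14], [2, 13, 15], [8, 9, 10],
    [7, 11, 12], [7, 13, 14], [7, 15, 16], [3, 5, 8], [4, 8, 16], [3, 6, 9], [5, 9, 16], [4,
    6, 10], [10, 12, 14]],
    [[1, 2], [0, 3, 4], [0, 5, 6], [1, 11, 13], [1, 12, 16], [2, 11, 14], [2, 13, 15], [8, 9, 10],
    [7, 11, 12], [7, 13, 14], [7, 15, 16], [3, 5, 8], [4, 8, 15], [3, 6, 9], [5, 9, 16], [6,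
    10, 12], [4, 10, 14]],
    [[1, 2], [0, 3, 4], [0, 5, 6], [1, 11, 13], [1, 12, 15], [2, 11, 14], [2, 12, 16], [8, 9, 10],
    [7, 11, 12], [7, 13, 14], [7, 15, 16], [3, 5, 8], [4, 6, 8], [3, 9, 15], [5, 9, 16], [4,
    10, 13], [6, 10, 14]],
    [[1, 2], [0, 3, 4], [0, 5, 6], [1, 11, 13], [1, 12, 16], [2, 11, 14], [2, 12, 15], [8, 9, 10],
    [7, 11, 12], [7, 13, 14], [7, 15, 16], [3, 5, 8], [4, 6, 8], [3, 9, 15], [5, 9, 16], [6,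
    10, 13], [4, 10, 14]],
    [[1, 2], [0, 3, 4], [0, 5, 6], [1, 11, 13], [1, 14, 15], [2, 11, 15], [2, 13, 16], [8, 9, 10],
    [7, 11, 12], [7, 13, 14], [7, 15, 16], [3, 5, 8], [8, 14, 16], [3, 6, 9], [4, 9, 12], [4,
    5, 10], [6, 10, 12]],
    [[1, 2], [0, 3, 4], [0, 5, 6], [1, 11, 13], [1, 12, 14], [2, 11, 15], [2, 13, 16], [8, 9, 10],
    [7, 11, 12], [7, 13, 14], [7, 15, 16], [3, 5, 8], [4, 8, 15], [3, 6, 9], [4, 9, 16], [5,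
    10, 12], [6, 10, 14]],
    [[1, 2], [0, 3, 4], [0, 5, 6], [1, 11, 13], [1, 12, 14], [2, 11, 15], [2, 13, 16], [8, 9, 10],
    [7, 11, 12], [7, 13, 14], [7, 15, 16], [3, 5, 8], [4, 8, 16], [3, 6, 9], [4, 9, 15], [5,
    10, 14], [6, 10, 12]],
    [[1, 2], [0, 3, 4], [0, 5, 6], [1, 11, 13], [1, 14, 16], [2, 11, 15], [2, 12, 16], [8, 9, 10],
    [7, 11, 12], [7, 13, 14], [7, 15, 16], [3, 5, 8], [6, 8, 13], [3, 9, 12], [4, 9, 15], [5,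
    10, 14], [4, 6, 10]],
    [[1, 2], [0, 3, 4], [0, 5, 6], [1, 11, 13], [1, 12, 16], [2, 11, 15], [2, 14, 16], [8, 9, 10],
    [7, 11, 12], [7, 13, 14], [7, 15, 16], [3, 5, 8], [4, 8, 13], [3, 9, 12], [6, 9, 15], [5,
    10, 14], [4, 6, 10]],
    [[1, 2], [0, 3, 4], [0, 5, 6], [1, 11, 13], [1, 12, 14], [2, 11, 15], [2, 12, 16], [8, 9, 10],
    [7, 11, 12], [7, 13, 14], [7, 15, 16], [3, 5, 8], [4, 6, 8], [3, 9, 15], [4, 9, 16], [5,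
    10, 13], [6, 10, 14]],
    [[1, 2], [0, 3, 4], [0, 5, 6], [1, 11, 13], [1, 12, 14], [2, 11, 15], [2, 14, 16], [8, 9, 10],
    [7, 11, 12], [7, 13, 14], [7, 15, 16], [3, 5, 8], [4, 8, 16], [3, 9, 15], [4, 6, 9], [5,
    10, 13], [6, 10, 12]],
    [[1, 2], [0, 3, 4], [0, 5, 6], [1, 11, 13], [1, 12, 16], [2, 11, 15], [2, 12, 14], [8, 9, 10],
    [7, 11, 12], [7, 13, 14], [7, 15, 16], [3, 5, 8], [4, 6, 8], [3, 9, 15], [6, 9, 16], [5,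
    10, 13], [4, 10, 14]],
    [[1, 2], [0, 3, 4], [0, 5, 6], [1, 11, 13], [1, 12, 16], [2, 11, 15], [2, 14, 16], [8, 9, 10],
    [7, 11, 12], [7, 13, 14], [7, 15, 16], [3, 5, 8], [4, 8, 14], [3, 9, 15], [6, 9, 12], [5,
    10, 13], [4, 6, 10]],
    [[1, 2], [0, 3, 4], [0, 5, 6], [1, 11, 13], [1, 12, 14], [2, 11, 15], [2, 12, 16], [8, 9, 10],
    [7, 11, 12], [7, 13, 14], [7, 15, 16], [3, 5, 8], [4, 6, 8], [3, 9, 16], [4, 9, 15], [5,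
    10, 14], [6, 10, 13]],
    [[1, 2], [0, 3, 4], [0, 5, 6], [1, 11, 13], [1, 12, 16], [2, 11, 15], [2, 12, 14], [8, 9, 10],
    [7, 11, 12], [7, 13, 14], [7, 15, 16], [3, 5, 8], [4, 6, 8], [3, 9, 16], [6, 9, 15], [5,
    10, 14], [4, 10, 13]]]

/-- Certificate for the search `X17`. -/
def certX17 : List (List ℕ) :=
  [[61264937101630311188033161569638030420607664782068588866757663273002840007870239395825218331985297021567427549532222625998918794885476531907519623756184825331641209018155196390016287747],
    [1510297304384388706765336661765671348447002602197603200267688067117042072421259734882686104670237695411928518001666081397279426564422826461113713254466563,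
    1510619852815759634757453877375061784466594525678394717413859053944043035525313035718330384593138163885259865801210489443184330053076301389885917859151907],
    [30081953353961028583536171829190391895188607618009771261706501530482007515946319399064911773701,
    816911679238102881837327881265019852170727260435108139319810917387],
    [30081953353961028583536171829190391895188607618009771261706501530482007515946319399064911773707,
    644429686769386674939642551542480907, 644429686769386674939642551643144197,
    816911679238102881837327881520231627361431108032639094893637272589,
    847476920092610551377895439590908019426232321177728012180096013],
    [30081953353961028583536171829190391895188607618009771261706501530482007515946319399064911773702,
    644429686769386674939642551542480908, 644429686769386674939642551643144198,
    644429686769386674939642551743807501, 668541410338171773290095304836109,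
    37239654516783485699288588524627813947865516202304025432241471809690929620522330652873440321557613931825061464450827027492,
    644429686769386674939642551945134093, 13,
    1011156511168599902601204038174673326040576926957426169566099883160174445992183493812396983301,
    816911679238102881837327882115746494175169647788414231203479060485,
    21395937106969736041255851750621198,
    1011156511168599902601204038279985617709134113655344197249811853853937820013760849037341754373,
    21395937106969736041255851754815503],
    [644429686769386674939642551475372045, 644429686769386674939642551576035341,
    25528489976190715057416496293519554367688803360419569676251566125,
    644429686769386674939642551743807501, 13, 644429686769386674939642551978688525,
    644429686769386674939642552079351821, 13, 20138427711543333591863829758771214,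
    644429686769386674939642552381341708, 14, 20891919073067867915315478289455, 4, 15,
    644429686769386674939642552884658182, 20138427711543333591863829779742734,
    668584658451586365166761236956174, 668541410338171812624057564005382, 15, 4,
    585039798983735566312404290274319,
    25528489976190715057416496365298513787015938790719666198998549508,
    25528489976190715057416496367956969778585770536636420076043437060,
    644429686769386674939642553622855685,
    847476920092610551377895441917057012049835098794293264784622597, 5, 5, 5,
    15667966847501076471920017300527, 668623034592804251289245369041936, 5, 5],
    [20138427711543333591863829732556813,
    797765311755959845544265508964814441166567403810714205835755565,
    26486887222749642002689572932126194075297421117819669429879853,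
    20138427711543333591863829735702532, 15, 15,
    797765311755959845544265509255583065243346604118350426403766310,
    18282492547094848695590621028399, 20138427711543333591863829744091140,
    20138427711543333591863829746188294, 15, 4, 585039761507035158258899873235974, 4, 16,
    668541410338171812589972702987279,
    797765311755959845544265510044812187741811550541645759771574316, 15,
    20138427711543333591863829765062660, 20138427711543333591863829767159820, 15,
    20891919073067867915315478298660, 12, 4, 16, 20891919073067867915315478305839,
    20891919073067867915315478306863, 15, 15, 15, 15, 15, 15,
    31598640974018743228349075979851514746614552273965879542793110868850472148909283938112926756,
    14, 4, 20894469831025133943504452525092,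
    26486887222749642002689573025587537528924318431368603355914276,
    33576118486096003752853465014131513747373837996618980956625275808746209536484542572862186532,
    16, 16, 14, 15, 21393325130821498003969842094309391, 15, 15, 15,
    20893270576612073911461288700975, 15, 15665416089543815082469601874991, 15,
    29378834699768651171409344823397633327861397363254008070366439679218033324009201815041186852,
    4, 14, 4, 20894469831025133943504452568100,
    26486887222749642002689573080106654543540008530938814812768292,
    33576118486096003752853465083242705154864491767127686624088516135035731583194467044960619556,
    16, 14, 20138427711543333591863829862580236, 12, 20138427711543333591863829867823109,
    668541410338171847526954678977541,
    31602739884021970356780908343987679306521560308778410254548484675953354891721421284410786852,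
    668584620974885957113256823915535, 15, 668541410338171847526954679141391,
    501254938724184161647730878317573, 20894469831025133943504452592677,
    26486887222749642002689573109957131227119373016097155843162149,
    26486887222749642002689573111260435694748974302121792788113445,
    501254938724184270753402500023300, 6, 4, 16, 4, 5, 668623034592804286192142483555333,
    668623034592804286192142483588101, 6, 668541410338171738387198192649220,
    18277392202327211349525099726885, 5, 16041384876438454703629438579408900, 6, 14,
    20135815735395095554577820183199748, 5,
    635519547469092671795824989034522497928551066262616618841998341,
    635519547469092671795824989034522497928551066262616618842031109],
    [15, 15, 18282493718241738767164489335855, 15, 15, 4, 14, 4, 4,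
    18282492547094848695590621023279, 18282492547094848695590621021222, 15, 15, 15, 15,
    668584620974885957113256820212740, 668584620974885957113256820081670, 15, 6, 15, 15, 15,
    4, 20894469831025133943504452486180,
    26486887222749642002689572974962643158209749053196264145979428, 4, 6, 12, 15,
    585039798983735531375422317364236, 20894469831025130531821910492204,
    668541410338171773290095305982991, 15, 15, 15, 4, 12, 12, 15, 15, 4, 15, 4,
    20894469831025133943504452519972,
    26486887222749642002689573017799092241122076988572858862079012, 4, 12,
    20891919073067867915315478327343, 20891919073067867915315478316076,
    15667966847501078790756720747558, 20891919073067867915315478318124, 15, 6,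
    20894469831025133943504452532271, 4, 15, 668623034592804286192142481261583,
    668541410338171773290095307293700, 668541410338171773290095307064326, 4, 6, 6, 12, 4, 4,
    12, 4, 6, 12,
    31598640974018743228349076022634633236965909369995078289308892632431870653408232922666763300,
    31598640974018743228349076024280137794287115412150047471867541211629240225947717288929046564,
    6, 6, 26483653752894076789734253252557309339760349602524996130947110, 12, 12, 14,
    18277392202327210258809564978212, 4, 15665414918396927330797588870180, 4, 4,
    20135815735395093178998320297705476, 4, 501374939120034447067355694367759, 12,
    15667966847501076470854865449007, 668541410338171812624057567183876, 15, 4, 12, 4,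
    668584658451586365166761240265743, 6, 20893270576612073911461288758319, 4, 6, 4,
    15667965676354191039084707770406, 20893270576612073911461288754220, 4, 6, 12,
    20890719818654809111393483150380, 20891919073067866823534791625774,
    18277392202327207939972861673508, 12, 14, 4, 20894469831025133943504452631588,
    26486887222749642002689573159289181636196129866028883833438244, 4, 4, 6,
    18282493718241736447262634206246, 18282493718241736447262634205222, 12, 12, 14,
    29378834699768651171409344933646438668382202187636943301780317589764674286825158530855603236,
    29378834699768651171409344935291943225703408229791912484338966174063559773892059471355749412,
    4, 4, 4, 15, 668503034196953891598676321338383, 12, 20894469831025133943504452663340,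
    20894469831025133943504452664364, 15, 18282492547094851014427324573743,
    545541005726177804949883522745359, 668541410338171847526954681566224, 4,
    461957770117109159307004705113092, 4,
    24930165992373745173258297425164902943760402709364693780260900, 6, 16, 6, 16,
    668502996720253483545171906987023, 15, 6, 20894469831025133943504452681766,
    20894469831025133943504452682790, 4, 20894469831025133943504452683812,
    26486887222749642002689573225490966582515182129792712031046692, 4, 12, 5,
    501293314865402117541924371432453, 501293314865402008436252749726725,
    26486887222749642002689573235875560299584837386853704689495076, 6, 6,
    19858274108735176514420311008756362075451248679133371078779940,
    19858274108735180836541252244986401349030427395115970898143268,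
    26483653752894075407088050811255103472653299111996069521701924,
    501374901643334148153607759037444, 668503034196953891598676321207310, 14, 6, 6,
    18282492547094847604875086353445, 18282492547094847604875086353445,
    26486887222749642002689573256644747733724147900975690006391845, 14, 14, 6,
    20894469831025133943504452715558,
    26486887222749642002689573265731267236160096250904058582534182,
    16042768816067721643682748513157124, 4, 5, 501336525502116301365085888513029,
    24926932522518182901127957023096260062599740506630039191956516, 6, 6,
    19859985858409144610973328533526482553367342559877151852864548,
    19859985858409148933094269765862299183045400554461879425312804],
    [14, 14, 14, 14, 14, 15, 15, 14, 12, 4, 20894469831025133943504452458532,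
    20893269405465186159789275615278, 20893269405465186159789275613220, 15,
    20894469831025133943504452460591, 6, 6, 15, 20894469831025133943504452463663, 4, 4,
    20893269405465186159789275619366, 20893269405465186159789275622436, 14, 14, 6,
    20894469831025133943504452470822, 6, 14, 14, 14, 4, 14, 6, 6, 14,
    585039761507035158258899873203206, 6, 584838174333252881493384206418948, 4, 15, 14, 14,
    12, 20893270576612072819680602000420, 15, 12, 12, 15, 20894469831025133943504452494383, 4,
    4, 12, 12, 4, 4, 12, 20894469831025133943504452503596, 12, 14, 14, 14, 4,
    20894469831025133943504452508708, 4, 14, 12, 12, 14, 12, 12, 4, 4,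
    20891919073067867915315478307884, 20891919073067867915315478321199,
    20891919073067867915315478308900, 20891919073067867915315478301732, 6, 6, 15,
    20894469831025133943504452525103, 20894469831025133943504452527142, 15, 15,
    20894469831025133943504452529188, 4, 20894469831025133943504452528164,
    20891919073067867915315478340646, 20891919073067867915315478341668, 4,
    20894469831025133943504452533284, 6, 20894469831025133943504452534310, 12, 4, 6, 4, 12, 6,
    4, 20894469831025133943504452544548, 4, 4, 501293314865402082639027259147270, 6,
    501293314865402008402167888872452, 4, 4, 4, 12, 12, 12, 14, 6, 14, 6, 14,
    20891919073067867915315478376486, 12, 6, 629244241731096661843697508844550,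
    18282492547094847603809934452774, 6, 6, 6, 629244241731096661843697509073926,
    18282492547094849923711789769764, 18282492547094849923711789769764,
    26486887222749642002689573090491248260609663787999807471217700,
    501336525502116266462188776260614, 6, 6, 501336525502116192225329406051332,
    20894469831025133943504452584484, 4, 20894469831025133943504452586532,
    26486887222749642002689573102173916192313025952193424211972132,
    15667966847501076470854865455148, 20890719818654809111393483144239,
    15667966847501076470854865455151, 20890719818654809111393483144236, 15,
    20891919073067869144501798967332, 4, 12, 12, 20891917901920979072927930652708, 4, 4,
    20894469831025133943504452596772, 20893270576612073911461288747046,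
    15667965676354191039084707776559, 20893270576612073911461288747055,
    15667965676354191039084707776550, 18282492547094847603809934499878, 6,
    18282492547094849923711789810724, 4, 4, 20894469831025133943504452601892,
    20893270576612073911461288744996, 20890718647507923679623325465636,
    501293314865402082639027259081734, 6, 501254901247483827797000970437636, 4, 4, 4,
    20891919073067866823534791624740, 20890719818654809111393483139108,
    585039798983735566312404293813260, 4, 4, 501293277388701600348663477175300, 4, 6, 6, 14,
    20893269405465185068008589058086, 6, 6, 20893269405465187387910444369956,
    20893269405465187387910444369956,
    26486887222749642002689573159289181636196129866028883833438244, 12, 12, 14, 14, 6, 14, 6,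
    14, 6, 12, 501336525502116266462188776162310, 6, 6, 501254901247483827797000972502020,
    20894469831025133943504452648996,
    26486887222749642002689573180053138816168399115826020978076708, 4,
    20894469831025133943504452651044,
    26486887222749642002689573183952591714236561101548741397253156,
    20890719818654809112458635025455, 20890719818654809112458635025455,
    20890719818654809112458635030566,
    19861507578590738786550651521161313201648144872483192437798950, 16, 6, 6, 6, 15,
    20891919073067869144501799032870, 4, 20894469831025133943504452659236, 6, 6, 12, 6,
    20894469831025133943504452661286, 6, 20893269405465188478625979095078, 6, 12,
    17054456028123752691011858528292, 16, 6, 6, 12, 501254901247483827797000970175494, 6, 4,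
    4, 6, 6, 6, 6, 6, 20894469831025133943504452683814, 6, 20894469831025133943504452684838,
    23167826960310305861591279009006870805876969490532916422464556,
    20890719818654809112458635027500, 12, 20894468659878246190767287605286,
    501293277388701709488419956294662, 6, 6, 20894469831025133943504452693030, 6,
    20894469831025133943504452694054, 6, 6, 14, 20894469831025133943504452697134,
    19861506093985687894841761201972254451535873462115462618870822, 6, 14,
    18281293292681792211570481213476, 629244241731096701177659771192324,
    19859985858409147550448067408929688213387817707464362146632742, 6, 4,
    20894469831025133943504452705316,
    26486887222749642002689573252750525089823027179577817759473700, 6, 6, 6, 6,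
    20894469831025133943504452713510, 6, 20894469831025133943504452714534],
    [14, 14, 16, 14, 16, 14, 14, 17053256773710693750749381263406, 16, 16, 6, 16, 16, 4, 14, 14,
    14, 16, 14, 14, 6, 14, 16, 14, 4, 14, 14, 6, 14, 18282492547094848695590621024294,
    18282492547094848695590621024294, 14, 18282492547094848695590621026340,
    18282492547094848695590621026340, 14, 16, 14, 14, 16, 16, 12, 16, 16, 4, 16, 14, 12, 16,
    14, 4, 14, 14, 12, 14, 16, 14, 14, 4, 14, 14, 12, 14, 14, 12,
    20894469831025133943504452469804, 14, 14, 4, 20894469831025133943504452471844,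
    19663882554096770682615547051052, 19663882554096770682615547050022, 16, 6, 16, 16, 16, 4,
    17048156428943055313968325206062, 14436179145012772385956349090862, 6, 12, 12, 16, 12, 6,
    16, 6, 12, 16, 12, 12, 16, 6, 4, 12, 6, 20894469831025133943504452477990, 12, 4,
    20894469831025133943504452480036, 6, 6, 4, 20894469831025133943504452482084,
    18233944474413474291640390648878, 14, 18233944474413474291640390649902, 12, 14, 6,
    20891919073067867915315478299694, 6, 6, 14, 12, 12, 12, 6, 6,
    20894469831025133943504452492326, 14, 12, 12, 12, 6, 12, 19663882554096770682615547075622,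
    19663882554096770682615547075622, 6, 11741143595125329511961682030636,
    19663882554096770682615547079718, 19663882554096770682615547074598,
    18276191776767264794996243474470, 6, 16, 4, 16, 14, 12, 14, 4, 12,
    14436180316159660137628362086444, 6, 14436180316159657817726506766380, 4, 6,
    19665234057640976678761357424684, 19665234057640976678761357423654,
    18282492547094847603809934404652, 6, 20894469831025133943504452500518,
    18282492547094849923711789720620, 4, 20894469831025133943504452501540,
    17053256773710694978870549965862, 6, 17053256773710692658968694645796,
    17053256773710692658968694645796, 15666767593088018758713556875310,
    15666767593088018758713556880428, 12, 14, 14, 15665414918396925010895733568548,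
    15665414918396925010895733568548, 12, 19663882554096771911801867650084,
    19663882554096771911801867650084, 14, 14, 6, 14438729902970036094243467975724, 6, 6,
    20894469831025133943504452505638, 14438729902970033774341612655660, 6,
    19665232886494090155210513088558, 17048155257796165242394456917038,
    14438729902970036094243467986988, 14436179145012772385956349119532, 14, 6, 14, 6,
    14438729902970036094243468010540, 18282493718241736447262634073126,
    20890718647507923679623325461548, 6, 20894469831025133943504452511782, 6,
    20890718647507921359721470139436, 6, 18276191776767262475094388157478,
    18276191776767264794996243471398, 6, 14437379570572718940485205372966, 16,
    15664216835130758461043828064294, 15664216835130758461043828064294,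
    18276192947914152546668256428078, 6, 15666766421941134417658933973030,
    15666766421941133326943399219244, 6, 14436179145012773476671883879468,
    14436179145012773476671883854886, 18276191776767264794996243436588,
    14437379570572717849769670609956, 12, 12, 6, 17048155257796167562296312216620,
    17053256773710694978870549985318, 17053256773710694978870549985318,
    18282492547094849923711789717542, 6, 18282492547094847603809934397476,
    18282492547094847603809934397476, 18282492547094851014427324459046,
    18282492547094851014427324459046, 17053256773710696069586084703270,
    17053256773710696069586084703270, 6, 6, 17053256773710694978870549949476,
    18282492547094849923711789705252, 19662683299683711879758703766574,
    15666767593088018759778708768812, 15666767593088018759778708768812,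
    19662683299683711879758703765548, 15666767593088018759778708766764,
    14437378399425831188813192377382, 14437378399425831188813192377382,
    15664216835130757370328293348396, 17048156428943055313968325218348, 6, 6,
    17048156428943052995131621791782, 14439929157383094897100311273510,
    14439929157383094897100311273510, 14436179145012772385956349104164,
    14436179145012770066054493788204, 20893269405465188478625979090980,
    20890718647507924770338860223526, 20890718647507924770338860223526,
    17053256773710694978870549979174, 18276191776767264794996243469350, 6,
    19665232886494091245926047828006, 19665232886494091245926047828006,
    17053256773710696069586084708390, 17053256773710696069586084708390, 6,
    17053256773710694978870549954596, 19665232886494090155210513074212]]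

/-- Final certificate for the search `X17`. -/
def leafX17 : List ℕ :=
  [20404755694360482366703566848, 20404755694360482366703566849, 20404755694360482366703566850,
    20404755694360482366703566851, 20404755694360482366703566852,
    20404755694360482366703566853, 20404755694360482366703566854,
    20404755694360482366703566855, 20404755694360482366703566856,
    20404755694360482366703566857, 20404755694360482366703566858,
    20404755694360482366703566859, 20404755694360482366703566860,
    20404755694360482366703566861, 20404755694360482366703566862,
    20404755694360482366703566863, 20404755694360482366703566864,
    20404755694360482366703566865, 20404755694360482366703566866,
    20404755694360482366703566867, 20404755694360482366703566868,
    20404755694360482366703566869, 20404755694360482366703566870,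
    20404755694360482366703566871, 20404755694360482366703566872,
    20404755694360482366703566873, 20404755694360482366703566874,
    20404755694360482366703566875, 20404755694360482366703566876,
    20404755694360482366703566877, 20404755694360482366703566878,
    20404755694360482366703566879, 20404755694360482366703566880,
    20404755694360482366703566881, 20404755694360482366703566882,
    20404755694360482366703566883, 20404755694360482366703566884,
    20404755694360482366703566885, 20404755694360482366703566886,
    20404755694360482366703566887, 20404755694360482366703566888,
    20404755694360482366703566889, 20404755694360482366703566890,
    20404755694360482366703566891, 20404755694360482366703566892,
    20404755694360482366703566893, 20404755694360482366703566894,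
    20404755694360482366703566895, 20404755694360482366703566896,
    20404755694360482366703566897, 20404755694360482366703566898,
    20404755694360482366703566899, 20404755694360482366703566900,
    20404755694360482366703566901, 20404755694360482366703566902,
    20404755694360482366703566903, 20404755694360482366703566904,
    20404755694360482366703566905, 20404755694360482366703566906,
    20404755694360482366703566907]

theorem runX17 : run probX17 clsX17 leafX17 certX17 [edgesGraph 17 (treeR 0 ++ treeU 7)] = true := by
  decide +kernel

/-- Initial data of the search `X19`. -/
def probX19 : Prob where
  n := 19
  deg := 3833620766819242141623094370
  col := 2555747177879493624993939456
  mark := 1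

/-- Graphs found by the search `X19`. -/
def clsX19 : List (List (List ℕ)) :=
  [[[1, 2], [0, 3, 4], [0, 5, 6], [1, 5, 7], [1, 6, 8], [2, 3, 8], [2, 4, 7], [3, 6, 13], [4, 5,
    18], [10, 11, 12], [9, 13, 14], [9, 15, 16], [9, 17, 18], [7, 10, 15], [10, 16, 17], [11,
    13, 17], [11, 14, 18], [12, 14, 15], [8, 12, 16]]]

/-- Certificate for the search `X19`. -/
def certX19 : List (List ℕ) :=
  [[32002270261497139240482636901000945331883020823433432948008326138954755],
    [770426632312380964475271580473099267,
    31252217052243301487927619619723812427179263624216850635372321832995],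
    [5, 770426632312381000180935326173266948],
    [4, 4],
    [4, 24075832259761906256744944477667364],
    [6],
    [1943925041073729475865535876068454161737201744958588911835477585040288367180148880817583255094143129179679987527711965167962056922953229118395925330254316942657652261895],
    [36924240608906305665095049509440658715224715475289269852225137789448535883647213381733757604328048197645],
    [23365962613079554755031260055485841423, 23365962613079554755031260055487938575],
    [730186331658736086094726876733899790, 15, 770343049075637347247182287418229777, 17],
    [15, 17, 14, 14, 14],
    [18, 17, 14, 24075832259761906256744944477667374, 16, 8],
    [16, 16, 18, 16]]

/-- Final certificate for the search `X19`. -/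
def leafX19 : List ℕ :=
  [23511554941173736578852484841472]

theorem runX19 : run probX19 clsX19 leafX19 certX19 [edgesGraph 19 (treeR 0 ++ treeU 9)] = true := by
  decide +kernel

/-- Initial data of the search `X21`. -/
def probX21 : Prob where
  n := 21
  deg := 3925627665222903953022048636002
  col := 3925627665222902789666701836288
  mark := 1

/-- Graphs found by the search `X21`. -/
def clsX21 : List (List (List ℕ)) :=
  [[[1, 2], [0, 3, 4], [0, 5, 6], [1, 5, 7], [1, 6, 8], [2, 3, 8], [2, 4, 7], [3, 6, 9], [4, 5,
    9], [7, 8, 15], [15, 17, 19], [12, 13, 14], [11, 15, 16], [11, 17, 18], [11, 19, 20], [9,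
    10, 12], [12, 18, 20], [10, 13, 20], [13, 16, 19], [10, 14, 18], [14, 16, 17]],
    [[1, 2], [0, 3, 4], [0, 5, 6], [1, 5, 7], [1, 6, 8], [2, 3, 8], [2, 4, 7], [3, 6, 9], [4, 5,
    10], [7, 10, 15], [8, 9, 20], [12, 13, 14], [11, 15, 16], [11, 17, 18], [11, 19, 20], [9,
    12, 17], [12, 18, 19], [13, 15, 19], [13, 16, 20], [14, 16, 17], [10, 14, 18]],
    [[1, 2], [0, 3, 4], [0, 5, 6], [1, 5, 7], [1, 6, 8], [2, 3, 8], [2, 4, 7], [3, 6, 9], [4, 5,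
    10], [7, 15, 17], [8, 15, 19], [12, 13, 14], [11, 15, 16], [11, 17, 18], [11, 19, 20], [9,
    10, 12], [12, 18, 20], [9, 13, 20], [13, 16, 19], [10, 14, 18], [14, 16, 17]],
    [[1, 2], [0, 3, 4], [0, 5, 6], [1, 5, 7], [1, 6, 8], [2, 3, 8], [2, 4, 7], [3, 6, 9], [4, 5,
    10], [7, 15, 17], [8, 16, 19], [12, 13, 14], [11, 15, 16], [11, 17, 18], [11, 19, 20], [9,
    12, 18], [10, 12, 20], [9, 13, 20], [13, 15, 19], [10, 14, 18], [14, 16, 17]],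
    [[1, 2], [0, 3, 4], [0, 5, 6], [1, 5, 7], [1, 6, 8], [2, 3, 8], [2, 4, 7], [3, 6, 9], [4, 5,
    10], [7, 15, 17], [8, 16, 20], [12, 13, 14], [11, 15, 16], [11, 17, 18], [11, 19, 20], [9,
    12, 18], [10, 12, 19], [9, 13, 20], [13, 15, 19], [14, 16, 18], [10, 14, 17]],
    [[1, 2], [0, 3, 4], [0, 5, 6], [1, 5, 7], [1, 6, 8], [2, 3, 8], [2, 4, 7], [3, 6, 9], [4, 5,
    10], [7, 15, 17], [8, 18, 19], [12, 13, 14], [11, 15, 16], [11, 17, 18], [11, 19, 20], [9,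
    12, 19], [12, 18, 20], [9, 13, 20], [10, 13, 16], [10, 14, 15], [14, 16, 17]],
    [[1, 2], [0, 3, 4], [0, 5, 6], [1, 5, 7], [1, 6, 8], [2, 3, 8], [2, 4, 7], [3, 6, 9], [4, 5,
    10], [7, 15, 17], [8, 16, 18], [12, 13, 14], [11, 15, 16], [11, 17, 18], [11, 19, 20], [9,
    12, 19], [10, 12, 20], [9, 13, 20], [10, 13, 19], [14, 15, 18], [14, 16, 17]]]

/-- Certificate for the search `X21`. -/
def certX21 : List (List ℕ) :=
  [[37292041226794341812834831915853290629877643435002942221265704112874584015875],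
    [876731675854571941208084124305220174851,
    36418009010541349428079670788415075371991890703692657130830147412421509155],
    [5, 876731675854571941243789788050920342532],
    [4, 4],
    [4, 27397864870455373163869521592126013476],
    [6],
    [876731675854571904645484448708282024967],
    [8],
    [1427586304002627799134066002365803145491503577745334858743422334336972590481484012155154791359964811126313734635535,
    59299615052481517941436861202756735341111010855053869043095980542805426407125084155027394200969262776990042089868188044311373421772761666132688077839],
    [44612072000082118722939562573931346443936059007482587558596187809023866406430045821435616252695164180564634796047,
    44612072000082118722939562573931350149282914601600841112867708087036920498662704938261558207302636514829973618698,
    35539328938534184559408436371655282784005225481907103740808507866030020756527,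
    44612072000082118722939562573931357559976625789837348221410748643063028683128023171913442116517581183360651264009,
    35539328938534184559408436371655288360040858925547005656183915451611768685583],
    [1394127250002566210091861330435354518476957225325733149420638364688041855009803633219457664855982125419748918282,
    26736819455527665573881813506538938073105,
    1394127250002566210091861330435354692165091081300026284777115877719903765583209529320673693978207391088436675594,
    1110604029329193267481513636614227543470562012022727311340814718589479160874,
    1110604029329193267481513636614227587026702303239274838902583595901174940721,
    36414453772837095526643356884800940578344182894036369770642819916048107569,
    1394127250002566210091861330435354923749269555932417131919085895095719646347750724122295066141174411980020352015,
    855578222576885298364218032209246286774287, 26736819455527665573881813506538948558865,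
    36414453772837094004921724065171429363228496999481038327057291298042032177],
    [835525607985239549183806672079341749258, 26736819455527665573881813506538938073098, 19,
    26736819455527665573881813506538942267407,
    1048878260825661218971633510253149052345716550916026617285926961229116473391,
    21914804614427858902656067350921481267,
    32770335175393405289988019768934161560756127461136144654886443508247302195,
    835525607985239549183806672079342076945, 26736819455527665573881813506538948558858,
    26736819455527665573881813506538950656018, 19,
    43566476562580194065370666576104855841175828287412463318844560307729731496151034803923056577097139180099613737,
    19, 32770335175393403768266386949304654429028844617842374771796204071459768371],
    [17, 835525607985239549183806672079341814794, 27397864870455373163869521592126015530, 10, 16,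
    835525607985239549183806672079341978642, 19, 27395188978843058442591414937559500850,
    24659008177980892812346435726227805232,
    29133325421017701993571816261814699795126710741130790366893129865262798898, 19,
    26736819455527665573881813506538951704593, 17, 26736819455527665573881813506538956947466,
    19, 36414453772837095526643356884800956909155007461673431333634847732473548842, 18,
    43566476562580194065370666576104872128077269128048517754064631202159795555166625254535940750273762567296921641,
    16, 29133325421017700471850183442185202191305701684113997458291898517985193010],
    [16, 20, 19, 10, 27397864870455373163869521592126016554, 10, 10, 19, 18,
    27395190206879577413688647637490729009, 876605807022324225248804166655352701961,
    22439472235553210879067937404253961748489, 16, 16,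
    835525607985239549183806672079342371856, 19, 16, 789088300992557140436081643772554478608,
    20, 876605807022324188614688420790818079763, 19, 876646086620146477238036724399704015882,
    16, 17, 701319057298294660267433818168931255306, 16,
    43566476562580194065370666576104890220591212458704052687031038809645408517637470730904902743508701620306199593,
    43566476562580194065370666576104892029842606791769606180327679570393970086110448815292569713531881471021697065,
    22439472235553210879067937404253985865737],
    [19, 16, 18, 16, 10, 27397864870455373163869521592126016554, 10,
    27397864870455373163869521592126017578, 16, 16, 19,
    32775774134108549753196277840475511334112833113275996770125273700293940266, 10,
    701233507361037839970873043882936173578, 10, 16, 27397864870455373163869521592126025776,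
    18, 10, 19, 27396607361059945615487119804279570480, 18, 19, 16, 16, 19, 16, 16,
    27395190206879577413688647637490751536, 27395190206879577413688647637490745386, 10, 16,
    18, 27395190206879577413688647637490750512, 27393932697484149865306245849644285994, 10,
    701233507361037839970873043882936927241, 27397864870455373163869521592126047273],
    [18, 18, 18, 18, 10, 20, 17, 24653660078865820283081920516888461360,
    23365969229912664060109124727310647338, 23365969229912664060109124727310647338,
    23370061047668829156904587907001484330, 10, 18, 18, 20, 18, 20, 18, 18, 18, 18, 20, 20,
    16, 17, 17, 10, 26107500585962940161813084547844150322, 16, 17,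
    26107500585962940161813084547844151345, 26107500585962940161813084547844148266,
    26107500585962940161813084547844148266, 27396606133023427789206004162615052330, 10]]

/-- Final certificate for the search `X21`. -/
def leafX21 : List ℕ :=
  [26755727412554075355341329679810560, 24194918266505890667747134788370432,
    26755727412554075355341329679810561, 26755727412554075355341329679810562,
    26755727412554075355341329679810563, 26755727412554075355341329679810564,
    26755727412554075355341329679810565, 26755727412554075355341329679810566]

theorem runX21 : run probX21 clsX21 leafX21 certX21 [edgesGraph 21 (treeR 0 ++ treeU 11)] = true := by
  decide +kernel

/-- Initial data of the search `G22`. -/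
def probG22 : Prob where
  n := 22
  deg := 125620085287132926496705556352099
  col := 83746723524755247103801408094208
  mark := 0

/-- Graphs found by the search `G22`. -/
def clsG22 : List (List (List ℕ)) :=
  [[[1, 2, 3], [0, 4, 5], [0, 6, 7], [0, 8, 9], [1, 6, 8], [1, 7, 9], [2, 4, 9], [2, 5, 8], [3,
    4, 7], [3, 5, 6], [11, 16, 18], [10, 17, 20], [13, 14, 15], [12, 16, 17], [12, 18, 19],
    [12, 20, 21], [10, 13, 19], [11, 13, 21], [10, 14, 21], [14, 16, 20], [11, 15, 19], [15,
    17, 18]],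
    [[1, 2, 3], [0, 4, 5], [0, 6, 7], [0, 8, 9], [1, 6, 8], [1, 7, 9], [2, 4, 9], [2, 5, 8], [3,
    4, 7], [3, 5, 6], [11, 16, 18], [10, 17, 19], [13, 14, 15], [12, 16, 17], [12, 18, 19],
    [12, 20, 21], [10, 13, 20], [11, 13, 21], [10, 14, 21], [11, 14, 20], [15, 16, 19], [15,
    17, 18]],
    [[1, 2, 3], [0, 4, 5], [0, 6, 7], [0, 8, 9], [1, 6, 8], [1, 7, 10], [2, 4, 9], [2, 5, 8], [3,
    4, 7], [3, 6, 10], [5, 9, 16], [16, 18, 20], [13, 14, 15], [12, 16, 17], [12, 18, 19],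
    [12, 20, 21], [10, 11, 13], [13, 19, 21], [11, 14, 21], [14, 17, 20], [11, 15, 19], [15,
    17, 18]],
    [[1, 2, 3], [0, 4, 5], [0, 6, 7], [0, 8, 9], [1, 6, 8], [1, 7, 10], [2, 4, 9], [2, 5, 8], [3,
    4, 7], [3, 6, 11], [5, 11, 16], [9, 10, 21], [13, 14, 15], [12, 16, 17], [12, 18, 19],
    [12, 20, 21], [10, 13, 18], [13, 19, 20], [14, 16, 20], [14, 17, 21], [15, 17, 18], [11,
    15, 19]],
    [[1, 2, 3], [0, 4, 5], [0, 6, 7], [0, 8, 9], [1, 6, 8], [1, 7, 10], [2, 4, 9], [2, 5, 8], [3,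
    4, 7], [3, 6, 11], [5, 16, 18], [9, 16, 20], [13, 14, 15], [12, 16, 17], [12, 18, 19],
    [12, 20, 21], [10, 11, 13], [13, 19, 21], [10, 14, 21], [14, 17, 20], [11, 15, 19], [15,
    17, 18]],
    [[1, 2, 3], [0, 4, 5], [0, 6, 7], [0, 8, 9], [1, 6, 8], [1, 7, 10], [2, 4, 9], [2, 5, 8], [3,
    4, 7], [3, 6, 11], [5, 16, 18], [9, 17, 20], [13, 14, 15], [12, 16, 17], [12, 18, 19],
    [12, 20, 21], [10, 13, 19], [11, 13, 21], [10, 14, 21], [14, 16, 20], [11, 15, 19], [15,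
    17, 18]],
    [[1, 2, 3], [0, 4, 5], [0, 6, 7], [0, 8, 9], [1, 6, 8], [1, 7, 10], [2, 4, 9], [2, 5, 8], [3,
    4, 7], [3, 6, 11], [5, 16, 18], [9, 17, 21], [13, 14, 15], [12, 16, 17], [12, 18, 19],
    [12, 20, 21], [10, 13, 19], [11, 13, 20], [10, 14, 21], [14, 16, 20], [15, 17, 19], [11,
    15, 18]],
    [[1, 2, 3], [0, 4, 5], [0, 6, 7], [0, 8, 9], [1, 6, 8], [1, 7, 10], [2, 4, 9], [2, 5, 8], [3,
    4, 7], [3, 6, 11], [5, 16, 18], [9, 19, 20], [13, 14, 15], [12, 16, 17], [12, 18, 19],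
    [12, 20, 21], [10, 13, 20], [13, 19, 21], [10, 14, 21], [11, 14, 17], [11, 15, 16], [15,
    17, 18]],
    [[1, 2, 3], [0, 4, 5], [0, 6, 7], [0, 8, 9], [1, 6, 8], [1, 7, 10], [2, 4, 9], [2, 5, 8], [3,
    4, 7], [3, 6, 11], [5, 16, 18], [9, 17, 19], [13, 14, 15], [12, 16, 17], [12, 18, 19],
    [12, 20, 21], [10, 13, 20], [11, 13, 21], [10, 14, 21], [11, 14, 20], [15, 16, 19], [15,
    17, 18]]]

/-- Certificate for the search `G22`. -/
def certG22 : List (List ℕ) :=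
  [[72550053314985954366460580903117605009064995728629718223119255235800529138376677910503623643549712058511107428138552109173444675473011868926616640954565636],
    [40099487302995659006296673217757335777149536240041748481788896500799919016117252,
    70849661440415973871643871894610678800669245695052133935732457540574036639532768430905982622945405039318387916723742967800852984527782627392557208831012],
    [942734415910828854432652926833425575346182,
    39159655569331699803534432053168193373171474194959230680040839422764348605478,
    53301361139763603508565332805943590000072055603832453137689378158737563257751111665344367259848982232557224317780997],
    [942734415910828854432652926833425575346184, 920639078037918839679209356157031285800,
    942734415910828891872754994644690243977221, 29460450497213402871023593582646570189829],
    [942734415910828854432652926833425575346183, 920639078037918839603081706489308513321, 7,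
    29460450497213402871023593582646570189829, 920639078037918839755227866100517574693,
    1665667535617612609715602723378616206743458175677060898609682249908376490832991838603204798948184965217854353841189,
    942734415910828854432652926833425584783366],
    [942734415910828854432652926833425575346181, 920639078037918839603081706489308513317, 5, 7,
    920639078037918839755227866100517575719,
    39159655569331699805057825315112978000489383773807261657640711364266092929063, 7,
    39159655569331698246813201677271364377457126898259192683177846466107349675047, 8,
    29460450497213401701020403963544549688329, 8],
    [65640232619062498118140491720465840171000892164136023066191227500629537760036560433741273630279085657294612407737263804513804909961124614148532530929730576,
    9, 920639078037918839679209356157031286821,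
    39159655569331699805057825315112977782708668944406645004406603855751200902181, 5,
    920639078037918839755227866100517573669,
    39159655569331699805057825315112977913377097842047015011016811861733430794277, 9, 5,
    920639078037918803080869113917280886825, 8, 920639078037918839755192929118544996392,
    29460450497213401701019285980121427018760, 920639078037918803044945170723107777575, 7,
    39159655569331698248336593489406524249845626028490389763003887591939442217000,
    920639078037918839679209322072170830887, 7],
    [1543194452607376242751537088564812270114508831776933907810514957354641357485695262939734345111208945910940741808455690,
    38304709919817259571313862855041026632253227874280114006175543682182102128854032,
    49382222483436039768049186834073992947206297027132052381102401576523352609554555479498098644445805138101373983265914896,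
    65640232619062498118140491720465840735868052995647277053423546376288385282939665745583236882724329029237678500109313563861139672530081820216283446527624208,
    9, 7, 7, 7, 5, 9, 9, 29460450497213401698587811645352988705797,
    920639078037918839755192929118544997417, 920639078037918803156852686878794592297, 8, 7,
    920639078037918839755227866100517589031, 7, 920639078037918839755227866100517590055],
    [48224826643980507585985534017650383381792851303523292562210248092884333599159948243150565550177014155624853211710474,
    1197022184994289361603558214220032079470320221254925670037619296229385253683242,
    900539402412632522439894883565390735114258,
    39156015005922542253264324896860053480369740302702118059798875380161798212658,
    1543194452607376242751537088564812279600196782097876636909450049266354769048579858734315582638931410565667936977059856,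
    1543194452607376242751537088564812283394471962226253728549024086031040133673733697052148077650020396427558815044501515,
    38304709919817259571313862855041026944435120842289662504814334323161719180892208,
    1543194452607376242751537088564812290983022322483007911828172159560410862924041373687813067672198368151340571179384842,
    38304709919817259571313862855041027122869622241953823119956474627760028591227920,
    1543194452607376242751537088564812298571572682739762095107320233089781592174349050323478057694376339875122327314268176,
    87237115154132911729873481699259037428644408083807345539629092290208428172294696496913047653249589954221095431805540458413432808216538045191727436075331166487818373972528238933831218369168394,
    87237115154132911729873481699259037535906871523348122336221292275855197194651351458221441344623940070404398955978305135827721672357324588908156703765309081172078609515283664921016646767281162,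
    87237115154132911729873481699259037643169334962888899132813492261501966217008006419529835035998290186587702480151069813242010536498111132624585971455286995856338845058039090908202075165393930,
    7, 7,
    65640232619062498118140491720465841784907065968453891601140710002511959254045432753289740065836923862846229814514548831220475660158157973015229333456421904,
    65640232619062498118140491720465841946297683348885678454635658252700201403446319985244586709392707683401391555192277333891142735177861425996646927798305808,
    9, 5, 9, 9, 920639078037918839755227832015657132073],
    [900539402412632522439894883565390733017104, 852987600052125773395558978344523888885776,
    900539402412632522439894883565390737211402, 20,
    35424437562140203450929259690212467761914016565430588870126842125708762815540,
    48224826643980507585985534017650383915362798509076321074025347012918212999572206756595760161111402792453257939944459,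
    900539402412632522439894883565390743502866,
    48224826643980507585985534017650384093219447577593997244630379986262839466376292927744158364756199004729392849355787,
    1197022184994289361603558214220032096195879120152893026189408000715656383180843,
    1197022184994289361603558214220032097589675609471822547071384604789630648199218,
    39156015005922543809985555272756883390763089882884745809614472871171999149106,
    48224826643980507585985534017650384330361646335617565472103757284055674755448407822608689302949260621097572728570896,
    28817260877204240718076636274092504060526608, 900539402412632522439894883565390753988626,
    39156015005922542246789585297650093203300653772898360325872594174947568407602,
    48224826643980507585985534017650384745360494162158809870182167555193136511324608888621618444787118449741887517197323,
    900539402412632522439894883565390758182928,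
    48224826643980507585985534017650384923217143230676486040787200528537762978128695059770016648431914662018022426608656,
    1543194452607376242751537088564812321337223763510024644944764453677893779925272080230473027760910255046467595718918160,
    1543194452607376242751537088564812325131498943638401736584338490442579144550425918548305522771999240908358473786359824,
    1543194452607376242751537088564812328925774123766778828223912527207264509175579756866138017783088226770249351853801488,
    50915692795841281529412567083100718871931194475874258501501339592634876646622304133162910928491987042358244531011632,
    1543194452607376242751537088564812334617186893959344465683273582354292556113310514342886760299721705563085668954963984,
    50915692795841281529412567083100719049787843544391934672106375723664908931907046294085331600749726338251948489215024,
    48224826643980507585985534017650385575358189815241298666338988097468060023077011020647476728462834107030517094450192,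
    48224826643980507585985534017650385634643739504747190723207332421916268845345039744363609463011099511122562064253968],
    [28141856325394766326246715111418460374035, 20, 26655862501628930418611218073266371494923, 19,
    37405231647977538490291910374922157869139413837500155810532578087631774026794,
    920598837737265194841106754753966115882, 10, 17,
    31700139573659483275399067298922136216142922532244955158412278592752928695347,
    28141856325394766326246715111418460734475, 900539402412632522439894883565390745600011, 20,
    900539402412632522439894883565390749794320,
    1133814998046672543929440964826287594448549051336712397992805261491088929074224,
    745181149845038383396397330381972453428,
    35424437562140205007650490066109297715863509111493339943254389367985294818356,
    28141856325394766326246715111418461062162, 900539402412632522439894883565390756085771,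
    900539402412632522439894883565390758182931, 20,
    1507025832624390862062047938051574528850535725958640188774600016516805093066521720617813020263497333188063200829482,
    20, 35424437562140203444454520091002507659069501899147324429448359925559857280052,
    900539402412632522439894883565390765522960, 28141856325394766326246715111418461455378,
    920553488803493375749439899552188498994, 900539402412632522439894883565390769717266,
    900539402412632522439894883565390771814418, 900539402412632522439894883565390773911570,
    900539402412632522439894883565390776008722, 900539402412632522439894883565390778105874,
    900539402412632522439894883565390780203026, 900539402412632522439894883565390782300178,
    39156015005922542251739445580050433099440178408762717301158028340393026830386,
    900539402412632522439894883565390785445906, 900539402412632522439894883565390787543058,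
    39156015005922542251742603265456255848598178839037271598672187582062520226866,
    28141856325394766326246715111418462176272, 28141856325394766326246715111418462209040],
    [18, 18, 11, 18, 18, 10, 920639078037918839755227866100517577770,
    39159655569331699805057825315112978087601669705567508304264610866798755063850, 10, 10,
    763024291373449972205850848292271106850826, 18, 28141856325394766326246715111418461094923,
    920639078037918839755227866100517591083, 11, 17,
    28141856325394766326246715111418461258771, 20, 920553449506324768674328453154389121075,
    832995663878735468506489118391774766129,
    31700139573659484832120297674818966562097701771228816141347373596426440304691, 20,
    900539402412632522439894883565390768668690, 18,
    900539402412632522439894883565390773911563, 20,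
    39156015005922543809985555272756884392466608893730488335945220132413705855019, 19,
    1507025832624390862062047938051574562202383651552983649510487210363760201824392924681379744120169432250160219455530,
    17, 31700139573659483268924327699712176810196695320043663890724992412865320238131,
    28141856325394766326246715111418461979667, 20, 20,
    832824524707053147570024631692915952692, 29457711641711786850402596715806458545172, 20,
    28141856325394766326246715111418462209041, 18, 29457711641711786851689115322960047834132,
    20, 28141856325394766326246715111418462372881, 18,
    29457711641711786851689115322960047997972, 20, 28141856325394766326246715111418462536721,
    18, 29457711641711786851687997339536925525012, 20,
    35424437562140203449404380373402848164995028057333407931101090608733950646324,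
    28141856325394766326246715111418462733329, 18, 29457711641711786851690372918004905477140,
    20, 35424437562140203449407538058808670957709171453488085551927199601669775110196, 18, 18],
    [11, 21, 879347420934160983689421880683497785393, 21, 18, 20, 20, 20, 20, 11,
    23845796795041227097537826820551105414155, 21, 10,
    920639078037918839755227866100517582890,
    39159655569331699805057825315112978305382384534968124920824359623130410400810, 10,
    920639078037918839755227866100517585962,
    39159655569331699805057825315112978436050813432608494890760208876929403602986,
    23844509105420311631432839009133472121866, 920639078037918839755227866100517589034, 17,
    21, 20, 11, 920639078037918839755227866100517594155, 11, 11, 20, 19,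
    920553488803493375749439899552188487730, 29456422694581475960326634937850805486602,
    763024291373449972205850848292271124676618, 17, 17,
    28141856325394766326246715111418461717521, 20, 17,
    26655862501628929242593277635567690351633, 21, 29456422694581474784308694500152123556884,
    20, 29457711641711788023982076785670032294923, 17, 18,
    23847246703412529877196547216251742127115, 17,
    1507025832624390862062047938051574584434464785117693170836116332031838510087791410143169272929145059282144420994090,
    1507025832624390862062047938051574586287138212914752297613252092170845035783667307759298420883778353160020826300458,
    763024291373449972205850848292271148793866, 20, 19, 17,
    745266699782295240327073850532502239283, 17, 17, 17, 18, 20, 17, 17, 17, 18, 20, 17, 17,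
    17, 18, 20, 17, 17, 17,
    31700139573659483273874187982112517229009935546469500745753823593506751469619, 18, 20, 17,
    17, 17, 31700139573659483273877345667518340065280221908504301689891882337708907000883, 20,
    20],
    [11, 11, 17, 19632141289011292580599274220164218913803, 17,
    25335980640189376064291878154706610127889, 11, 703934841675052309823917957926979898411,
    17, 17, 11, 17, 17, 17, 11, 11, 19, 11, 11, 11, 10,
    920639078037918839755227866100517585962, 20, 17, 19, 17, 11,
    920639078037918839755227866100517590059, 11, 920639078037918839755227866100517591083, 17,
    17, 20, 35430007055864512937975746331367642886433636641076484352379938507125338168363, 11,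
    23844509105420311631432839009133472384011, 11, 17,
    920639078037918839755227866100517599281, 19, 11, 20,
    920598837737265158090546116075882317873, 19, 20, 17, 17, 20, 17, 17,
    920553488803493375749439899552188506161, 920553488803493375749439899552188500011, 11, 17,
    19, 920553488803493375749439899552188505137, 920513248502839694084758149527553214507, 11,
    23844509105420311631432839009133473137674, 920639078037918839755227866100517620778, 17,
    17, 35430007055864512937975746331367644193117925617480184051738431045115270190123,
    23844509105420311631432839009133473268747, 20, 17,
    920639078037918839755227866100517625905, 19, 11, 21, 20, 17,
    920639078037918839755227866100517630001, 19, 11, 21, 20, 17,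
    920639078037918839755227866100517634097, 19, 11, 21, 20, 17,
    920639078037918839755227866100517638193, 19, 11,
    763024291373449972205850848292271163473930, 21, 20, 17,
    920639078037918839755227866100517644337, 19, 11,
    763024291373449972205850848292271169765386, 19, 19],
    [11, 11, 19, 832995703175904075581600564789574109233, 21, 11,
    920553488803493375749439899552188467243, 11, 920598837737265194841106754753966112819,
    832955462875250430667479453443022652467, 879347381636992376614310434285698418731, 19, 19,
    11, 11, 11, 11, 11, 19, 19, 19, 19, 11, 21, 18, 832824524707053147570024631692915904561,
    791618417540552148434895166426425856043, 791618417540552148434895166426425856043,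
    791749355708749431532349988176532608043, 11, 19, 19, 21, 19, 21, 19, 19, 19, 19, 21, 21,
    17, 18, 18, 11, 879347420934160983689421880683497792563, 17, 18,
    879347420934160983689421880683497793586, 879347420934160983689421880683497790507,
    879347420934160983689421880683497790507, 920598798440096587765995308356166752299, 11, 21,
    18, 791749355708749431532349988176532615211, 19, 19, 21, 19, 19, 19, 21, 19, 19, 19, 21,
    19, 19, 19, 21, 19, 17, 920598798440096587765995308356166762539, 19, 19, 21, 19, 17,
    920598798440096587765995308356166764587, 17, 17]]

/-- Final certificate for the search `G22`. -/
def leafG22 : List ℕ :=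
  [899061599646405116948464712988786688, 899061599646405116948464712988786689,
    435727734211554622888056566184968193, 722311930052671635705364845678329856,
    899061599646405116948464712988786690, 732739655062601204008303815259357186,
    899061599646405116948464712988786691, 899061599646405116948464712988786692,
    899061599646405116948464712988786693, 899061599646405116948464712988786694,
    899061599646405116948464712988786695, 899061599646405116948464712988786696,
    732739655062601198279622696288389122, 344242094111915900388078584775225348,
    298726033404528504831365919598358534, 173019341516406772029756848619302919,
    172935758279663154836604537536950277, 298726033404528469090833394932559872,
    213220383377585828886210319244242952, 341600306865367963129325661354110977,
    419609066179387233247171784103866369, 346842002244835052410855296848015360]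

theorem runG22 : run probG22 clsG22 leafG22 certG22 [edgesGraph 22 (treeU 0 ++ treeU 12)] = true := by
  decide +kernel

/-- Initial data of the search `M8`. -/
def probM8 : Prob where
  n := 8
  deg := 72044612706
  col := 0
  mark := 68719476737

/-- Graphs found by the search `M8`. -/
def clsM8 : List (List (List ℕ)) :=
  []

/-- Certificate for the search `M8`. -/
def certM8 : List (List ℕ) :=
  [[8257494022600262659],
    [3, 9297111750799160502402637797261347],
    [5]]

/-- Final certificate for the search `M8`. -/
def leafM8 : List ℕ :=
  []

theorem runM8 : run probM8 clsM8 leafM8 certM8 [edgesGraph 8 (treeR 0)] = true := by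
  decide +kernel

/-- Initial data of the search `M10`. -/
def probM10 : Prob where
  n := 10
  deg := 108923695762530
  col := 0
  mark := 68719476737

/-- Graphs found by the search `M10`. -/
def clsM10 : List (List (List ℕ)) :=
  [[[1, 2], [0, 3, 4], [0, 5, 6], [1, 5, 8], [1, 6, 9], [2, 3, 9], [2, 4, 8], [8, 9], [3, 6, 7],
    [4, 5, 7]]]

/-- Certificate for the search `M10`. -/
def certM10 : List (List ℕ) :=
  [[369669370248873858262162008522192996785980419],
    [313122136191544792743939, 13318742704824913825926209889102716597271404311513071066546211,
    464858247975025332992127645888498489244361075270459028669475],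
    [9785066755985774740485, 341521582865512398885, 10928729985658654884868,
    10928729985658654950404],
    [7, 8, 4, 12599967818507541639691215429245037711396, 4,
    12599967818507541677470147292202199421988],
    [6, 6, 8, 341523902767367721000, 305779925507165389861, 9785066755985774937093],
    [4, 4, 6, 341523902767367720998, 6, 8, 8],
    [8, 8, 4, 341523902767367718948, 4, 4],
    [9, 8, 8, 8, 7]]

/-- Final certificate for the search `M10`. -/
def leafM10 : List ℕ :=
  [333519436296257536]

theorem runM10 : run probM10 clsM10 leafM10 certM10 [edgesGraph 10 (treeR 0)] = true := by
  decide +kernel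

/-- Initial data of the search `M14`. -/
def probM14 : Prob where
  n := 14
  deg := 114250801970551032930
  col := 0
  mark := 68719476737

/-- Graphs found by the search `M14`. -/
def clsM14 : List (List (List ℕ)) :=
  [[[1, 2], [0, 3, 4], [0, 5, 6], [1, 5, 10], [1, 6, 12], [2, 3, 11], [2, 4, 13], [8, 9], [7, 10,
    11], [7, 12, 13], [3, 8, 12], [5, 8, 13], [4, 9, 10], [6, 9, 11]],
    [[1, 2], [0, 3, 4], [0, 5, 6], [1, 5, 10], [1, 6, 13], [2, 3, 11], [2, 4, 12], [8, 9], [7, 10,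
    11], [7, 12, 13], [3, 8, 12], [5, 8, 13], [6, 9, 10], [4, 9, 11]],
    [[1, 2], [0, 3, 4], [0, 5, 6], [1, 5, 10], [1, 11, 12], [2, 3, 12], [2, 10, 13], [8, 9], [7,
    10, 11], [7, 12, 13], [3, 6, 8], [4, 8, 13], [4, 5, 9], [6, 9, 11]],
    [[1, 2], [0, 3, 4], [0, 5, 6], [1, 5, 10], [1, 11, 13], [2, 3, 12], [2, 10, 13], [8, 9], [7,
    10, 11], [7, 12, 13], [3, 6, 8], [4, 8, 12], [5, 9, 11], [4, 6, 9]],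
    [[1, 2], [0, 3, 4], [0, 5, 6], [1, 5, 10], [1, 6, 11], [2, 3, 12], [2, 4, 13], [8, 9], [7, 10,
    11], [7, 12, 13], [3, 8, 13], [4, 8, 12], [5, 9, 11], [6, 9, 10]],
    [[1, 2], [0, 3, 4], [0, 5, 6], [1, 5, 10], [1, 6, 13], [2, 3, 12], [2, 4, 11], [8, 9], [7, 10,
    11], [7, 12, 13], [3, 8, 13], [6, 8, 12], [5, 9, 11], [4, 9, 10]],
    [[1, 2], [0, 3, 4], [0, 5, 6], [1, 10, 12], [1, 11, 13], [2, 10, 13], [2, 11, 12], [8, 9], [7,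
    10, 11], [7, 12, 13], [3, 5, 8], [4, 6, 8], [3, 6, 9], [4, 5, 9]]]

/-- Certificate for the search `M14`. -/
def certM14 : List (List ℕ) :=
  [[25973008055128495393799516703363051368322447901657843490080058043358329888932639146674069994424782131561475],
    [20980828821177647277955366769895489026014434133062260140061900556586480690004995,
    23005213225751222911478593515669709590904416985162991873681328233811930156892195],
    [491900176463472898680739102725, 16571134927506337327969534986],
    [491900176463472898680739102730, 10, 5, 16571134927506337327969666060],
    [491900176463472898680739102726, 11, 6, 12,
    18583463249858204915426106850617494749432694175695908, 12, 14020375862319966010783073285,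
    448652027594238912345061490693],
    [12, 12, 517811368143101615428078636, 12, 12, 12, 13, 11, 6, 13,
    14020375862210826254300578820, 14020375862319966010783368196, 5],
    [12, 517847966485663757033799724, 4, 4, 517811368143101615428075558, 4, 6, 11,
    517847966482252074491838507, 4, 11, 16949594380570581338906415680648954126760827026407460,
    4, 4, 14019204715397277356797232132, 14020375862285063113671083012, 4, 11,
    480334667737366947715621925, 400623446949202128518784036, 4],
    [13, 13, 4, 6, 4, 11, 11, 4, 6, 6, 4, 517847966485663757033804836,
    400660045286033750879112235, 4, 400623446948111412984024102, 6,
    517811368145420452131506214, 4]]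

/-- Final certificate for the search `M14`. -/
def leafM14 : List ℕ :=
  [505710904771156012728320, 505710904771156012728321, 505710904771156012728322,
    505710904771156012728323, 505710904771156012728324, 505710904771156012728325,
    505710904771156012728326]

theorem runM14 : run probM14 clsM14 leafM14 certM14 [edgesGraph 14 (treeR 0 ++ treeR 7)] = true := by
  decide +kernel

/-- Initial data of the search `M16`. -/
def probM16 : Prob where
  n := 16
  deg := 116992821217844257721442
  col := 77995214167549665083392
  mark := 70368744177665

/-- Graphs found by the search `M16`. -/
def clsM16 : List (List (List ℕ)) :=
  []

/-- Certificate for the search `M16`. -/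
def certM16 : List (List ℕ) :=
  [[24828112467340216457824484516711231712739863663116976385950723],
    [19585927275915092059187625067523,
    24246203581431131605374285724109396497036006172301516079139],
    [5, 19585927275950797722933325235204],
    [4, 4],
    [4, 612060227373463519557201166372],
    [6],
    [26634920779125165861154694430022734885487574106687428183375756929988355504495018184279047],
    [587452504223351532580176196042764],
    [14, 14],
    [13, 13],
    [13]]

/-- Final certificate for the search `M16`. -/
def leafM16 : List ℕ :=
  []

theorem runM16 : run probM16 clsM16 leafM16 certM16 [edgesGraph 16 (treeR 0 ++ treeR 9)] = true := by
  decide +kernel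

/-- Initial data of the search `M18`. -/
def probM18 : Prob where
  n := 18
  deg := 119800648927072519906757730
  col := 119800648961937961578921984
  mark := 72057594037927937

/-- Graphs found by the search `M18`. -/
def clsM18 : List (List (List ℕ)) :=
  [[[1, 2], [0, 3, 4], [0, 5, 6], [1, 5, 7], [1, 6, 8], [2, 3, 8], [2, 4, 7], [3, 6, 9], [4, 5,
    10], [7, 14, 16], [8, 15, 17], [12, 13], [11, 14, 15], [11, 16, 17], [9, 12, 17], [10, 12,
    16], [9, 13, 15], [10, 13, 14]]]

/-- Certificate for the search `M18`. -/
def certM18 : List (List ℕ) :=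
  [[29512865654362568657069860023572836030459625124749587195156045497347],
    [22735884683365785966880109065405443,
    28821157865588491216475863963335205605934367274192415498067509283],
    [5, 22735884683365821672543854765573124],
    [4, 4],
    [4, 710496396355181928357710996176932],
    [6],
    [22735884683329223367204512127255559],
    [8],
    [21993856294849964176549910833146101774,
    27880525133499978657160106026785785674883432778893936563456359629838],
    [687308009214061380517184713534767118, 687308009214061380517184713536864266,
    710496396355181928357710996177966, 687308009214061380517184713540009993,
    22735884683329187591700887342646286],
    [21478375287939418141162022297928714, 16, 21478375287939418141162022297994250,
    710496396355181928357710996178986, 626913123306011214903567510930480,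
    21478375287939418141162022298027022, 14, 16],
    [10, 10, 14, 16, 10, 17, 671199227748106816911313196813353],
    [10, 17, 16, 10],
    [15, 15]]

/-- Final certificate for the search `M18`. -/
def leafM18 : List ℕ :=
  [693844137065607351911827144704]

theorem runM18 : run probM18 clsM18 leafM18 certM18 [edgesGraph 18 (treeR 0 ++ treeR 11)] = true := by
  decide +kernel

/-- Initial data of the search `M20`. -/
def probM20 : Prob where
  n := 20
  deg := 122675864501322260384519916642
  col := 163567819383096388833020739584
  mark := 73786976294838206465

/-- Graphs found by the search `M20`. -/
def clsM20 : List (List (List ℕ)) :=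
  [[[1, 2], [0, 3, 4], [0, 5, 6], [1, 5, 7], [1, 6, 8], [2, 3, 8], [2, 4, 7], [3, 6, 9], [4, 5,
    9], [7, 8, 10], [9, 11, 12], [10, 16, 18], [10, 17, 19], [14, 15], [13, 16, 17], [13, 18,
    19], [11, 14, 19], [12, 14, 18], [11, 15, 17], [12, 15, 16]],
    [[1, 2], [0, 3, 4], [0, 5, 6], [1, 5, 7], [1, 6, 8], [2, 3, 8], [2, 4, 7], [3, 6, 9], [4, 5,
    10], [7, 10, 11], [8, 9, 12], [9, 16, 18], [10, 17, 19], [14, 15], [13, 16, 17], [13, 18,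
    19], [11, 14, 19], [12, 14, 18], [11, 15, 17], [12, 15, 16]]]

/-- Certificate for the search `M20`. -/
def certM20 : List (List ℕ) :=
  [[34594166879157210717778096894947482052714557025216220638210123294962615299],
    [26025758552225782549647605725799646211,
    33783366092926963637928774173647032939690826498458980934896067595468835],
    [5, 26025758552225782585353269471499813892],
    [4, 4],
    [4, 813304954757055705793380386519121956],
    [6],
    [26025758552225745987047930128861496327],
    [8],
    [832824273670025788319363803654273400841, 832824273670025788319363803654275497993],
    [26025758552188305884980118864196011018, 10, 26025758552188305884980118864196109321,
    813304954757055705793380386519125033],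
    [10, 10, 813304954757055705793380386519122986, 10, 26025758552188305884980118864196109322],
    [40177902709002486691516016044376055117792559541988144769748323781740188024249000580881006406919349967258635,
    10,
    40177902709002486691516016044376111656898632450286691435268347555134055633201384354541519796747518403970059,
    10],
    [24738068931309145333512609278965318667, 24738068931309145333512609278965351435],
    [16, 16],
    [18, 12, 19],
    [17, 18, 12],
    [12, 17, 17]]

/-- Final certificate for the search `M20`. -/
def leafM20 : List ℕ :=
  [794243119879937212688848033710080, 794243119879937212688848033710081]

theorem runM20 : run probM20 clsM20 leafM20 certM20 [edgesGraph 20 (treeR 0 ++ treeR 13)] = true := by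
  decide +kernel

/-! ### From the search to isomorphisms -/

/-- Number of vertices of a (nonempty) graph given by lists of neighbours. -/
abbrev ord (A : List (List ℕ)) : ℕ := A.length - 1 + 1

/-- The graph with given lists of neighbours. -/
def gr (A : List (List ℕ)) : SimpleGraph (Fin (ord A)) :=
  SimpleGraph.fromRel fun i j => j.val ∈ row A i

section Search

variable {V : Type} {G : SimpleGraph V}

lemma wf_of_forall {n : ℕ} {A : List (List ℕ)} (h : A.length = n)
    (h' : ∀ i < n, (row A i).Nodup ∧ ∀ j ∈ row A i, i ∈ row A j) : WF n A where
  length := h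
  nodup i := by
    by_cases hi : i < n
    · exact (h' i hi).1
    · rw [row_eq, List.getD_eq_default _ _ (by omega)]; exact List.nodup_nil
  symm i j hj := by
    by_cases hi : i < n
    · exact (h' i hi).2 j hj
    · rw [row_eq, List.getD_eq_default _ _ (by omega)] at hj; simp at hj

lemma sub_edgesGraph {p : Prob} {l : ℕ → V} {es : List (ℕ × ℕ)}
    (h : ∀ e ∈ es, e.1 < p.n ∧ e.2 < p.n ∧ G.Adj (l e.1) (l e.2)) :
    Sub p G (edgesGraph p.n es) l := by
  have : (edgesGraph p.n es).length = p.n ∧ Sub p G (edgesGraph p.n es) l := by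
    induction es with
    | nil =>
      refine ⟨by simp [edgesGraph], fun i hi j hj => ?_⟩
      simp [edgesGraph, row_eq, List.getD_eq_getElem?_getD, hi] at hj
    | cons e es ih =>
      obtain ⟨h1, h2⟩ := ih fun e he => h e (List.mem_cons_of_mem _ he)
      obtain ⟨hv, hw, hadj⟩ := h e (by simp)
      have hne : e.1 ≠ e.2 := fun he => by rw [he] at hadj; exact hadj.ne rfl
      have he : edgesGraph p.n (e :: es) = addE e.1 e.2 (edgesGraph p.n es) := rfl
      refine ⟨by rw [he, addE, setAt_eq, setAt_eq]; simpa using h1, fun i hi j hij => ?_⟩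
      rw [he, row_addE h1 hv hw hne] at hij
      split_ifs at hij with h3 h4
      · subst h3
        rcases List.mem_cons.1 hij with rfl | h
        · exact ⟨hv, hadj.symm⟩
        · exact h2 _ hi j h
      · subst h4
        rcases List.mem_cons.1 hij with rfl | h
        · exact ⟨hw, hadj⟩
        · exact h2 _ hi j h
      · exact h2 i hi j hij
  exact this.2

lemma Classified.exists_iso {p : Prob} {cls : List (List (List ℕ))} {l : ℕ → V}
    (h : Classified p cls G l) (hp : 0 < p.n) (hc : ∀ A ∈ cls, A.length = p.n) :
    ∃ A, ∃ k < cls.length, A = ent [] cls k ∧ A ∈ cls ∧ ∃ φ : gr A ≃g G,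
      ∀ i : Fin (ord A), ∃ j < p.n, φ i = l j ∧ dig p.mark j = dig p.mark i := by
  obtain ⟨k, hk, l', h1, h2, h3, h4⟩ := h
  have hA : ent [] cls k ∈ cls := by
    rw [ent_eq, List.getD_eq_getElem _ _ hk]; exact List.getElem_mem _
  refine ⟨_, k, hk, rfl, hA, ?_⟩
  set A := ent [] cls k
  have hn : ord A = p.n := by have := hc A hA; unfold ord; omega
  have hlt : ∀ i : Fin (ord A), i.val < p.n := fun i => hn ▸ i.2
  have hbij : Function.Bijective fun i : Fin (ord A) => l' i := by
    refine ⟨fun i j hij => Fin.ext (h1 _ (hlt i) _ (hlt j) hij), fun x => ?_⟩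
    obtain ⟨i, hi, hx⟩ := h2 x
    exact ⟨⟨i, by omega⟩, hx⟩
  refine ⟨⟨Equiv.ofBijective _ hbij, ?_⟩, fun i => h4 i (hlt i)⟩
  intro i j
  simp only [Equiv.ofBijective_apply, gr, SimpleGraph.fromRel_adj]
  rw [← h3 _ (hlt i) _ (hlt j), ← h3 _ (hlt j) _ (hlt i)]
  constructor
  · intro h
    exact ⟨fun e => h.ne (by rw [e]), .inl h⟩
  · rintro ⟨-, h | h⟩
    exacts [h, h.symm]

theorem exists_iso_of_run {p : Prob} {cls : List (List (List ℕ))} {lf : List ℕ}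
    {lv : List (List ℕ)} {es : List (ℕ × ℕ)} (hrun : run p cls lf lv [edgesGraph p.n es] = true)
    (hwf : WF p.n (edgesGraph p.n es)) (hp : 0 < p.n) (hc : ∀ A ∈ cls, A.length = p.n)
    (hG : Sparse G) {L : List V} (hnd : L.Nodup) (hlen : L.length = p.n) (hall : ∀ x, x ∈ L)
    (hdeg : ∀ i (h : i < L.length), (G.neighborSet L[i]).ncard = dig p.deg i)
    (f : V → ℕ) (hf : ∀ x y, G.Adj x y → f x ≤ f y + 1)
    (hcol : ∀ i (h : i < L.length), f L[i] = dig p.col i) (x₀ : V)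
    (hes : ∀ e ∈ es, e.1 < p.n ∧ e.2 < p.n ∧ G.Adj (L.getD e.1 x₀) (L.getD e.2 x₀)) :
    ∃ A, ∃ k < cls.length, A = ent [] cls k ∧ A ∈ cls ∧ ∃ φ : gr A ≃g G,
      ∀ i : Fin (ord A), ∃ j < p.n, φ i = L.getD j x₀ ∧ dig p.mark j = dig p.mark i := by
  refine (solved_of_run cls hG lf lv _ hrun (by simpa using hwf) _ (by simp)
    (fun i => L.getD i x₀) ?_ (sub_edgesGraph hes)).exists_iso hp hc
  have hget : ∀ i, ∀ h : i < p.n, L.getD i x₀ = L[i]'(hlen ▸ h) :=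
    fun i h => List.getD_eq_getElem _ _ _
  refine ⟨fun i hi j hj h => ?_, fun x => ?_, fun i hi => ?_, fun i hi j hj h => ?_⟩
  · simp only [hget i hi, hget j hj] at h
    exact (hnd.getElem_inj_iff).1 h
  · obtain ⟨i, hi, rfl⟩ := List.getElem_of_mem (hall x)
    have hi' : i < p.n := hlen ▸ hi
    exact ⟨i, hi', hget i hi'⟩
  · rw [hget i hi, hdeg]
  · simp only [hget i hi, hget j hj] at h
    have := hf _ _ h
    rwa [hcol, hcol] at this

end Search

/-! ### Local structure of layered sparse graphs -/

/-- The edges `es` are present between the entries of `L`. -/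
def On {V : Type} (G : SimpleGraph V) (L : List V) (es : List (ℕ × ℕ)) : Prop :=
  ∀ e ∈ es, ∃ x y, L[e.1]? = some x ∧ L[e.2]? = some y ∧ G.Adj x y

/-- There is exactly one edge between the layers `k` and `k + 1`. -/
def Cut {V : Type} (G : SimpleGraph V) (lay : V → ℕ) (k : ℕ) : Prop :=
  ∃ y z, G.Adj y z ∧ lay y = k ∧ lay z = k + 1 ∧
    ∀ y' z', G.Adj y' z' → lay y' = k → lay z' = k + 1 → y' = y ∧ z' = z

section Local

variable {V : Type} {G : SimpleGraph V} {r : V} {lay : V → ℕ}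

lemma On.append_left {L : List V} {es : List (ℕ × ℕ)} (h : On G L es) (L' : List V) :
    On G (L ++ L') es := fun e he => by
  obtain ⟨x, y, hx, hy, hxy⟩ := h e he
  exact ⟨x, y, by rw [List.getElem?_append_left (List.getElem?_eq_some_iff.1 hx).1, hx],
    by rw [List.getElem?_append_left (List.getElem?_eq_some_iff.1 hy).1, hy], hxy⟩

lemma On.append_right {L : List V} {es : List (ℕ × ℕ)} (h : On G L es) (L' : List V) :
    On G (L' ++ L) (es.map fun e => (L'.length + e.1, L'.length + e.2)) := fun e he => by
  obtain ⟨e, he', rfl⟩ := List.mem_map.1 he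
  obtain ⟨x, y, hx, hy, hxy⟩ := h e he'
  exact ⟨x, y, by rw [List.getElem?_append_right (by omega)]; simpa using hx,
    by rw [List.getElem?_append_right (by omega)]; simpa using hy, hxy⟩

lemma On.append {L : List V} {es es' : List (ℕ × ℕ)} (h : On G L es) (h' : On G L es') :
    On G L (es ++ es') := fun e he => (List.mem_append.1 he).elim (h e) (h' e)

lemma exists_two_others {a v : V} (h : (G.neighborSet a).ncard = 3) (hv : G.Adj a v) :
    ∃ c d, c ≠ d ∧ c ≠ v ∧ d ≠ v ∧ G.Adj a c ∧ G.Adj a d ∧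
      ∀ x, G.Adj a x → x = v ∨ x = c ∨ x = d := by
  obtain ⟨x, y, z, h1, h2, h3, he⟩ := Set.ncard_eq_three.1 h
  have hm : ∀ w, G.Adj a w ↔ w = x ∨ w = y ∨ w = z := fun w => by
    rw [← mem_neighborSet, he]; simp
  rcases (hm v).1 hv with rfl | rfl | rfl
  · exact ⟨y, z, h3, h1.symm, h2.symm, (hm _).2 (by simp), (hm _).2 (by simp),
      fun x hx => by have := (hm x).1 hx; tauto⟩
  · exact ⟨x, z, h2, h1, h3.symm, (hm _).2 (by simp), (hm _).2 (by simp),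
      fun x hx => by have := (hm x).1 hx; tauto⟩
  · exact ⟨x, y, h1, h2, h3, (hm _).2 (by simp), (hm _).2 (by simp),
      fun x hx => by have := (hm x).1 hx; tauto⟩

lemma exists_treeR (hG : Sparse G) {v : V} (hv : (G.neighborSet v).ncard = 2)
    (hn : ∀ x, G.Adj v x → (G.neighborSet x).ncard = 3) :
    ∃ L : List V, L.length = 7 ∧ L.Nodup ∧ L[0]? = some v ∧ On G L (treeR 0) ∧
      (∀ x y, G.Adj v x → G.Adj x y → x ∈ L ∧ y ∈ L) ∧
      ∀ f : V → ℕ, (∀ ⦃x y⦄, G.Adj x y → f y ≤ f x + 1) → ∀ x ∈ L, f x ≤ f v + 2 ∧ f v ≤ f x + 2 := by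
  obtain ⟨a, b, hab, he⟩ := Set.ncard_eq_two.1 hv
  have hm : ∀ w, G.Adj v w ↔ w = a ∨ w = b := fun w => by
    rw [← mem_neighborSet, he]; simp
  have hva := (hm a).2 (by simp)
  have hvb := (hm b).2 (by simp)
  obtain ⟨c, d, hcd, hcv, hdv, hac, had, hA⟩ := exists_two_others (hn a hva) hva.symm
  obtain ⟨e, f, hef, hev, hfv, hbe, hbf, hB⟩ := exists_two_others (hn b hvb) hvb.symm
  refine ⟨[v, a, b, c, d, e, f], rfl, ?_, rfl, ?_, ?_, ?_⟩
  · have key : ∀ x y, G.Adj a x → G.Adj b y → x ≠ v → x ≠ y := by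
      rintro x y hx hy hxv rfl
      exact hG.sq hva hx hy.symm hvb.symm hxv.symm hab
    have key2 : ¬ G.Adj a b := fun h => hG.tri hva h hvb.symm
    have h1 := hva.ne; have h2 := hvb.ne; have h3 := hac.ne; have h4 := had.ne
    have h5 := hbe.ne; have h6 := hbf.ne
    have : b ≠ c := by rintro rfl; exact key2 hac
    have : b ≠ d := by rintro rfl; exact key2 had
    have : a ≠ e := by rintro rfl; exact key2 hbe.symm
    have : a ≠ f := by rintro rfl; exact key2 hbf.symm
    have := key c e hac hbe hcv
    have := key c f hac hbf hcv
    have := key d e had hbe hdv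
    have := key d f had hbf hdv
    simp only [List.nodup_cons, List.mem_cons, List.not_mem_nil, not_or]
    simp [*, Ne.symm hcv, Ne.symm hdv, Ne.symm hev, Ne.symm hfv]
  · intro x hx
    simp only [treeR, List.mem_cons, List.not_mem_nil, or_false] at hx
    rcases hx with rfl | rfl | rfl | rfl | rfl | rfl <;> exact ⟨_, _, rfl, rfl, ‹_›⟩
  · intro x y hx hy
    rcases (hm x).1 hx with rfl | rfl
    · rcases hA y hy with rfl | rfl | rfl <;> simp
    · rcases hB y hy with rfl | rfl | rfl <;> simp
  · intro g hg x hx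
    have h1 := hg hva; have h2 := hg hvb; have h3 := hg hac; have h4 := hg had
    have h5 := hg hbe; have h6 := hg hbf
    have h1' := hg hva.symm; have h2' := hg hvb.symm; have h3' := hg hac.symm
    have h4' := hg had.symm; have h5' := hg hbe.symm; have h6' := hg hbf.symm
    simp only [List.mem_cons, List.not_mem_nil, or_false] at hx
    rcases hx with rfl | rfl | rfl | rfl | rfl | rfl | rfl <;> constructor <;> omega

lemma exists_treeU (hG : Sparse G) {v : V} (hv : (G.neighborSet v).ncard = 3)
    (hn : ∀ x, G.Adj v x → (G.neighborSet x).ncard = 3) :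
    ∃ L : List V, L.length = 10 ∧ L.Nodup ∧ On G L (treeU 0) ∧
      ∀ f : V → ℕ, (∀ ⦃x y⦄, G.Adj x y → f y ≤ f x + 1) → ∀ x ∈ L, f x ≤ f v + 2 ∧ f v ≤ f x + 2 := by
  obtain ⟨a, b, c, hab, hac, hbc, he⟩ := Set.ncard_eq_three.1 hv
  have hm : ∀ w, G.Adj v w ↔ w = a ∨ w = b ∨ w = c := fun w => by
    rw [← mem_neighborSet, he]; simp
  have hva := (hm a).2 (by simp)
  have hvb := (hm b).2 (by simp)
  have hvc := (hm c).2 (by simp)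
  obtain ⟨a1, a2, ha, ha1v, ha2v, ha1, ha2, -⟩ := exists_two_others (hn a hva) hva.symm
  obtain ⟨b1, b2, hb, hb1v, hb2v, hb1, hb2, -⟩ := exists_two_others (hn b hvb) hvb.symm
  obtain ⟨c1, c2, hc, hc1v, hc2v, hc1, hc2, -⟩ := exists_two_others (hn c hvc) hvc.symm
  refine ⟨[v, a, b, c, a1, a2, b1, b2, c1, c2], rfl, ?_, ?_, ?_⟩
  · have key : ∀ p q x y, G.Adj v p → G.Adj v q → p ≠ q → G.Adj p x → G.Adj q y → x ≠ v → x ≠ y := by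
      rintro p q x y hp hq hpq hx hy hxv rfl
      exact hG.sq hp hx hy.symm hq.symm hxv.symm hpq
    have key2 : ∀ p q x, G.Adj v p → G.Adj v q → G.Adj p x → q ≠ x := by
      rintro p q x h1 h2 h3 rfl
      exact hG.tri h1 h3 h2.symm
    have n1 := fun q h => key2 a q a1 hva h ha1
    have n2 := fun q h => key2 a q a2 hva h ha2
    have n3 := fun q h => key2 b q b1 hvb h hb1
    have n4 := fun q h => key2 b q b2 hvb h hb2
    have n5 := fun q h => key2 c q c1 hvc h hc1
    have n6 := fun q h => key2 c q c2 hvc h hc2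
    simp only [List.nodup_cons, List.mem_cons, List.not_mem_nil, not_or]
    simp only [hva.ne, hvb.ne, hvc.ne, Ne.symm ha1v, Ne.symm ha2v, Ne.symm hb1v, Ne.symm hb2v,
      Ne.symm hc1v, Ne.symm hc2v, hab, hac, hbc, n1 _ hva, n1 _ hvb, n1 _ hvc, n2 _ hva, n2 _ hvb,
      n2 _ hvc, n3 _ hva, n3 _ hvb, n3 _ hvc, n4 _ hva, n4 _ hvb, n4 _ hvc, n5 _ hva, n5 _ hvb,
      n5 _ hvc, n6 _ hva, n6 _ hvb, n6 _ hvc, ha, hb, hc, key a b a1 b1 hva hvb hab ha1 hb1 ha1v,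
      key a b a1 b2 hva hvb hab ha1 hb2 ha1v, key a b a2 b1 hva hvb hab ha2 hb1 ha2v,
      key a b a2 b2 hva hvb hab ha2 hb2 ha2v, key a c a1 c1 hva hvc hac ha1 hc1 ha1v,
      key a c a1 c2 hva hvc hac ha1 hc2 ha1v, key a c a2 c1 hva hvc hac ha2 hc1 ha2v,
      key a c a2 c2 hva hvc hac ha2 hc2 ha2v, key b c b1 c1 hvb hvc hbc hb1 hc1 hb1v,
      key b c b1 c2 hvb hvc hbc hb1 hc2 hb1v, key b c b2 c1 hvb hvc hbc hb2 hc1 hb2v,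
      key b c b2 c2 hvb hvc hbc hb2 hc2 hb2v]
    simp
  · intro x hx
    simp only [treeU, List.mem_cons, List.not_mem_nil, or_false] at hx
    rcases hx with rfl | rfl | rfl | rfl | rfl | rfl | rfl | rfl | rfl <;>
      exact ⟨_, _, rfl, rfl, ‹_›⟩
  · intro g hg x hx
    have key : ∀ p x, G.Adj v p → G.Adj p x → g x ≤ g v + 2 ∧ g v ≤ g x + 2 := fun p x h1 h2 => by
      have := hg h1; have := hg h1.symm; have := hg h2; have := hg h2.symm; omega
    have key1 : ∀ p, G.Adj v p → g p ≤ g v + 2 ∧ g v ≤ g p + 2 := fun p h1 => by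
      have := hg h1; have := hg h1.symm; omega
    simp only [List.mem_cons, List.not_mem_nil, or_false] at hx
    rcases hx with rfl | rfl | rfl | rfl | rfl | rfl | rfl | rfl | rfl | rfl
    · omega
    exacts [key1 _ hva, key1 _ hvb, key1 _ hvc, key _ _ hva ha1, key _ _ hva ha2, key _ _ hvb hb1,
      key _ _ hvb hb2, key _ _ hvc hc1, key _ _ hvc hc2]

lemma Layered.exists_lay (h : Layered G r lay) {n : ℕ} {x : V} (hx : n ≤ lay x) :
    ∃ y, lay y = n := by
  induction hn : lay x - n generalizing x with
  | zero => exact ⟨x, by omega⟩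
  | succ m ih =>
    have hr : x ≠ r := by rintro rfl; have := h.root; omega
    obtain ⟨y, -, hy⟩ := h.back x hr
    exact ih (x := y) (by omega) (by omega)

lemma Layered.exists_two (h : Layered G r lay) (hdeg : ∀ x, (G.neighborSet x).ncard ≤ 3) [Finite V]
    {i : ℕ} (h1 : ¬ Cut G lay i) (h2 : ¬ Cut G lay (i + 1)) {x : V} (hx : i + 2 ≤ lay x) :
    ∃ a b, a ≠ b ∧ lay a = i + 1 ∧ lay b = i + 1 := by
  obtain ⟨z, hz⟩ := h.exists_lay hx
  obtain ⟨y, hzy, hy⟩ := h.back z (by rintro rfl; have := h.root; omega)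
  obtain ⟨w, hyw, hw⟩ := h.back y (by rintro rfl; have := h.root; omega)
  by_contra hcon
  have huniq : ∀ a, lay a = i + 1 → a = y := fun a ha => by
    by_contra hne; exact hcon ⟨a, y, hne, ha, by omega⟩
  have e1 : ∃ w', G.Adj y w' ∧ lay w' = i ∧ w' ≠ w := by
    by_contra hn
    refine h1 ⟨w, y, hyw.symm, by omega, by omega, fun a b hab ha hb => ?_⟩
    obtain rfl := huniq b hb
    by_contra hne
    exact hn ⟨a, hab.symm, ha, fun e => hne ⟨e, rfl⟩⟩
  have e2 : ∃ z', G.Adj y z' ∧ lay z' = i + 2 ∧ z' ≠ z := by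
    by_contra hn
    refine h2 ⟨y, z, hzy.symm, by omega, by omega, fun a b hab ha hb => ?_⟩
    obtain rfl := huniq a ha
    by_contra hne
    exact hn ⟨b, hab, hb, fun e => hne ⟨rfl, e⟩⟩
  obtain ⟨w', hw'1, hw'2, hw'3⟩ := e1
  obtain ⟨z', hz'1, hz'2, hz'3⟩ := e2
  have hsub : ({w, w', z, z'} : Set V) ⊆ G.neighborSet y := by
    rintro x (rfl | rfl | rfl | rfl)
    exacts [hyw, hw'1, hzy.symm, hz'1]
  have hc := Set.ncard_le_ncard hsub (Set.toFinite _)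
  have : ({w, w', z, z'} : Set V).ncard = 4 := by
    have a1 : w ≠ z := by rintro rfl; omega
    have a2 : w ≠ z' := by rintro rfl; omega
    have a3 : w' ≠ z := by rintro rfl; omega
    have a4 : w' ≠ z' := by rintro rfl; omega
    rw [Set.ncard_insert_of_notMem, Set.ncard_insert_of_notMem, Set.ncard_pair hz'3.symm]
    · simp [a3, a4]
    · simp [hw'3.symm, a1, a2]
  have := hdeg y
  omega

lemma adj_of_four [Finite V] (hG : Sparse G) {a b p q s t : V} (hab : a ≠ b)
    (ha : (G.neighborSet a).ncard = 3) (hb : (G.neighborSet b).ncard = 3)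
    (ha' : ∀ x, G.Adj a x → x = b ∨ x = p ∨ x = q ∨ x = s ∨ x = t)
    (hb' : ∀ x, G.Adj b x → x = a ∨ x = p ∨ x = q ∨ x = s ∨ x = t) : G.Adj a b := by
  by_contra hn
  have hsub : G.neighborSet a ∪ G.neighborSet b ⊆ {p, q, s, t} := by
    rintro x (hx | hx)
    · rcases ha' x hx with rfl | h
      · exact absurd hx hn
      · simpa using h
    · rcases hb' x hx with rfl | h
      · exact absurd hx.symm hn
      · simpa using h
  have h1 := Set.ncard_le_ncard hsub (Set.toFinite _)
  have h2 : ({p, q, s, t} : Set V).ncard ≤ 4 := by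
    have := Set.ncard_insert_le p {q, s, t}
    have := Set.ncard_insert_le q {s, t}
    have := Set.ncard_insert_le s {t}
    have := Set.ncard_singleton t
    omega
  have h3 := Set.ncard_union_add_ncard_inter (G.neighborSet a) (G.neighborSet b)
  obtain ⟨x, hx, y, hy, hxy⟩ := (Set.one_lt_ncard (Set.toFinite _)).1
    (show 1 < (G.neighborSet a ∩ G.neighborSet b).ncard by omega)
  exact hG.sq hx.1 (Adj.symm hx.2) hy.2 (Adj.symm hy.1) hab hxy

lemma Layered.false_of_four_twos [Finite V] (h : Layered G r lay) (hG : Sparse G) {i : ℕ}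
    (hdeg : ∀ x, lay x = i + 1 ∨ lay x = i + 2 → (G.neighborSet x).ncard = 3)
    (a b : ℕ → V) (hab : ∀ t, t = i + 1 ∨ t = i + 2 → a t ≠ b t ∧ lay (a t) = t ∧ lay (b t) = t)
    (hcov : ∀ x, i ≤ lay x → lay x ≤ i + 3 → x = a (lay x) ∨ x = b (lay x)) : False := by
  have key : ∀ t, t = i + 1 ∨ t = i + 2 → G.Adj (a t) (b t) := fun t ht => by
    obtain ⟨h1, h2, h3⟩ := hab t ht
    have hn : ∀ x y, lay y = t → G.Adj y x → x = a t ∨ x = b t ∨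
        x = a (t - 1) ∨ x = b (t - 1) ∨ x = a (t + 1) ∨ x = b (t + 1) := fun x y hy hxy => by
      have e1 := h.lip hxy
      have e2 := h.lip hxy.symm
      have e3 := hcov x (by omega) (by omega)
      obtain h' | h' | h' : lay x = t ∨ lay x = t - 1 ∨ lay x = t + 1 := by omega
      all_goals rw [h'] at e3; tauto
    refine adj_of_four hG h1 (hdeg _ (by omega)) (hdeg _ (by omega))
      (p := a (t - 1)) (q := b (t - 1)) (s := a (t + 1)) (t := b (t + 1))
      (fun x hx => ?_) (fun x hx => ?_)
    · rcases hn x _ h2 hx with rfl | h'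
      · exact absurd rfl hx.ne
      · exact h'
    · rcases hn x _ h3 hx with h' | rfl | h'
      · exact .inl h'
      · exact absurd rfl hx.ne
      · exact .inr h'
  have k1 := key (i + 1) (.inl rfl)
  have k2 := key (i + 2) (.inr rfl)
  obtain ⟨h1, h2, h3⟩ := hab (i + 1) (.inl rfl)
  obtain ⟨h4, h5, h6⟩ := hab (i + 2) (.inr rfl)
  have bk : ∀ x, lay x = i + 2 → G.Adj x (a (i + 1)) ∨ G.Adj x (b (i + 1)) := fun x hx => by
    obtain ⟨y, hy, hl⟩ := h.back x (by rintro rfl; have := h.root; omega)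
    have := hcov y (by omega) (by omega)
    rw [show lay y = i + 1 by omega] at this
    rcases this with rfl | rfl <;> simp [hy]
  rcases bk _ h5 with e | e <;> rcases bk _ h6 with e' | e'
  · exact hG.tri k2 e' e.symm
  · exact hG.sq k2 e' k1.symm e.symm (by intro e; rw [e] at h5; omega) (by intro e; rw [e] at h6; omega)
  · exact hG.sq k2 e' k1 e.symm (by intro e; rw [e] at h5; omega) (by intro e; rw [e] at h6; omega)
  · exact hG.tri k2 e' e.symm

open Classical in
lemma even_three_mul_card_sub [Finite V] (S : Finset V)
    (h : ∀ x, (G.neighborSet x).ncard + (if x ∈ S then 1 else 0) = 3) :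
    Even (3 * Nat.card V - S.card) ∧ S.card ≤ 3 * Nat.card V := by
  have := Fintype.ofFinite V
  have h1 := G.sum_degrees_eq_twice_card_edges
  have h2 : ∑ x, (G.degree x + (if x ∈ S then 1 else 0)) = ∑ _x : V, 3 :=
    Finset.sum_congr rfl fun x _ => by
      rw [← h x, ← card_neighborSet_eq_degree, Set.ncard_eq_toFinset_card', Set.toFinset_card]
  rw [Finset.sum_add_distrib, h1, Finset.sum_ite_mem, Finset.univ_inter] at h2
  simp only [Finset.sum_const, Finset.card_univ, smul_eq_mul] at h2
  rw [Nat.card_eq_fintype_card]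
  refine ⟨⟨G.edgeFinset.card, ?_⟩, ?_⟩ <;> omega

end Local

/-! ### Distances and degrees of explicit graphs -/

noncomputable section

/-- The mask of the neighbours of `i`. -/
def msk (A : List (List ℕ)) (i : ℕ) : ℕ := orAll (fun j => Nat.pow 2 j) (row A i)

/-- The list of all neighbour masks. -/
def masks (A : List (List ℕ)) : List ℕ := A.map fun l => orAll (fun j => Nat.pow 2 j) l

/-- Union of the masks in `ms` selected by the bits of `m`. -/
def hull (ms : List ℕ) : ℕ → ℕ :=
  lrec (fun _ => 0) (fun k _ ih m => Nat.lor (br (tb m 0) k 0) (ih (Nat.shiftRight m 1))) ms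

/-- The mask of the vertices at distance at most `t` from `m`. -/
def ballM (ms : List ℕ) (t : ℕ) : ℕ → ℕ :=
  @Nat.rec (fun _ => ℕ → ℕ) (fun m => m)
    (fun _ ih m => forceNat (fun m' => ih m') (Nat.lor m (hull ms m))) t

/-- Number of bits among the first `n`. -/
def pop (n : ℕ) : ℕ → ℕ :=
  @Nat.rec (fun _ => ℕ → ℕ) (fun _ => 0)
    (fun _ ih m => Nat.add (Nat.land m 1) (forceNat ih (Nat.shiftRight m 1))) n

/-- The lists of neighbours are symmetric, without loops and in range. -/
def goodB (A : List (List ℕ)) : Bool :=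
  Nat.blt 0 (len A) && allB (fun i => allB (fun j => Nat.blt j (len A) && (!(Nat.beq i j) &&
    memb i (row A j))) (row A i)) (List.range (len A))

/-- No triangles and no quadrilaterals. -/
def sparseB (A : List (List ℕ)) : Bool :=
  allB (fun i => allB (fun a => Nat.beq (Nat.land (msk A i) (msk A a)) 0 &&
    allB (fun b => Nat.beq a b || Nat.beq (Nat.land (msk A a) (msk A b)) (Nat.pow 2 i)) (row A i))
      (row A i)) (List.range (len A))

/-- There is a 5-cycle. -/
def fiveB (A : List (List ℕ)) : Bool :=
  anyB (fun a => anyB (fun b => anyB (fun c => anyB (fun d => anyB (fun e =>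
    memb a (row A e) && (!(Nat.beq a c) && (!(Nat.beq a d) && (!(Nat.beq b d) && (!(Nat.beq b e) &&
      !(Nat.beq c e)))))) (row A d)) (row A c)) (row A b)) (row A a)) (List.range (len A))

/-- All degrees are three, up to the deficiencies `δ`. -/
def degB (δ : ℕ → ℕ) (A : List (List ℕ)) : Bool :=
  allB (fun i => Nat.beq (Nat.add (pop (len A) (msk A i)) (δ i)) 3) (List.range (len A))

/-- All distances are at most `e`. -/
def diamB (e : ℕ) (A : List (List ℕ)) : Bool :=
  forceList (fun x k => forceNat k x) (masks A) fun ms => allB (fun i =>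
    Nat.beq (ballM ms e (Nat.pow 2 i)) (Nat.pred (Nat.pow 2 (len A)))) (List.range (len A))

end

lemma beq_eq_false {x y : ℕ} : Nat.beq x y = false ↔ x ≠ y := by
  rw [← Bool.not_eq_true, Nat.beq_eq]

lemma tb_shift (m i j : ℕ) : tb (Nat.shiftRight m i) j = tb m (i + j) := by
  rw [tb_eq, tb_eq]; exact Nat.testBit_shiftRight ..

lemma tb_land (a b j : ℕ) : tb (Nat.land a b) j = (tb a j && tb b j) := by
  simp only [tb_eq]; exact Nat.testBit_and _ _ _

lemma tb_msk {A : List (List ℕ)} {i j : ℕ} : tb (msk A i) j = true ↔ j ∈ row A i := by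
  rw [msk, tb_orAll]; simp only [tb_pow, exists_eq_right]

lemma tb_zero (j : ℕ) : tb 0 j = false := by rw [tb_eq]; simp

lemma tb_hull (ms : List ℕ) : ∀ m j, tb (hull ms m) j = true ↔
    ∃ i, ∃ h : i < ms.length, tb m i = true ∧ tb ms[i] j = true := by
  induction ms with
  | nil => intro m j; simp [hull, lrec, tb_zero]
  | cons k ms ih =>
    intro m j
    have : hull (k :: ms) m = Nat.lor (br (tb m 0) k 0) (hull ms (Nat.shiftRight m 1)) := rfl
    rw [this, tb_lor, Bool.or_eq_true, ih]
    constructor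
    · rintro (h | ⟨i, hi, h1, h2⟩)
      · rw [br_eq] at h
        cases h0 : tb m 0
        · simp [h0, tb_zero] at h
        · exact ⟨0, by simp, h0, by simpa [h0] using h⟩
      · rw [tb_shift] at h1
        exact ⟨i + 1, by simpa using hi, by rwa [add_comm], by simpa using h2⟩
    · rintro ⟨i, hi, h1, h2⟩
      cases i with
      | zero => left; simpa [br_eq, h1] using h2
      | succ i =>
        exact .inr ⟨i, by simpa using hi, by rwa [tb_shift, add_comm], by simpa using h2⟩

lemma ballM_zero (ms : List ℕ) (m : ℕ) : ballM ms 0 m = m := rfl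

lemma ballM_succ (ms : List ℕ) (t m : ℕ) :
    ballM ms (t + 1) m = ballM ms t (Nat.lor m (hull ms m)) := forceNat_eq _ _

lemma pop_eq (n : ℕ) : ∀ m, pop n m = ((Finset.range n).filter fun j => tb m j = true).card := by
  induction n with
  | zero => intro m; rfl
  | succ n ih =>
    intro m
    have h : pop (n + 1) m = Nat.land m 1 + pop n (Nat.shiftRight m 1) := by
      change Nat.land m 1 + forceNat _ _ = _
      rw [forceNat_eq]; rfl
    have h0 : Nat.land m 1 = if tb m 0 = true then 1 else 0 := by
      have : Nat.land m 1 = m % 2 := Nat.and_one_is_mod _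
      rw [this, tb_eq, Nat.testBit_zero]
      rcases Nat.mod_two_eq_zero_or_one m with h | h <;> simp [h]
    rw [h, ih, h0, Finset.range_eq_Ico, Finset.range_eq_Ico, ← Finset.insert_Ico_add_one_left_eq_Ico
      (by omega : 0 < n + 1), Finset.filter_insert]
    have e : ((Finset.Ico (0 + 1) (n + 1)).filter fun j => tb m j = true).card =
        ((Finset.Ico 0 n).filter fun j => tb (Nat.shiftRight m 1) j = true).card := by
      rw [← Finset.image_add_right_Ico, Finset.filter_image,
        Finset.card_image_of_injective _ (add_left_injective 1)]
      simp only [tb_shift, add_comm]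
    split_ifs
    · rw [Finset.card_insert_of_notMem (by simp), e, add_comm]
    · rw [e, zero_add]

lemma ncard_tb (n m : ℕ) : {j : Fin n | tb m j = true}.ncard = pop n m := by
  rw [pop_eq, Set.ncard_eq_toFinset_card', ← Finset.card_map Fin.valEmbedding]
  congr 1
  ext j
  simp only [Finset.mem_map, Set.mem_toFinset, Set.mem_ofPred_eq, Fin.valEmbedding_apply,
    Finset.mem_filter, Finset.mem_range]
  exact ⟨fun ⟨a, h, e⟩ => e ▸ ⟨a.2, h⟩, fun ⟨h, h'⟩ => ⟨⟨j, h⟩, h', rfl⟩⟩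

section Tables

variable {A : List (List ℕ)}

lemma goodB_iff : goodB A = true ↔ 0 < A.length ∧ ∀ i < A.length, ∀ j ∈ row A i,
    j < A.length ∧ i ≠ j ∧ i ∈ row A j := by
  simp [goodB, allB_eq, len_eq, memb_iff, beq_eq_false]

lemma ord_eq (h : goodB A = true) : ord A = A.length := by
  have := (goodB_iff.1 h).1; unfold ord; omega

lemma gr_adj (h : goodB A = true) {i j : Fin (ord A)} : (gr A).Adj i j ↔ j.val ∈ row A i := by
  have h' := goodB_iff.1 h
  have hi : ∀ i : Fin (ord A), i.val < A.length := fun i => ord_eq h ▸ i.2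
  simp only [gr, fromRel_adj]
  constructor
  · rintro ⟨-, h1 | h1⟩
    · exact h1
    · exact (h'.2 _ (hi j) _ h1).2.2
  · intro h1
    exact ⟨fun e => (h'.2 _ (hi i) _ h1).2.1 (congrArg _ e), .inl h1⟩

lemma gr_adj_tb (h : goodB A = true) {i j : Fin (ord A)} :
    (gr A).Adj i j ↔ tb (msk A i) j = true := by rw [gr_adj h, tb_msk]

lemma masks_getElem (i : ℕ) (h : i < (masks A).length) : (masks A)[i] = msk A i := by
  simp only [masks, List.length_map] at h
  simp [masks, msk, row_eq, h]

lemma tb_ballM (h : goodB A = true) (t : ℕ) : ∀ m, ∀ j : Fin (ord A),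
    tb (ballM (masks A) t m) j = true ↔
      ∃ i : Fin (ord A), tb m i = true ∧ ∃ p : (gr A).Walk i j, p.length ≤ t := by
  induction t with
  | zero =>
    intro m j
    rw [ballM_zero]
    refine ⟨fun hm => ⟨j, hm, .nil, by simp⟩, fun ⟨i, hi, p, hp⟩ => ?_⟩
    obtain rfl := Walk.eq_of_length_eq_zero (Nat.le_zero.1 hp)
    exact hi
  | succ t ih =>
    intro m j
    have hg : ∀ k : Fin (ord A), tb (Nat.lor m (hull (masks A) m)) k = true ↔
        tb m k = true ∨ ∃ i : Fin (ord A), tb m i = true ∧ (gr A).Adj i k := fun k => by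
      rw [tb_lor, Bool.or_eq_true, tb_hull]
      refine or_congr Iff.rfl ⟨fun ⟨i, hi, h1, h2⟩ => ?_, fun ⟨i, h1, h2⟩ => ?_⟩
      · rw [masks_getElem] at h2
        have hi' : i < ord A := by rw [ord_eq h]; simpa [masks] using hi
        exact ⟨⟨i, hi'⟩, h1, (gr_adj_tb h).2 h2⟩
      · have hi' : i.val < (masks A).length := by
          have := i.2; have := ord_eq h; simp only [masks, List.length_map]; omega
        exact ⟨i, hi', h1, by rw [masks_getElem]; exact (gr_adj_tb h).1 h2⟩
    rw [ballM_succ, ih]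
    constructor
    · rintro ⟨k, hk, p, hp⟩
      rcases (hg k).1 hk with h1 | ⟨i, h1, h2⟩
      · exact ⟨k, h1, p, by omega⟩
      · exact ⟨i, h1, .cons h2 p, by simpa using hp⟩
    · rintro ⟨i, hi, p, hp⟩
      cases p with
      | nil => exact ⟨j, (hg j).2 (.inl hi), .nil, by simp⟩
      | @cons _ k _ hik q => exact ⟨k, (hg k).2 (.inr ⟨i, hi, hik⟩), q, by simpa using hp⟩

lemma exists_walk_iff (h : goodB A = true) (t : ℕ) (i j : Fin (ord A)) :
    (∃ p : (gr A).Walk i j, p.length ≤ t) ↔ tb (ballM (masks A) t (Nat.pow 2 i)) j = true := by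
  rw [tb_ballM h]
  constructor
  · exact fun hp => ⟨i, (tb_pow _ _).2 rfl, hp⟩
  · rintro ⟨k, hk, hp⟩
    obtain rfl : i = k := Fin.ext ((tb_pow _ _).1 hk)
    exact hp

lemma exists_walk_of_diamB (h : goodB A = true) {e : ℕ} (he : diamB e A = true)
    (i j : Fin (ord A)) : ∃ p : (gr A).Walk i j, p.length ≤ e := by
  rw [diamB, forceList_eq fun _ _ => forceNat_eq _ _, allB_eq, List.all_eq_true] at he
  have := he i (by rw [len_eq, List.mem_range]; exact (ord_eq h).le.trans_lt' i.2)
  rw [Nat.beq_eq] at this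
  rw [exists_walk_iff h, this, tb_eq]
  have e : Nat.pred (Nat.pow 2 (len A)) = 2 ^ A.length - 1 := by rw [len_eq]; rfl
  rw [e, Nat.testBit_two_pow_sub_one]
  exact decide_eq_true ((ord_eq h).le.trans_lt' j.2)

lemma connected_of_diamB (h : goodB A = true) {e : ℕ} (he : diamB e A = true) :
    (gr A).Connected where
  preconnected i j := by obtain ⟨p, -⟩ := exists_walk_of_diamB h he i j; exact ⟨p⟩
  nonempty := ⟨0⟩

lemma dist_le_of_diamB (h : goodB A = true) {e : ℕ} (he : diamB e A = true)
    (i j : Fin (ord A)) : (gr A).dist i j ≤ e := by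
  obtain ⟨p, hp⟩ := exists_walk_of_diamB h he i j
  exact (dist_le p).trans hp

lemma dist_le_iff_tb (h : goodB A = true) (hc : (gr A).Connected) (t : ℕ) (i j : Fin (ord A)) :
    (gr A).dist i j ≤ t ↔ tb (ballM (masks A) t (Nat.pow 2 i)) j = true := by
  rw [← exists_walk_iff h]
  constructor
  · intro hd
    obtain ⟨p, hp⟩ := hc.exists_walk_length_eq_dist i j
    exact ⟨p, by omega⟩
  · rintro ⟨p, hp⟩; exact (dist_le p).trans hp

lemma ncard_dist_le (h : goodB A = true) (hc : (gr A).Connected) (t : ℕ) (i : Fin (ord A)) :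
    {j | (gr A).dist i j ≤ t}.ncard = pop (ord A) (ballM (masks A) t (Nat.pow 2 i)) := by
  rw [← ncard_tb]
  simp only [dist_le_iff_tb h hc]

lemma sparse_of_sparseB (h : goodB A = true) (hs : sparseB A = true) : Sparse (gr A) := by
  have hi : ∀ i : Fin (ord A), i.val < A.length := fun i => ord_eq h ▸ i.2
  simp only [sparseB, allB_eq, List.all_eq_true, len_eq, List.mem_range, Bool.and_eq_true,
    Nat.beq_eq, Bool.or_eq_true] at hs
  constructor
  · intro a b c h1 h2 h3
    have := (hs a (hi a) b ((gr_adj h).1 h1)).1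
    have h4 : tb (Nat.land (msk A a) (msk A b)) c = true := by
      rw [tb_land, (gr_adj_tb h).1 h3.symm, (gr_adj_tb h).1 h2]; rfl
    rw [this, tb_zero] at h4
    exact absurd h4 (by simp)
  · intro a b c d h1 h2 h3 h4 h5 h6
    rcases (hs a (hi a) b ((gr_adj h).1 h1)).2 d ((gr_adj h).1 h4.symm) with h7 | h7
    · exact h6 (Fin.ext h7)
    · have h8 : tb (Nat.land (msk A b) (msk A d)) c = true := by
        rw [tb_land, (gr_adj_tb h).1 h2, (gr_adj_tb h).1 h3.symm]; rfl
      rw [h7, tb_pow] at h8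
      exact h5 (Fin.ext h8)

lemma ncard_of_degB (h : goodB A = true) {δ : ℕ → ℕ} (hd : degB δ A = true) (i : Fin (ord A)) :
    ((gr A).neighborSet i).ncard + δ i = 3 := by
  simp only [degB, allB_eq, List.all_eq_true, len_eq, List.mem_range, Nat.beq_eq] at hd
  have := hd i (ord_eq h ▸ i.2)
  rw [← ord_eq h, ← ncard_tb] at this
  rw [← this]
  congr 2
  ext j
  exact gr_adj_tb h

lemma exists_five_of_fiveB (h : goodB A = true) (hf : fiveB A = true) :
    ∃ a b c d e, (gr A).Adj a b ∧ (gr A).Adj b c ∧ (gr A).Adj c d ∧ (gr A).Adj d e ∧ (gr A).Adj e a ∧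
      a ≠ c ∧ a ≠ d ∧ b ≠ d ∧ b ≠ e ∧ c ≠ e := by
  simp only [fiveB, anyB_eq, List.any_eq_true, len_eq, List.mem_range, Bool.and_eq_true,
    Bool.not_eq_true', memb_iff] at hf
  obtain ⟨a, ha, b, hb, c, hc, d, hd, e, he, h1, h2, h3, h4, h5, h6⟩ := hf
  have hg := (goodB_iff.1 h).2
  have hb' := (hg a ha b hb).1
  have hc' := (hg b hb' c hc).1
  have hd' := (hg c hc' d hd).1
  have he' := (hg d hd' e he).1
  have hne : ∀ x y : ℕ, Nat.beq x y = false → x ≠ y := fun x y hxy => Nat.ne_of_beq_eq_false hxy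
  rw [← ord_eq h] at ha hb' hc' hd' he'
  refine ⟨⟨a, ha⟩, ⟨b, hb'⟩, ⟨c, hc'⟩, ⟨d, hd'⟩, ⟨e, he'⟩, (gr_adj h).2 hb, (gr_adj h).2 hc,
    (gr_adj h).2 hd, (gr_adj h).2 he, (gr_adj h).2 h1, ?_⟩
  simp only [ne_eq, Fin.mk.injEq]
  exact ⟨hne _ _ h2, hne _ _ h3, hne _ _ h4, hne _ _ h5, hne _ _ h6⟩

end Tables

/-! ### The pieces -/

/-- Number of layers and graph of the end pieces. -/
def endTab : List (ℕ × List (List ℕ)) :=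
  clsP11.map (Prod.mk 4) ++ clsA13.map (Prod.mk 5) ++ clsX17.map (Prod.mk 6) ++
    clsX19.map (Prod.mk 7) ++ clsX21.tail.map (Prod.mk 8)

/-- Number of layers, exit and graph of the middle pieces. -/
def midTab : List (ℕ × ℕ × List (List ℕ)) :=
  clsM10.map (fun A => (5, 7, A)) ++ clsM14.map (fun A => (6, 7, A)) ++
    clsM18.map (fun A => (8, 11, A)) ++ clsM20.tail.map (fun A => (9, 13, A))

/-- The graphs with 22 vertices and diameter six. -/
def soloTab : List (List (List ℕ)) := clsG22.drop 3

noncomputable section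

/-- Checks of the properties of an end piece. -/
def endB (E : ℕ × List (List ℕ)) : Bool :=
  goodB E.2 && (sparseB E.2 && (fiveB E.2 && (degB (fun i => br (Nat.beq i 0) 1 0) E.2 &&
    (diamB (Nat.pred E.1) E.2 && (!(diamB (Nat.pred (Nat.pred E.1)) E.2) &&
    (!(Nat.beq (ballM (masks E.2) (Nat.pred (Nat.pred E.1)) 1) (Nat.pred (Nat.pow 2 (len E.2)))) &&
    (Nat.beq (len E.2) (Nat.add (Nat.mul 2 E.1) (br (Nat.ble E.1 5) 3 5)) && Nat.ble 4 E.1)))))))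

/-- Checks of the properties of a middle piece. -/
def midB (M : ℕ × ℕ × List (List ℕ)) : Bool :=
  goodB M.2.2 && (sparseB M.2.2 && (Nat.blt M.2.1 (len M.2.2) && (
    degB (fun i => br (Nat.beq i 0) 1 (br (Nat.beq i M.2.1) 1 0)) M.2.2 &&
    (diamB (Nat.pred M.1) M.2.2 &&
    (!(tb (ballM (masks M.2.2) (Nat.pred (Nat.pred M.1)) 1) M.2.1) &&
    (Nat.beq (len M.2.2) (Nat.add (Nat.mul 2 M.1) (br (Nat.ble M.1 5) 0 2)) &&
      Nat.ble 5 M.1))))))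

/-- Checks of the properties of the remaining graphs. -/
def soloB (A : List (List ℕ)) : Bool :=
  goodB A && (sparseB A && (fiveB A && (degB (fun _ => 0) A && (diamB 6 A && (!(diamB 5 A) &&
    Nat.beq (len A) 22)))))

end

lemma endTab_ok : ∀ E ∈ endTab, endB E = true := by
  have : allB endB endTab = true := by decide +kernel
  simpa [allB_eq] using this

lemma midTab_ok : ∀ M ∈ midTab, midB M = true := by
  have : allB midB midTab = true := by decide +kernel
  simpa [allB_eq] using this

lemma soloTab_ok : ∀ A ∈ soloTab, soloB A = true := by
  have : allB soloB soloTab = true := by decide +kernel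
  simpa [allB_eq] using this

/-- Number of layers of an end piece. -/
def eL (i : Fin 72) : ℕ := (ent (0, []) endTab i).1

/-- Graph of an end piece. -/
def eG (i : Fin 72) : List (List ℕ) := (ent (0, []) endTab i).2

/-- Number of layers of a middle piece. -/
def mL (i : Fin 10) : ℕ := (ent (0, 0, []) midTab i).1

/-- Graph of a middle piece. -/
def mG (i : Fin 10) : List (List ℕ) := (ent (0, 0, []) midTab i).2.2

/-- Exit of a middle piece. -/
def mE (i : Fin 10) : Fin (ord (mG i)) := Fin.ofNat _ (ent (0, 0, []) midTab i).2.1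

lemma endTab_length : endTab.length = 72 := by decide +kernel

lemma midTab_length : midTab.length = 10 := by decide +kernel

lemma eG_mem (i : Fin 72) : (eL i, eG i) ∈ endTab := by
  have h : i.val < endTab.length := by rw [endTab_length]; exact i.2
  have : ent (0, []) endTab i = endTab[i.val] := by
    rw [ent_eq, List.getD_eq_getElem _ _ h]
  simp only [eL, eG, this, Prod.mk.eta]
  exact List.getElem_mem _

lemma mG_mem (i : Fin 10) : (mL i, (ent (0, 0, []) midTab i).2.1, mG i) ∈ midTab := by
  have h : i.val < midTab.length := by rw [midTab_length]; exact i.2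
  have : ent (0, 0, []) midTab i = midTab[i.val] := by
    rw [ent_eq, List.getD_eq_getElem _ _ h]
  simp only [mL, mG, this, Prod.mk.eta]
  exact List.getElem_mem _

lemma exists_end {l : ℕ} {A : List (List ℕ)} (h : (l, A) ∈ endTab) :
    ∃ i : Fin 72, eL i = l ∧ eG i = A := by
  obtain ⟨i, hi, he⟩ := List.getElem_of_mem h
  refine ⟨⟨i, endTab_length ▸ hi⟩, ?_⟩
  simp only [eL, eG, ent_eq, List.getD_eq_getElem _ _ hi, he, and_self]

lemma exists_mid {l x : ℕ} {A : List (List ℕ)} (h : (l, x, A) ∈ midTab) :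
    ∃ i : Fin 10, mL i = l ∧ ∃ _ : mG i = A, (mE i).val = x % ord A := by
  obtain ⟨i, hi, he⟩ := List.getElem_of_mem h
  have : ent (0, 0, []) midTab i = (l, x, A) := by
    rw [ent_eq, List.getD_eq_getElem _ _ hi, he]
  refine ⟨⟨i, midTab_length ▸ hi⟩, ?_⟩
  simp only [mL, mG, mE, this, exists_const, true_and]
  exact congrArg (x % ord ·.2.2) this

/-! ### Layered graphs without bottlenecks -/

/-- A graph with one vertex `r` of degree two, the others of degree three, and layers
`0, …, D`. -/
structure IsTail {V : Type} (G : SimpleGraph V) (r : V) (lay : V → ℕ) (D : ℕ) : Prop where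
  layered : Layered G r lay
  sparse : Sparse G
  deg_root : (G.neighborSet r).ncard = 2
  deg : ∀ x, x ≠ r → (G.neighborSet x).ncard = 3
  le : ∀ x, lay x ≤ D
  top : ∃ x, lay x = D

/-- A graph with two vertices `r` and `y` of degree two, the others of degree three, and layers
`0, …, k`, the vertex `y` being in the last one, with no cut. -/
structure IsMid {V : Type} (G : SimpleGraph V) (r y : V) (lay : V → ℕ) (k : ℕ) : Prop where
  layered : Layered G r lay
  sparse : Sparse G
  deg_root : (G.neighborSet r).ncard = 2
  deg_exit : (G.neighborSet y).ncard = 2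
  deg : ∀ x, x ≠ r → x ≠ y → (G.neighborSet x).ncard = 3
  le : ∀ x, lay x ≤ k
  top : lay y = k
  not_cut : ∀ i < k, ¬ Cut G lay i

section Base

variable {V : Type} {G : SimpleGraph V} {r y : V} {lay : V → ℕ} {D k : ℕ}

lemma length_le_card [Finite V] {L : List V} (h : L.Nodup) : L.length ≤ Nat.card V := by
  classical
  have := Fintype.ofFinite V
  rw [Nat.card_eq_fintype_card]; exact h.length_le_card

lemma mem_of_card_le [Finite V] {L : List V} (h : L.Nodup) (hc : Nat.card V ≤ L.length) (x : V) :
    x ∈ L := by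
  by_contra hx
  have := length_le_card (List.nodup_cons.2 ⟨hx, h⟩)
  simp only [List.length_cons] at this
  omega

lemma exists_middle (m : ℕ) (h : ∀ i < m, ∃ a b, a ≠ b ∧ lay a = 3 + i ∧ lay b = 3 + i) :
    ∃ L : List V, L.length = 2 * m ∧ L.Nodup ∧
      ∀ (i : ℕ) (hi : i < L.length), lay L[i] = 3 + i / 2 := by
  induction m with
  | zero => exact ⟨[], rfl, List.nodup_nil, fun i hi => by simp at hi⟩
  | succ m ih =>
    obtain ⟨L, h1, h2, h3⟩ := ih fun i hi => h i (by omega)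
    obtain ⟨a, b, hab, ha, hb⟩ := h m (by omega)
    refine ⟨L ++ [a, b], by simp [h1]; omega, ?_, fun i hi => ?_⟩
    · refine List.Nodup.append h2 (by simpa using hab) fun x hx hx' => ?_
      obtain ⟨i, hi, rfl⟩ := List.getElem_of_mem hx
      have := h3 i hi
      simp only [List.mem_cons, List.not_mem_nil, or_false] at hx'
      rcases hx' with e | e <;> rw [e] at this <;> omega
    · simp only [List.length_append, List.length_cons, List.length_nil] at hi
      rcases Nat.lt_or_ge i L.length with hi' | hi'
      · rw [List.getElem_append_left hi', h3]
      · rw [List.getElem_append_right hi']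
        obtain h' | h' : i - L.length = 0 ∨ i - L.length = 1 := by omega
        · simp only [h', List.getElem_cons_zero, ha]; omega
        · simp only [h', List.getElem_cons_succ, List.getElem_cons_zero, hb]; omega

/-- Two trees and the layers between them. -/
lemma exists_spine [Finite V] (hl : Layered G r lay) (hG : Sparse G) {L₁ L₂ : List V} {m c : ℕ}
    (h₁ : L₁.length = c) (n₁ : L₁.Nodup) (n₂ : L₂.Nodup) (l₁ : ∀ x ∈ L₁, lay x ≤ 2)
    (l₂ : ∀ x ∈ L₂, 3 + m ≤ lay x)
    (h : ∀ i < m, ∃ a b, a ≠ b ∧ lay a = 3 + i ∧ lay b = 3 + i)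
    (hdeg : ∀ x, 4 ≤ lay x → lay x ≤ 5 → 4 ≤ m → (G.neighborSet x).ncard = 3) :
    ∃ L : List V, L.length = 2 * m ∧ (L₁ ++ L ++ L₂).Nodup ∧
      (Nat.card V = c + 2 * m + L₂.length → m < 4) ∧
      ∀ i (hi : i < (L₁ ++ L ++ L₂).length), min (max (lay (L₁ ++ L ++ L₂)[i]) 2 - 2) (m + 1) =
        if i < c then 0 else if i < c + 2 * m then (i - c) / 2 + 1 else m + 1 := by
  obtain ⟨L, hL, nL, lL⟩ := exists_middle m h
  have lL' : ∀ x ∈ L, 3 ≤ lay x ∧ lay x < 3 + m := fun x hx => by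
    obtain ⟨i, hi, rfl⟩ := List.getElem_of_mem hx
    rw [lL i hi]; omega
  have nd : (L₁ ++ L ++ L₂).Nodup := by
    refine List.Nodup.append (List.Nodup.append n₁ nL fun x hx hx' => ?_) n₂ fun x hx hx' => ?_
    · have := l₁ x hx; have := lL' x hx'; omega
    · have h2 := l₂ x hx'
      rcases List.mem_append.1 hx with hx | hx
      · have := l₁ x hx; omega
      · have := lL' x hx; omega
  refine ⟨L, hL, nd, fun hc => ?_, fun i hi => ?_⟩
  · by_contra hm
    have hall := mem_of_card_le nd (by simp [h₁, hL, hc]; omega)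
    have a0 : ∀ t, 3 ≤ t → t ≤ 6 → 2 * (t - 3) < L.length := fun t _ _ => by omega
    have a1 : ∀ t, 3 ≤ t → t ≤ 6 → 2 * (t - 3) + 1 < L.length := fun t _ _ => by omega
    have g : ∀ i, i < L.length → L.getD i r = L.getD i r := fun i _ => rfl
    refine hl.false_of_four_twos hG (i := 3) (fun x hx => hdeg x (by omega) (by omega) (by omega))
      (fun t => L.getD (2 * (t - 3)) r) (fun t => L.getD (2 * (t - 3) + 1) r) (fun t ht => ?_)
      (fun x h3 h6 => ?_)
    · have h0 := a0 t (by omega) (by omega)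
      have h1 := a1 t (by omega) (by omega)
      simp only [List.getD_eq_getElem _ _ h0, List.getD_eq_getElem _ _ h1]
      refine ⟨fun e => ?_, ?_, ?_⟩
      · have := (nL.getElem_inj_iff).1 e; omega
      · rw [lL]; omega
      · rw [lL]; omega
    · have h0 := a0 (lay x) (by omega) (by omega)
      have h1 := a1 (lay x) (by omega) (by omega)
      simp only [List.getD_eq_getElem _ _ h0, List.getD_eq_getElem _ _ h1]
      have hx : x ∈ L := by
        have := hall x
        simp only [List.mem_append] at this
        rcases this with (hx | hx) | hx
        · have := l₁ x hx; omega
        · exact hx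
        · have := l₂ x hx; omega
      obtain ⟨i, hi, rfl⟩ := List.getElem_of_mem hx
      have := lL i hi
      obtain e | e : i = 2 * (lay L[i] - 3) ∨ i = 2 * (lay L[i] - 3) + 1 := by omega
      · left; congr 1
      · right; congr 1
  · have hi' := hi
    simp only [List.length_append, h₁, hL] at hi'
    rw [List.getElem_append]
    split_ifs with c1 c2 c3 c3
    · rw [List.getElem_append_left (by omega)]
      have := l₁ _ (List.getElem_mem (show i < L₁.length by omega)); omega
    · rw [List.getElem_append_right (by omega), lL]; omega
    · simp only [List.length_append, h₁, hL] at c1; omega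
    · simp only [List.length_append, h₁, hL] at c1; omega
    · simp only [List.length_append, h₁, hL] at c1; omega
    · have := l₂ _ (List.getElem_mem (show i - (L₁ ++ L).length < L₂.length by
        simp only [List.length_append, h₁, hL]; omega)); omega

theorem classify {p : Prob} {cls : List (List (List ℕ))} {lf : List ℕ} {lv : List (List ℕ)}
    {es : List (ℕ × ℕ)} (hrun : run p cls lf lv [edgesGraph p.n es] = true)
    (hwf : (edgesGraph p.n es).length = p.n ∧ ∀ i < p.n, (row (edgesGraph p.n es) i).Nodup ∧
      ∀ j ∈ row (edgesGraph p.n es) i, i ∈ row (edgesGraph p.n es) j) (hp : 0 < p.n)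
    (hc : ∀ A ∈ cls, A.length = p.n) (hG : Sparse G) {L : List V} (hnd : L.Nodup)
    (hlen : L.length = p.n) (hall : ∀ x, x ∈ L)
    (hdeg : ∀ i (h : i < L.length), (G.neighborSet L[i]).ncard = dig p.deg i)
    (f : V → ℕ) (hf : ∀ x y, G.Adj x y → f x ≤ f y + 1)
    (hcol : ∀ i (h : i < L.length), f L[i] = dig p.col i) (hes : On G L es) :
    ∃ A ∈ cls, ∃ φ : gr A ≃g G, ∀ i : Fin (ord A), ∃ j < p.n, L[j]? = some (φ i) ∧
      dig p.mark j = dig p.mark i := by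
  have x₀ : V := L[0]
  have hg : ∀ i x, L[i]? = some x → i < p.n ∧ L.getD i x₀ = x := fun i x h => by
    obtain ⟨h1, h2⟩ := List.getElem?_eq_some_iff.1 h
    exact ⟨hlen ▸ h1, by rw [List.getD_eq_getElem _ _ h1, h2]⟩
  obtain ⟨A, -, -, -, hA, φ, hφ⟩ := exists_iso_of_run hrun (wf_of_forall hwf.1 hwf.2) hp hc hG hnd
    hlen hall hdeg f hf hcol x₀ fun e he => by
      obtain ⟨x, y, hx, hy, hxy⟩ := hes e he
      obtain ⟨h1, h2⟩ := hg _ _ hx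
      obtain ⟨h3, h4⟩ := hg _ _ hy
      exact ⟨h1, h3, by rwa [h2, h4]⟩
  refine ⟨A, hA, φ, fun i => ?_⟩
  obtain ⟨j, hj, e, hm⟩ := hφ i
  refine ⟨j, hj, ?_, hm⟩
  rw [e, List.getElem?_eq_getElem (by omega), List.getD_eq_getElem _ _ (by omega)]

lemma ord_of_length {A : List (List ℕ)} {n : ℕ} (h : A.length = n) (hn : 0 < n) : ord A = n := by
  unfold ord; omega

end Base

section Base

variable {V : Type} {G : SimpleGraph V} {r y : V} {lay : V → ℕ} {D k : ℕ}

lemma dig_zero (i : ℕ) : dig 0 i = 0 := by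
  simp only [dig]; exact (congrArg (Nat.mod · 32) (Nat.zero_shiftRight _)).trans (Nat.zero_mod 32)

lemma exists_extend [Finite V] (L : List V) (h : L.Nodup) :
    ∃ L' : List V, (L ++ L').Nodup ∧ (L ++ L').length = Nat.card V ∧ ∀ x, x ∈ L ++ L' := by
  classical
  have := Fintype.ofFinite V
  set L' := Finset.univ.toList.filter fun x => x ∉ L with hL'
  have h1 : ∀ x, x ∈ L ++ L' := fun x => by
    simp only [hL', List.mem_append, List.mem_filter, Finset.mem_toList, Finset.mem_univ,
      true_and, decide_eq_true_eq]; tauto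
  have h2 : (L ++ L').Nodup :=
    List.Nodup.append h ((Finset.nodup_toList _).filter _) fun x hx hx' => by
      simp [hL'] at hx'; exact hx' hx
  refine ⟨L', h2, ?_, h1⟩
  have := List.toFinset_card_of_nodup h2
  rw [← this, Nat.card_eq_fintype_card, ← Finset.card_univ]
  congr 1; ext x; simpa using h1 x

lemma mem_of_lay_le_two (hl : Layered G r lay) {L : List V} (h0 : L[0]? = some r)
    (h : ∀ x y, G.Adj r x → G.Adj x y → x ∈ L ∧ y ∈ L) {x : V} (hx : lay x ≤ 2) : x ∈ L := by
  have hr : r ∈ L := List.mem_of_getElem? h0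
  by_cases e : x = r
  · exact e ▸ hr
  obtain ⟨y, hxy, hy⟩ := hl.back x e
  by_cases e' : y = r
  · exact (h x y (e' ▸ hxy.symm) hxy).1
  obtain ⟨z, hyz, hz⟩ := hl.back y e'
  obtain rfl := hl.eq_zero_iff.1 (show lay z = 0 by omega)
  exact (h y x hyz.symm hxy.symm).2

lemma eq_zero_of_getElem {L : List V} (hnd : L.Nodup) {t : ℕ} {v : V} (h0 : L[t]? = some v) {i : ℕ}
    (hi : i < L.length) : L[i] = v ↔ i = t := by
  obtain ⟨h1, rfl⟩ := List.getElem?_eq_some_iff.1 h0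
  exact hnd.getElem_inj_iff

lemma classify_tail {p : Prob} {cls : List (List (List ℕ))} {lf : List ℕ} {lv : List (List ℕ)}
    {es : List (ℕ × ℕ)} (hrun : run p cls lf lv [edgesGraph p.n es] = true)
    (hwf : ((edgesGraph p.n es).length = p.n ∧ ∀ i < p.n, (row (edgesGraph p.n es) i).Nodup ∧
      ∀ j ∈ row (edgesGraph p.n es) i, i ∈ row (edgesGraph p.n es) j) ∧ 0 < p.n ∧
      (∀ A ∈ cls, A.length = p.n) ∧ ∀ i < p.n, dig p.deg i = (if i = 0 then 2 else 3) ∧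
        dig p.mark i = if i = 0 then 1 else 0)
    (hG : Sparse G) (hr : (G.neighborSet r).ncard = 2)
    (hd : ∀ x, x ≠ r → (G.neighborSet x).ncard = 3) {L : List V} (hnd : L.Nodup)
    (hlen : L.length = p.n) (hall : ∀ x, x ∈ L) (h0 : L[0]? = some r)
    (f : V → ℕ) (hf : ∀ x y, G.Adj x y → f x ≤ f y + 1)
    (hcol : ∀ i (h : i < L.length), f L[i] = dig p.col i) (hes : On G L es) :
    ∃ A ∈ cls, ∃ φ : gr A ≃g G, φ 0 = r := by
  obtain ⟨hw, hp, hc, hdm⟩ := hwf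
  obtain ⟨A, hA, φ, hφ⟩ := classify hrun hw hp hc hG hnd hlen hall (fun i hi => by
    rw [(hdm i (by omega)).1]
    split_ifs with h
    · rw [(eq_zero_of_getElem hnd h0 hi).2 h, hr]
    · exact hd _ fun e => h ((eq_zero_of_getElem hnd h0 hi).1 e)) f hf hcol hes
  refine ⟨A, hA, φ, ?_⟩
  obtain ⟨j, hj, hj', hm⟩ := hφ 0
  rw [Fin.val_zero, (hdm j hj).2, (hdm 0 hp).2, if_pos rfl] at hm
  split_ifs at hm with e
  rw [e, h0] at hj'
  exact (Option.some.inj hj').symm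

lemma classify_mid {p : Prob} {cls : List (List (List ℕ))} {lf : List ℕ} {lv : List (List ℕ)}
    {es : List (ℕ × ℕ)} {t : ℕ} (hrun : run p cls lf lv [edgesGraph p.n es] = true)
    (hwf : ((edgesGraph p.n es).length = p.n ∧ ∀ i < p.n, (row (edgesGraph p.n es) i).Nodup ∧
      ∀ j ∈ row (edgesGraph p.n es) i, i ∈ row (edgesGraph p.n es) j) ∧ t < p.n ∧ 0 < t ∧
      (∀ A ∈ cls, A.length = p.n) ∧ ∀ i < p.n, dig p.deg i = (if i = 0 ∨ i = t then 2 else 3) ∧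
        dig p.mark i = if i = 0 then 1 else if i = t then 2 else 0)
    (hG : Sparse G) (hr : (G.neighborSet r).ncard = 2) (hy : (G.neighborSet y).ncard = 2)
    (hd : ∀ x, x ≠ r → x ≠ y → (G.neighborSet x).ncard = 3) {L : List V} (hnd : L.Nodup)
    (hlen : L.length = p.n) (hall : ∀ x, x ∈ L) (h0 : L[0]? = some r) (ht : L[t]? = some y)
    (f : V → ℕ) (hf : ∀ x y, G.Adj x y → f x ≤ f y + 1)
    (hcol : ∀ i (h : i < L.length), f L[i] = dig p.col i) (hes : On G L es) :
    ∃ A ∈ cls, ∃ φ : gr A ≃g G, φ 0 = r ∧ ∀ i : Fin (ord A), i.val = t → φ i = y := by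
  obtain ⟨hw, htp, ht0, hc, hdm⟩ := hwf
  obtain ⟨A, hA, φ, hφ⟩ := classify hrun hw (by omega) hc hG hnd hlen hall (fun i hi => by
    rw [(hdm i (by omega)).1]
    split_ifs with h
    · rcases h with h | h
      · rw [(eq_zero_of_getElem hnd h0 hi).2 h, hr]
      · rw [(eq_zero_of_getElem hnd ht hi).2 h, hy]
    · rw [← eq_zero_of_getElem hnd h0 hi, ← eq_zero_of_getElem hnd ht hi, not_or] at h
      exact hd _ h.1 h.2) f hf hcol hes
  refine ⟨A, hA, φ, ?_, fun i hi => ?_⟩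
  · obtain ⟨j, hj, hj', hm⟩ := hφ 0
    rw [Fin.val_zero, (hdm j hj).2, (hdm 0 (by omega)).2, if_pos rfl] at hm
    split_ifs at hm with e
    · rw [e, h0] at hj'
      exact (Option.some.inj hj').symm
    · omega
  · obtain ⟨j, hj, hj', hm⟩ := hφ i
    rw [hi, (hdm j hj).2, (hdm t htp).2, if_neg ht0.ne', if_pos rfl] at hm
    split_ifs at hm with e e'
    · omega
    · rw [e', ht] at hj'
      exact (Option.some.inj hj').symm

lemma IsTail.deg_le (h : IsTail G r lay D) (x : V) : (G.neighborSet x).ncard ≤ 3 := by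
  by_cases e : x = r
  · rw [e, h.deg_root]; omega
  · rw [h.deg x e]

lemma layer_lip (hl : Layered G r lay) (m : ℕ) (x y : V) (h : G.Adj x y) :
    min (max (lay x) 2 - 2) (m + 1) ≤ min (max (lay y) 2 - 2) (m + 1) + 1 := by
  have := hl.lip h.symm; omega

lemma treeR_map (n : ℕ) : (treeR 0).map (fun e => (n + e.1, n + e.2)) = treeR n := by
  simp [treeR]

lemma treeU_map (n : ℕ) : (treeU 0).map (fun e => (n + e.1, n + e.2)) = treeU n := by
  simp [treeU]

lemma IsTail.three_le [Finite V] (h : IsTail G r lay D) : 3 ≤ D := by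
  obtain ⟨u₀, hu₀⟩ := h.top
  have hn : ∀ x, G.Adj r x → (G.neighborSet x).ncard = 3 := fun x hx => h.deg x hx.ne'
  obtain ⟨L, h1, h2, h3, -, h5, -⟩ := exists_treeR h.sparse h.deg_root hn
  by_contra hD
  have hall : ∀ x, x ∈ L := fun x => mem_of_lay_le_two h.layered h3 h5 (by have := h.le x; omega)
  have hcard : Nat.card V ≤ 7 := by
    classical
    rw [← h1, ← List.toFinset_card_of_nodup h2, ← Nat.card_eq_finsetCard]
    exact Nat.card_le_card_of_injective (fun x => ⟨x, by simpa using hall x⟩)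
      fun x y e => by simpa using e
  obtain ⟨u, hu, hu'⟩ : ∃ u, u ≠ r ∧ ¬ G.Adj r u := by
    by_contra hcon
    push Not at hcon
    have : (Set.univ : Set V) ⊆ insert r (G.neighborSet r) := fun x _ => by
      by_cases e : x = r
      · exact .inl e
      · exact .inr (hcon x e)
    have h6 := Set.ncard_le_ncard this (Set.toFinite _)
    have h7 := Set.ncard_insert_le r (G.neighborSet r)
    have h8 := length_le_card h2
    rw [Set.ncard_univ] at h6
    have := h.deg_root
    omega
  obtain ⟨U, hU, nU, -⟩ := exists_treeU h.sparse (h.deg u hu)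
    fun x hx => h.deg x fun e => hu' (e ▸ hx.symm)
  have := length_le_card nU
  omega

lemma exists_end_of_iso {cls : List (List (List ℕ))} {l : ℕ}
    (hmem : ∀ A ∈ cls, (l, A) ∈ endTab) (h : ∃ A ∈ cls, ∃ φ : gr A ≃g G, φ 0 = r) :
    ∃ E : Fin 72, eL E = l ∧ ∃ φ : gr (eG E) ≃g G, φ 0 = r := by
  obtain ⟨A, hA, h⟩ := h
  obtain ⟨E, h1, rfl⟩ := exists_end (hmem A hA)
  exact ⟨E, h1, h⟩

lemma IsTail.odd_card [Finite V] (h : IsTail G r lay D) : Odd (Nat.card V) := by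
  classical
  have := even_three_mul_card_sub (G := G) {r} fun x => by
    by_cases e : x = r
    · simp [e, h.deg_root]
    simp [e, h.deg x e]
  rw [Finset.card_singleton, Nat.even_sub this.2] at this
  have := this.1
  simp only [Nat.even_mul] at this
  have e2 : ¬ Even 1 := by decide
  have e3 : ¬ Even 3 := by decide
  rw [← Nat.not_even_iff_odd]
  tauto

theorem IsTail.base [Finite V] (h : IsTail G r lay D) (hc : ∀ i < D, ¬ Cut G lay i) :
    2 * D + 5 ≤ Nat.card V ∧ (Nat.card V = 2 * D + 5 ∨ Nat.card V = 2 * D + 7 ∧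
        ((D + 1) % 5 = 1 ∨ (D + 1) % 5 = 2 ∨ (D + 1) % 5 = 3) →
      ∃ E : Fin 72, eL E = D + 1 ∧ ∃ φ : gr (eG E) ≃g G, φ 0 = r) := by
  have hD := h.three_le
  obtain ⟨u, hu⟩ := h.top
  have hur : u ≠ r := by rintro rfl; have := h.layered.root; omega
  obtain ⟨U, hU, nU, oU, bU⟩ := exists_treeU h.sparse (h.deg u hur) fun x hx => h.deg x (by
    rintro rfl; have := h.layered.lip hx.symm; have := h.layered.root; omega)
  have bU' : ∀ x ∈ U, D ≤ lay x + 2 := fun x hx => by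
    have := (bU lay h.layered.lip x hx).2; omega
  rcases Nat.lt_or_ge D 5 with hD5 | hD5
  · obtain rfl | rfl : D = 3 ∨ D = 4 := by omega
    · have nd : (r :: U).Nodup := List.nodup_cons.2
        ⟨fun hr => by have := bU' r hr; have := h.layered.root; omega, nU⟩
      have hcard := length_le_card nd
      simp only [List.length_cons, hU] at hcard
      refine ⟨hcard, fun he => ?_⟩
      refine exists_end_of_iso (cls := clsP11) (by decide +kernel) ?_
      refine classify_tail (p := probP11) runP11 (by decide +kernel) h.sparse h.deg_root h.deg nd
        (by simp [hU, probP11]) (mem_of_card_le nd (by simp [hU]; omega)) rfl 0 (by simp)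
        (fun i hi => ?_) ?_
      · exact (dig_zero i).symm
      · have := oU.append_right [r]
        rwa [treeU_map] at this
    · obtain ⟨a, b, hab, he⟩ := Set.ncard_eq_two.1 h.deg_root
      have ha : G.Adj r a := by rw [← mem_neighborSet, he]; simp
      have hb : G.Adj r b := by rw [← mem_neighborSet, he]; simp
      have hl1 := h.layered.lip ha
      have hl2 := h.layered.lip hb
      have hl0 := h.layered.root
      have nd : ([r, a, b] ++ U).Nodup := by
        refine List.Nodup.append (by simp [ha.ne, hb.ne, hab]) nU fun x hx hx' => ?_
        have := bU' x hx'
        simp only [List.mem_cons, List.not_mem_nil, or_false] at hx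
        rcases hx with rfl | rfl | rfl <;> omega
      have hcard := length_le_card nd
      simp only [List.length_append, List.length_cons, List.length_nil, hU] at hcard
      refine ⟨hcard, fun he => ?_⟩
      refine exists_end_of_iso (cls := clsA13) (by decide +kernel) ?_
      refine classify_tail (p := probA13) runA13 (by decide +kernel) h.sparse h.deg_root h.deg nd
        (by simp [hU, probA13]) (mem_of_card_le nd (by simp [hU]; omega)) rfl 0 (by simp)
        (fun i hi => ?_) (On.append ?_ ?_)
      · exact (dig_zero i).symm
      · refine On.append_left (L := [r, a, b]) ?_ U
        intro e he
        simp only [List.mem_cons, List.not_mem_nil, or_false] at he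
        rcases he with rfl | rfl
        exacts [⟨r, a, rfl, rfl, ha⟩, ⟨r, b, rfl, rfl, hb⟩]
      · have := oU.append_right [r, a, b]
        rwa [treeU_map] at this
  · have hn : ∀ x, G.Adj r x → (G.neighborSet x).ncard = 3 := fun x hx => h.deg x hx.ne'
    obtain ⟨R, hR, nR, r0, oR, -, bR⟩ := exists_treeR h.sparse h.deg_root hn
    obtain ⟨m, rfl⟩ : ∃ m, D = m + 5 := ⟨D - 5, by omega⟩
    have hl0 := h.layered.root
    obtain ⟨L, hL, nd, hm, hcol⟩ := exists_spine (m := m) h.layered h.sparse hR nR nU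
      (fun x hx => by have := (bR lay h.layered.lip x hx).1; omega)
      (fun x hx => by have := bU' x hx; omega)
      (fun i hi => by
        obtain ⟨a, b, hab, h1, h2⟩ := h.layered.exists_two h.deg_le (i := i + 2) (x := u)
          (hc _ (by omega)) (hc _ (by omega)) (by omega)
        exact ⟨a, b, hab, by omega, by omega⟩)
      (fun x hx _ _ => h.deg x (by rintro rfl; omega))
    have hlen : (R ++ L ++ U).length = 7 + 2 * m + 10 := by simp [hR, hL, hU]; omega
    have hcard := length_le_card nd
    rw [hlen] at hcard
    refine ⟨by omega, fun he => ?_⟩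
    obtain ⟨he, hres⟩ : Nat.card V = 2 * m + 17 ∧ (m + 5 + 1) % 5 ≠ 4 := by omega
    have hall := mem_of_card_le nd (by omega)
    have h0 : (R ++ L ++ U)[0]? = some r := by
      rw [List.append_assoc, List.getElem?_append_left (by omega), r0]
    have hes : On G (R ++ L ++ U) (treeR 0 ++ treeU (7 + 2 * m)) := by
      refine On.append ((oR.append_left L).append_left U) ?_
      have := oU.append_right (R ++ L)
      rwa [treeU_map, show (R ++ L).length = 7 + 2 * m by simp [hR, hL]] at this
    have hm4 := hm (by omega)
    obtain rfl | rfl | rfl : m = 0 ∨ m = 1 ∨ m = 2 := by omega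
    · refine exists_end_of_iso (cls := clsX17) (by decide +kernel) ?_
      refine classify_tail (p := probX17) runX17 (by decide +kernel) h.sparse h.deg_root h.deg nd
        hlen hall h0 0 (by simp) (fun i hi => ?_) hes
      exact (dig_zero i).symm
    · refine exists_end_of_iso (cls := clsX19) (by decide +kernel) ?_
      refine classify_tail (p := probX19) runX19 (by decide +kernel) h.sparse h.deg_root h.deg nd
        hlen hall h0 _ (layer_lip h.layered 1) (fun i hi => ?_) hes
      rw [hcol i hi]
      exact (by decide +kernel : ∀ i < 19, (if i < 7 then 0 else if i < 7 + 2 * 1 then (i - 7) / 2 + 1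
        else 1 + 1) = dig probX19.col i) i (by omega)
    · refine exists_end_of_iso (cls := clsX21.tail) (by decide +kernel) ?_
      obtain ⟨A, hA, φ, hφ⟩ := classify_tail (p := probX21) runX21 (by decide +kernel) h.sparse
        h.deg_root h.deg nd hlen hall h0 _ (layer_lip h.layered 2) (fun i hi => by
          rw [hcol i hi]
          exact (by decide +kernel : ∀ i < 21, (if i < 7 then 0 else if i < 7 + 2 * 2 then
            (i - 7) / 2 + 1 else 2 + 1) = dig probX21.col i) i (by omega)) hes
      have hdec : ∀ A ∈ clsX21, A ∈ clsX21.tail ∨ goodB A = true ∧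
          ∃ j < ord A, tb (ballM (masks A) 7 1) j = false := by decide +kernel
      rcases hdec A hA with h1 | ⟨hg, j, hj, h1⟩
      · exact ⟨A, h1, φ, hφ⟩
      · exfalso
        have hcon := φ.connected_iff.2 h.layered.connected
        have h2 : ¬ (gr A).dist 0 ⟨j, hj⟩ ≤ 7 := by
          rw [dist_le_iff_tb hg hcon, Bool.not_eq_true]; exact h1
        rw [← Iso.dist_eq hcon φ, hφ, h.layered.dist_eq] at h2
        exact h2 (h.le _)

lemma exists_mid_of_iso {cls : List (List (List ℕ))} {l t : ℕ}
    (hmem : ∀ A ∈ cls, (l, t, A) ∈ midTab ∧ t < ord A)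
    (h : ∃ A ∈ cls, ∃ φ : gr A ≃g G, φ 0 = r ∧ ∀ i : Fin (ord A), i.val = t → φ i = y) :
    ∃ M : Fin 10, mL M = l ∧ ∃ φ : gr (mG M) ≃g G, φ 0 = r ∧ φ (mE M) = y := by
  obtain ⟨A, hA, φ, h1, h2⟩ := h
  obtain ⟨M, h3, rfl, h4⟩ := exists_mid (hmem A hA).1
  exact ⟨M, h3, φ, h1, h2 _ (by rw [h4, Nat.mod_eq_of_lt (hmem _ hA).2])⟩

lemma IsMid.even_card [Finite V] (h : IsMid G r y lay k) (hry : r ≠ y) : Even (Nat.card V) := by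
  classical
  have := even_three_mul_card_sub (G := G) {r, y} fun x => by
    by_cases e : x = r
    · simp [e, h.deg_root]
    by_cases e' : x = y
    · simp [e', h.deg_exit]
    simp [e, e', h.deg x e e']
  rw [Finset.card_pair hry, Nat.even_sub this.2] at this
  have := this.1
  simp only [Nat.even_mul] at this
  have e2 : Even 2 := by decide
  have e3 : ¬ Even 3 := by decide
  tauto

theorem IsMid.base [Finite V] (h : IsMid G r y lay k) (hk : 2 ≤ k) :
    2 * k + 2 ≤ Nat.card V ∧ (Nat.card V = 2 * k + 2 ∨ Nat.card V = 2 * k + 4 ∧ k ≠ 4 →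
      ∃ M : Fin 10, mL M = k + 1 ∧ ∃ φ : gr (mG M) ≃g G, φ 0 = r ∧ φ (mE M) = y) := by
  have hl0 := h.layered.root
  have hyk := h.top
  have hry : r ≠ y := by rintro rfl; omega
  have hnadj : ¬ G.Adj r y := fun e => by have := h.layered.lip e; omega
  have hn : ∀ x, G.Adj r x → (G.neighborSet x).ncard = 3 := fun x hx =>
    h.deg x hx.ne' (by rintro rfl; exact hnadj hx)
  obtain ⟨R, hR, nR, r0, oR, aR, bR⟩ := exists_treeR h.sparse h.deg_root hn
  have bR' : ∀ x ∈ R, lay x ≤ 2 := fun x hx => by have := (bR lay h.layered.lip x hx).1; omega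
  obtain ⟨c, hc⟩ := h.even_card hry
  have h7 := length_le_card nR
  have hdeg3 : ∀ x, (G.neighborSet x).ncard ≤ 3 := fun x => by
    by_cases e : x = r
    · rw [e, h.deg_root]; omega
    by_cases e' : x = y
    · rw [e', h.deg_exit]; omega
    rw [h.deg x e e']
  rcases Nat.lt_or_ge k 3 with hk3 | hk3
  · exfalso
    have hall : ∀ x, x ∈ R := fun x =>
      mem_of_lay_le_two h.layered r0 aR (by have := h.le x; omega)
    obtain ⟨L', h1, h2, -⟩ := exists_extend R nR
    obtain rfl : L' = [] := List.eq_nil_iff_forall_not_mem.2 fun x hx =>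
      List.disjoint_of_nodup_append h1 (hall x) hx
    simp [hR] at h2
    omega
  have ndy : (R ++ [y]).Nodup := List.Nodup.append nR (by simp) fun x hx hx' => by
    rw [List.mem_singleton] at hx'; have := bR' x hx; rw [hx'] at this; omega
  obtain ⟨L', hnd, hlen, hall⟩ := exists_extend _ ndy
  have hR0 : (R ++ [y] ++ L')[0]? = some r := by
    rw [List.append_assoc, List.getElem?_append_left (by omega), r0]
  have hR7 : (R ++ [y] ++ L')[7]? = some y := by
    rw [List.append_assoc, List.getElem?_append_right (by omega), hR]; rfl
  have hes := (oR.append_left [y]).append_left L'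
  have h10 : Nat.card V = 10 → ∃ A ∈ clsM10, ∃ φ : gr A ≃g G, φ 0 = r ∧
      ∀ i : Fin (ord A), i.val = 7 → φ i = y := fun e =>
    classify_mid (p := probM10) runM10 (by decide +kernel) h.sparse h.deg_root h.deg_exit h.deg hnd
      (hlen.trans e) hall hR0 hR7 0 (by simp) (fun i hi => by
        exact (dig_zero i).symm) hes
  rcases Nat.lt_or_ge k 5 with hk5 | hk5
  · obtain rfl | rfl : k = 3 ∨ k = 4 := by omega
    · refine ⟨by omega, fun he => False.elim ?_⟩
      obtain he | he : Nat.card V = 8 ∨ Nat.card V = 10 := by omega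
      · obtain ⟨A, hA, -⟩ := classify_mid (p := probM8) runM8 (by decide +kernel) h.sparse h.deg_root
          h.deg_exit h.deg hnd (hlen.trans he) hall hR0 hR7 0 (by simp) (fun i hi => by
            exact (dig_zero i).symm) hes
        simp [clsM8] at hA
      · obtain ⟨A, hA, φ, h1, h2⟩ := h10 he
        have hdec : ∀ A ∈ clsM10, goodB A = true ∧ 7 < ord A ∧
          tb (ballM (masks A) 3 1) 7 = false := by decide +kernel
        obtain ⟨hg, h8, h9⟩ := hdec A hA
        have hcon := φ.connected_iff.2 h.layered.connected
        have h3 : ¬ (gr A).dist 0 ⟨7, h8⟩ ≤ 3 := by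
          rw [dist_le_iff_tb hg hcon, Bool.not_eq_true]; exact h9
        rw [← Iso.dist_eq hcon φ, h1, h.layered.dist_eq, h2 _ rfl, hyk] at h3
        exact h3 le_rfl
    · obtain ⟨a, b, hab, he⟩ := Set.ncard_eq_two.1 h.deg_exit
      have ha : G.Adj y a := by rw [← mem_neighborSet, he]; simp
      have hb : G.Adj y b := by rw [← mem_neighborSet, he]; simp
      have nd : (R ++ [y, a, b]).Nodup := List.Nodup.append nR (by simp [ha.ne, hb.ne, hab])
        fun x hx hx' => by
          have h1 := bR' x hx
          have := h.layered.lip ha.symm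
          have := h.layered.lip hb.symm
          simp only [List.mem_cons, List.not_mem_nil, or_false] at hx'
          rcases hx' with rfl | rfl | rfl <;> omega
      have := length_le_card nd
      simp only [List.length_append, List.length_cons, List.length_nil, hR] at this
      exact ⟨this, fun he => exists_mid_of_iso (cls := clsM10) (by decide +kernel) (h10 (by omega))⟩
  · obtain ⟨S, hS, nS, s0, oS, -, bS⟩ := exists_treeR h.sparse h.deg_exit fun x hx =>
      h.deg x (by rintro rfl; exact hnadj hx.symm) hx.ne'
    obtain ⟨m, rfl⟩ : ∃ m, k = m + 5 := ⟨k - 5, by omega⟩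
    obtain ⟨L, hL, nd, hm, hcol⟩ := exists_spine (m := m) h.layered h.sparse hR nR nS bR'
      (fun x hx => by have := (bS lay h.layered.lip x hx).2; omega)
      (fun i hi => by
        obtain ⟨a, b, hab, h1, h2⟩ := h.layered.exists_two hdeg3 (i := i + 2) (x := y)
          (h.not_cut _ (by omega)) (h.not_cut _ (by omega)) (by omega)
        exact ⟨a, b, hab, by omega, by omega⟩)
      (fun x hx _ _ => h.deg x (by rintro rfl; omega) (by rintro rfl; omega))
    have hlen : (R ++ L ++ S).length = 7 + 2 * m + 7 := by simp [hR, hL, hS]; omega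
    have hcard := length_le_card nd
    rw [hlen] at hcard
    refine ⟨by omega, fun he => ?_⟩
    have he : Nat.card V = 2 * m + 14 := by omega
    have hall := mem_of_card_le nd (by omega)
    have h0 : (R ++ L ++ S)[0]? = some r := by
      rw [List.append_assoc, List.getElem?_append_left (by omega), r0]
    have hRL : (R ++ L).length = 7 + 2 * m := by simp [hR, hL]
    have hy : (R ++ L ++ S)[7 + 2 * m]? = some y := by
      rw [List.getElem?_append_right (by omega), hRL, Nat.sub_self, s0]
    have hes : On G (R ++ L ++ S) (treeR 0 ++ treeR (7 + 2 * m)) := by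
      refine On.append ((oR.append_left L).append_left S) ?_
      have := oS.append_right (R ++ L)
      rwa [treeR_map, hRL] at this
    have hm4 := hm (by omega)
    obtain rfl | rfl | rfl | rfl : m = 0 ∨ m = 1 ∨ m = 2 ∨ m = 3 := by omega
    · refine exists_mid_of_iso (t := 7) (cls := clsM14) (by decide +kernel) ?_
      refine classify_mid (p := probM14) runM14 (by decide +kernel) h.sparse h.deg_root h.deg_exit
        h.deg nd hlen hall h0 hy 0 (by simp) (fun i hi => ?_) hes
      exact (dig_zero i).symm
    · obtain ⟨A, hA, -⟩ := classify_mid (p := probM16) runM16 (by decide +kernel) h.sparse h.deg_root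
        h.deg_exit h.deg nd hlen hall h0 hy _ (layer_lip h.layered 1) (fun i hi => by
          rw [hcol i hi]
          exact (by decide +kernel : ∀ i < 16, (if i < 7 then 0 else if i < 7 + 2 * 1 then
            (i - 7) / 2 + 1 else 1 + 1) = dig probM16.col i) i (by omega)) hes
      simp [clsM16] at hA
    · refine exists_mid_of_iso (t := 11) (cls := clsM18) (by decide +kernel) ?_
      refine classify_mid (p := probM18) runM18 (by decide +kernel) h.sparse h.deg_root h.deg_exit
        h.deg nd hlen hall h0 hy _ (layer_lip h.layered 2) (fun i hi => ?_) hes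
      rw [hcol i hi]
      exact (by decide +kernel : ∀ i < 18, (if i < 7 then 0 else if i < 7 + 2 * 2 then
        (i - 7) / 2 + 1 else 2 + 1) = dig probM18.col i) i (by omega)
    · refine exists_mid_of_iso (t := 13) (cls := clsM20.tail) (by decide +kernel) ?_
      obtain ⟨A, hA, φ, h1, h2⟩ := classify_mid (p := probM20) runM20 (by decide +kernel) h.sparse
        h.deg_root h.deg_exit h.deg nd hlen hall h0 hy _ (layer_lip h.layered 3) (fun i hi => by
          rw [hcol i hi]
          exact (by decide +kernel : ∀ i < 20, (if i < 7 then 0 else if i < 7 + 2 * 3 then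
            (i - 7) / 2 + 1 else 3 + 1) = dig probM20.col i) i (by omega)) hes
      have hdec : ∀ A ∈ clsM20, A ∈ clsM20.tail ∨ goodB A = true ∧ 13 < ord A ∧
          tb (ballM (masks A) 8 1) 13 = false := by decide +kernel
      rcases hdec A hA with h3 | ⟨hg, h3, h4⟩
      · exact ⟨A, h3, φ, h1, h2⟩
      · exfalso
        have hcon := φ.connected_iff.2 h.layered.connected
        have h5 : ¬ (gr A).dist 0 ⟨13, h3⟩ ≤ 8 := by
          rw [dist_le_iff_tb hg hcon, Bool.not_eq_true]; exact h4
        rw [← Iso.dist_eq hcon φ, h1, h.layered.dist_eq, h2 _ rfl, hyk] at h5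
        exact h5 le_rfl

end Base

/-! ### Joining two graphs by an edge -/

/-- The disjoint union of `G` and `H` with an additional edge from `x` to `y`. -/
def glue {V W : Type} (G : SimpleGraph V) (x : V) (H : SimpleGraph W) (y : W) :
    SimpleGraph (V ⊕ W) where
  Adj
    | .inl a, .inl b => G.Adj a b
    | .inr a, .inr b => H.Adj a b
    | .inl a, .inr b => a = x ∧ b = y
    | .inr b, .inl a => a = x ∧ b = y
  symm := ⟨by
    rintro (a | a) (b | b) h
    exacts [Adj.symm h, h, h, Adj.symm h]⟩
  loopless := ⟨by
    rintro (a | a) h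
    exacts [G.loopless.irrefl a h, H.loopless.irrefl a h]⟩

section Glue

variable {V W V' W' : Type} {G : SimpleGraph V} {H : SimpleGraph W} {x : V} {y : W}
  {G' : SimpleGraph V'} {H' : SimpleGraph W'} {x' : V'} {y' : W'}

@[simp] lemma glue_inl_inl {a b : V} : (glue G x H y).Adj (.inl a) (.inl b) ↔ G.Adj a b := Iff.rfl

@[simp] lemma glue_inr_inr {a b : W} : (glue G x H y).Adj (.inr a) (.inr b) ↔ H.Adj a b := Iff.rfl

@[simp] lemma glue_inl_inr {a : V} {b : W} :
    (glue G x H y).Adj (.inl a) (.inr b) ↔ a = x ∧ b = y := Iff.rfl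

@[simp] lemma glue_inr_inl {a : V} {b : W} :
    (glue G x H y).Adj (.inr b) (.inl a) ↔ a = x ∧ b = y := Iff.rfl

/-- Isomorphic graphs give isomorphic joins. -/
def glueCongr (φ : G ≃g G') (ψ : H ≃g H') (hx : φ x = x') (hy : ψ y = y') :
    glue G x H y ≃g glue G' x' H' y' where
  toEquiv := Equiv.sumCongr φ.toEquiv ψ.toEquiv
  map_rel_iff' := by
    subst hx hy
    rintro (a | a) (b | b) <;> simp [SimpleGraph.Iso.map_adj_iff]

/-- Exchanging the two sides. -/
def glueComm : glue G x H y ≃g glue H y G x where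
  toEquiv := Equiv.sumComm V W
  map_rel_iff' := by
    rintro (a | a) (b | b) <;> simp [and_comm]

/-- Moving the block in the middle to the other side. -/
def glueSlide {U : Type} {K : SimpleGraph U} {u : U} {e r : V} {e' r' : V'} (β : G ≃g G')
    (h1 : β r = e') (h2 : β e = r') :
    glue (glue G e H y) (.inl r) K u ≃g glue H y (glue G' e' K u) (.inl r') where
  toEquiv := {
    toFun := Sum.elim (Sum.elim (fun a => .inr (.inl (β a))) .inl) (fun a => .inr (.inr a))
    invFun := Sum.elim (fun a => .inl (.inr a)) (Sum.elim (fun a => .inl (.inl (β.symm a))) .inr)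
    left_inv := by rintro ((a | a) | a) <;> simp
    right_inv := by rintro (a | (a | a)) <;> simp }
  map_rel_iff' := by
    subst h1 h2
    rintro ((a | a) | a) ((b | b) | b) <;>
      simp [and_comm, SimpleGraph.Iso.map_adj_iff]

/-- Cutting a graph along its only edge between `p` and its complement. -/
noncomputable def glueSplit (p : V → Prop) {y z : V} (hy : p y) (hz : ¬ p z)
    (h : ∀ a b, p a → ¬ p b → (G.Adj a b ↔ a = y ∧ b = z)) :
    glue (G.induce {a | p a}) ⟨y, hy⟩ (G.induce {a | ¬ p a}) ⟨z, hz⟩ ≃g G where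
  toEquiv := by
    classical
    exact Equiv.sumCompl p
  map_rel_iff' := by
    classical
    rintro (a | a) (b | b)
    · exact Iff.rfl
    · refine (h _ _ a.2 b.2).trans ?_
      rw [glue_inl_inr, Subtype.ext_iff, Subtype.ext_iff]
    · refine (G.adj_comm _ _).trans ((h _ _ b.2 a.2).trans ?_)
      rw [glue_inr_inl, Subtype.ext_iff, Subtype.ext_iff]
    · exact Iff.rfl

lemma glueSplit_inl {p : V → Prop} {y z : V} (hy : p y) (hz : ¬ p z)
    (h : ∀ a b, p a → ¬ p b → (G.Adj a b ↔ a = y ∧ b = z)) (a : {a | p a}) :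
    glueSplit p hy hz h (.inl a) = a := rfl

lemma glueSplit_inr {p : V → Prop} {y z : V} (hy : p y) (hz : ¬ p z)
    (h : ∀ a b, p a → ¬ p b → (G.Adj a b ↔ a = y ∧ b = z)) (a : {a | ¬ p a}) :
    glueSplit p hy hz h (.inr a) = a := rfl

/-- An isomorphism of joins respecting the two sides consists of two isomorphisms. -/
lemma exists_iso_of_glue (f : glue G x H y ≃g glue G' x' H' y')
    (h1 : ∀ a, ∃ a', f (.inl a) = .inl a') (h2 : ∀ b, ∃ b', f (.inr b) = .inr b') :
    ∃ (φ : G ≃g G') (ψ : H ≃g H'), φ x = x' ∧ ψ y = y' ∧ ∀ a, f (.inl a) = .inl (φ a) := by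
  choose φ hφ using h1
  choose ψ hψ using h2
  have iφ : φ.Injective := fun a b e => by
    have : f (.inl a) = f (.inl b) := by rw [hφ, hφ, e]
    simpa using this
  have iψ : ψ.Injective := fun a b e => by
    have : f (.inr a) = f (.inr b) := by rw [hψ, hψ, e]
    simpa using this
  have sφ : φ.Surjective := fun a => by
    obtain ⟨c | c, hc⟩ := f.surjective (.inl a)
    · exact ⟨c, by rw [hφ] at hc; simpa using hc⟩
    · rw [hψ] at hc; cases hc
  have sψ : ψ.Surjective := fun a => by
    obtain ⟨c | c, hc⟩ := f.surjective (.inr a)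
    · rw [hφ] at hc; cases hc
    · exact ⟨c, by rw [hψ] at hc; simpa using hc⟩
  have hadj : (glue G' x' H' y').Adj (f (.inl x)) (f (.inr y)) := f.map_adj_iff.2 ⟨rfl, rfl⟩
  rw [hφ, hψ] at hadj
  exact ⟨⟨.ofBijective φ ⟨iφ, sφ⟩, fun {a b} => by
      have := f.map_adj_iff (v := .inl a) (w := .inl b)
      rw [hφ, hφ] at this; exact this⟩,
    ⟨.ofBijective ψ ⟨iψ, sψ⟩, fun {a b} => by
      have := f.map_adj_iff (v := .inr a) (w := .inr b)
      rw [hψ, hψ] at this; exact this⟩, hadj.1, hadj.2, hφ⟩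

lemma ncard_glue_inl [Finite V] [Finite W] (a : V) [Decidable (a = x)] :
    ((glue G x H y).neighborSet (.inl a)).ncard =
      (G.neighborSet a).ncard + if a = x then 1 else 0 := by
  have h0 : (Sum.inl '' G.neighborSet a : Set (V ⊕ W)).ncard = (G.neighborSet a).ncard :=
    Set.ncard_image_of_injective _ Sum.inl_injective
  split_ifs with e
  · rw [← h0, ← Set.ncard_insert_of_notMem (a := Sum.inr y) (by simp)]
    congr 1
    ext (b | b) <;> simp [e]
  · rw [← h0, add_zero]
    congr 1
    ext (b | b) <;> simp [e]

lemma ncard_map_iso (f : G ≃g G') (v : V) :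
    (G'.neighborSet (f v)).ncard = (G.neighborSet v).ncard := by
  rw [← Set.ncard_image_of_injective _ f.injective]
  congr 1
  ext w
  obtain ⟨w, rfl⟩ := f.surjective w
  simp [SimpleGraph.Iso.map_adj_iff]

lemma ncard_glue_inr [Finite V] [Finite W] (b : W) [Decidable (b = y)] :
    ((glue G x H y).neighborSet (.inr b)).ncard =
      (H.neighborSet b).ncard + if b = y then 1 else 0 := by
  rw [← ncard_glue_inl (y := x) (H := G) b, ← ncard_map_iso glueComm]
  rfl

lemma Sparse.induce (h : Sparse G) (S : Set V) : Sparse (G.induce S) where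
  tri _ _ _ h1 h2 h3 := h.tri h1 h2 h3
  sq _ _ _ _ h1 h2 h3 h4 h5 h6 := h.sq h1 h2 h3 h4 (fun e => h5 (Subtype.ext e))
    (fun e => h6 (Subtype.ext e))

lemma Sparse.glue (h : Sparse G) (h' : Sparse H) : Sparse (glue G x H y) where
  tri := by
    rintro (a | a) (b | b) (c | c) h1 h2 h3
    all_goals simp only [glue_inl_inl, glue_inl_inr, glue_inr_inl, glue_inr_inr] at h1 h2 h3
    · exact h.tri h1 h2 h3
    iterate 6 grind [SimpleGraph.irrefl]
    · exact h'.tri h1 h2 h3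
  sq := by
    rintro (a | a) (b | b) (c | c) (d | d) h1 h2 h3 h4 h5 h6
    all_goals simp only [glue_inl_inl, glue_inl_inr, glue_inr_inl, glue_inr_inr, ne_eq,
      Sum.inl.injEq, Sum.inr.injEq] at h1 h2 h3 h4 h5 h6
    · exact h.sq h1 h2 h3 h4 h5 h6
    iterate 14 grind [SimpleGraph.irrefl]
    · exact h'.sq h1 h2 h3 h4 h5 h6

/-- The embedding of the left side. -/
def glueInl : G →g glue G x H y := ⟨Sum.inl, fun h => h⟩

lemma exists_walk_inl (hG : G.Connected) (a b : V) :
    ∃ p : (glue G x H y).Walk (.inl a) (.inl b), p.length = G.dist a b := by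
  obtain ⟨p, hp⟩ := hG.exists_walk_length_eq_dist a b
  exact ⟨p.map glueInl, (Walk.length_map _ _).trans hp⟩

lemma exists_walk_inr (hH : H.Connected) (a b : W) :
    ∃ p : (glue G x H y).Walk (.inr a) (.inr b), p.length = H.dist a b := by
  obtain ⟨p, hp⟩ := hH.exists_walk_length_eq_dist a b
  exact ⟨p.map (⟨Sum.inr, fun h => h⟩ : H →g _), (Walk.length_map _ _).trans hp⟩

lemma exists_walk_inl_inr (hG : G.Connected) (hH : H.Connected) (a : V) (b : W) :
    ∃ p : (glue G x H y).Walk (.inl a) (.inr b), p.length = G.dist a x + 1 + H.dist y b := by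
  obtain ⟨p, hp⟩ := exists_walk_inl (x := x) (H := H) (y := y) hG a x
  obtain ⟨q, hq⟩ := exists_walk_inr (x := x) (G := G) (y := y) hH y b
  refine ⟨p.append (.cons (glue_inl_inr.2 ⟨rfl, rfl⟩) q), ?_⟩
  rw [Walk.length_append, Walk.length_cons]; omega

lemma glue_connected (hG : G.Connected) (hH : H.Connected) : (glue G x H y).Connected where
  preconnected := by
    rintro (a | a) (b | b)
    · exact (exists_walk_inl hG a b).elim fun p _ => ⟨p⟩
    · exact (exists_walk_inl_inr hG hH a b).elim fun p _ => ⟨p⟩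
    · exact (exists_walk_inl_inr hG hH b a).elim fun p _ => ⟨p.reverse⟩
    · exact (exists_walk_inr hH a b).elim fun p _ => ⟨p⟩
  nonempty := ⟨.inl x⟩

lemma glue_dist_ge (hG : G.Connected) (hH : H.Connected) (a : V) (v : V ⊕ W) :
    Sum.elim (G.dist a) (fun b => G.dist a x + 1 + H.dist y b) v ≤
      (glue G x H y).dist (.inl a) v := by
  have := le_dist_of_lip (glue_connected (x := x) (y := y) hG hH)
    (f := Sum.elim (G.dist a) (fun b => G.dist a x + 1 + H.dist y b)) (by
      rintro (u | u) (v | v) h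
      · exact dist_le_succ_of_adj hG a h
      · obtain ⟨rfl, rfl⟩ := h; simp
      · obtain ⟨rfl, rfl⟩ := h; simp; omega
      · have := dist_le_succ_of_adj hH y h
        simp only [Sum.elim_inr]; omega) (.inl a) v
  simpa using this

lemma glue_dist_inl (hG : G.Connected) (hH : H.Connected) (a b : V) :
    (glue G x H y).dist (.inl a) (.inl b) = G.dist a b := by
  obtain ⟨p, hp⟩ := exists_walk_inl (x := x) (H := H) (y := y) hG a b
  exact le_antisymm (hp ▸ dist_le p) (glue_dist_ge hG hH a (.inl b))

lemma glue_dist_inl_inr (hG : G.Connected) (hH : H.Connected) (a : V) (b : W) :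
    (glue G x H y).dist (.inl a) (.inr b) = G.dist a x + 1 + H.dist y b := by
  obtain ⟨p, hp⟩ := exists_walk_inl_inr (x := x) (y := y) hG hH a b
  exact le_antisymm (hp ▸ dist_le p) (glue_dist_ge hG hH a (.inr b))

lemma glue_dist_inr (hG : G.Connected) (hH : H.Connected) (a b : W) :
    (glue G x H y).dist (.inr a) (.inr b) = H.dist a b := by
  rw [← glue_dist_inl (x := y) (y := x) hH hG, ← Iso.dist_eq (glue_connected hG hH) glueComm]
  rfl

end Glue

/-! ### Chains of pieces -/

/-- A graph with a root. -/
structure RG where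
  V : Type
  G : SimpleGraph V
  r : V

/-- The end piece `E`. -/
def endRG (E : Fin 72) : RG := ⟨Fin (ord (eG E)), gr (eG E), 0⟩

/-- The middle pieces of `L` attached one after another in front of `X`. -/
def ext : List (Fin 10) → RG → RG
  | [], X => X
  | M :: L, X => ⟨Fin (ord (mG M)) ⊕ (ext L X).V, glue (gr (mG M)) (mE M) (ext L X).G (ext L X).r,
      .inl 0⟩

/-- The chain with middle pieces `L` and end piece `E`. -/
def tail (L : List (Fin 10)) (E : Fin 72) : RG := ext L (endRG E)

/-- The number of layers of the middle pieces of `L`. -/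
def mlen (L : List (Fin 10)) : ℕ := (L.map mL).sum

/-- Two rooted graphs joined at their roots. -/
def RG.join (X Y : RG) : SimpleGraph (X.V ⊕ Y.V) := glue X.G X.r Y.G Y.r

/-- `G` rooted at `r` is a chain with `l` layers. -/
def IsChain {V : Type} (G : SimpleGraph V) (r : V) (l : ℕ) : Prop :=
  ∃ L E, mlen L + eL E = l ∧ ∃ φ : (tail L E).G ≃g G, φ (tail L E).r = r

/-- `G` rooted at `r` with exit `y` is a middle piece with `l` layers. -/
def IsLink {V : Type} (G : SimpleGraph V) (r y : V) (l : ℕ) : Prop :=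
  ∃ M : Fin 10, mL M = l ∧ ∃ φ : gr (mG M) ≃g G, φ 0 = r ∧ φ (mE M) = y

lemma ext_finite {X : RG} [Finite X.V] : ∀ L, Finite (ext L X).V
  | [] => ‹_›
  | _ :: L => have := ext_finite (X := X) L; inferInstanceAs (Finite (_ ⊕ _))

instance (L : List (Fin 10)) (X : RG) [Finite X.V] : Finite (ext L X).V := ext_finite L

instance (E : Fin 72) : Finite (endRG E).V := inferInstanceAs (Finite (Fin _))

instance (L : List (Fin 10)) (E : Fin 72) : Finite (tail L E).V := inferInstanceAs (Finite (ext _ _).V)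

lemma end_spec (E : Fin 72) : 4 ≤ eL E ∧ eL E ≤ 8 ∧
    ord (eG E) = 2 * eL E + if eL E ≤ 5 then 3 else 5 := by
  have h8 : ∀ E ∈ endTab, E.1 ≤ 8 := by decide +kernel
  have h := endTab_ok _ (eG_mem E)
  simp only [endB, Bool.and_eq_true, Nat.beq_eq, Nat.ble_eq, len_eq, br_eq] at h
  obtain ⟨-, -, -, -, -, -, -, h, h4⟩ := h
  refine ⟨h4, h8 _ (eG_mem E), ?_⟩
  have h1 : (eG E).length = 2 * eL E + if eL E ≤ 5 then 3 else 5 := by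
    simpa [Bool.cond_eq_ite] using h
  rw [← h1, ord_of_length rfl]
  omega

lemma mid_spec (M : Fin 10) : 5 ≤ mL M ∧
    ord (mG M) = 2 * mL M + if mL M ≤ 5 then 0 else 2 := by
  have h := midTab_ok _ (mG_mem M)
  simp only [midB, Bool.and_eq_true, Nat.beq_eq, Nat.ble_eq, len_eq, br_eq] at h
  obtain ⟨-, -, -, -, -, -, h, h4⟩ := h
  refine ⟨h4, ?_⟩
  have h1 : (mG M).length = 2 * mL M + if mL M ≤ 5 then 0 else 2 := by
    simpa [Bool.cond_eq_ite] using h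
  rw [← h1, ord_of_length rfl]
  omega

section Split

variable {V : Type} {G : SimpleGraph V} {r y z : V} {lay : V → ℕ} {D k : ℕ}

lemma Layered.adj_iff_of_cut (h : Layered G r lay) (hyz : G.Adj y z) (hy : lay y = k)
    (hz : lay z = k + 1)
    (hu : ∀ y' z', G.Adj y' z' → lay y' = k → lay z' = k + 1 → y' = y ∧ z' = z) (a b : V)
    (ha : lay a ≤ k) (hb : ¬ lay b ≤ k) : G.Adj a b ↔ a = y ∧ b = z := by
  refine ⟨fun e => ?_, ?_⟩
  · have := h.lip e
    exact hu _ _ e (by omega) (by omega)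
  · rintro ⟨rfl, rfl⟩; exact hyz

lemma Layered.upper (h : Layered G r lay) (hz : lay z = k + 1)
    (ha : ∀ a b, lay a ≤ k → ¬ lay b ≤ k → (G.Adj a b ↔ a = y ∧ b = z)) :
    Layered (G.induce {a | ¬ lay a ≤ k}) ⟨z, by simp; omega⟩ (fun a => lay a - (k + 1)) where
  root := by simp [hz]
  lip := by
    rintro ⟨a, ha⟩ ⟨b, hb⟩ e
    have := h.lip e
    change ¬ lay a ≤ k at ha
    change ¬ lay b ≤ k at hb
    dsimp only at this ⊢
    change lay b ≤ lay a + 1 at this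
    omega
  back := by
    rintro ⟨a, ha'⟩ e
    simp only [Set.mem_ofPred_eq] at ha'
    obtain ⟨b, hab, hb⟩ := h.back a (by rintro rfl; have := h.root; omega)
    by_cases hbk : lay b ≤ k
    · exact absurd (Subtype.ext ((ha b a hbk ha').1 hab.symm).2) e
    · exact ⟨⟨b, hbk⟩, hab, by simp; omega⟩

lemma Layered.lower (h : Layered G r lay) :
    Layered (G.induce {a | lay a ≤ k}) ⟨r, by simp [h.root]⟩ (fun a => lay a) where
  root := h.root
  lip _ _ e := h.lip e
  back := by
    rintro ⟨a, ha'⟩ e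
    simp only [Set.mem_ofPred_eq] at ha'
    obtain ⟨b, hab, hb⟩ := h.back a fun e' => e (Subtype.ext e')
    exact ⟨⟨b, by simp; omega⟩, hab, hb⟩

open Classical in
lemma ncard_lower [Finite V] (hy : lay y ≤ k) (hz : ¬ lay z ≤ k)
    (h : ∀ a b, lay a ≤ k → ¬ lay b ≤ k → (G.Adj a b ↔ a = y ∧ b = z)) (a : {a | lay a ≤ k}) :
    (G.neighborSet a).ncard = ((G.induce {a | lay a ≤ k}).neighborSet a).ncard +
      if a.1 = y then 1 else 0 := by
  have := ncard_map_iso (glueSplit (fun a => lay a ≤ k) hy hz h) (.inl a)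
  rw [glueSplit_inl, ncard_glue_inl] at this
  simpa only [Subtype.ext_iff] using this

open Classical in
lemma ncard_upper [Finite V] (hy : lay y ≤ k) (hz : ¬ lay z ≤ k)
    (h : ∀ a b, lay a ≤ k → ¬ lay b ≤ k → (G.Adj a b ↔ a = y ∧ b = z)) (a : {a | ¬ lay a ≤ k}) :
    (G.neighborSet a).ncard = ((G.induce {a | ¬ lay a ≤ k}).neighborSet a).ncard +
      if a.1 = z then 1 else 0 := by
  have := ncard_map_iso (glueSplit (fun a => lay a ≤ k) hy hz h) (.inr a)
  rw [glueSplit_inr, ncard_glue_inr] at this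
  simpa only [Subtype.ext_iff] using this

lemma card_lower_add_upper [Finite V] :
    Nat.card {a | lay a ≤ k} + Nat.card {a | ¬ lay a ≤ k} = Nat.card V := by
  classical
  rw [← Nat.card_sum]
  exact Nat.card_congr (Equiv.sumCompl fun a => lay a ≤ k)

/-- The part of a layered cubic graph beyond a cut. -/
lemma Layered.isTail_upper [Finite V] (h : Layered G r lay) (hG : Sparse G)
    (hd : ∀ x, x ≠ r → (G.neighborSet x).ncard = 3) (hyz : lay y = k ∧ lay z = k + 1)
    (ha : ∀ a b, lay a ≤ k → ¬ lay b ≤ k → (G.Adj a b ↔ a = y ∧ b = z)) (hk : k < D)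
    (hle : ∀ x, lay x ≤ D) (ht : ∃ x, lay x = D) :
    IsTail (G.induce {a | ¬ lay a ≤ k}) ⟨z, by simp; omega⟩ (fun a => lay a - (k + 1))
      (D - (k + 1)) where
  layered := h.upper hyz.2 ha
  sparse := hG.induce _
  deg_root := by
    have := ncard_upper hyz.1.le (by omega) ha ⟨z, by simp; omega⟩
    have hzr : z ≠ r := by rintro rfl; have := h.root; omega
    rw [hd _ hzr] at this
    simpa using this.symm
  deg := by
    intro x hx
    have := ncard_upper hyz.1.le (by omega) ha x
    rw [if_neg fun e => hx (Subtype.ext e), hd _ (by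
      intro e; have h0 := h.root; have h1 : ¬ lay x ≤ k := x.2; rw [e] at h1; omega)] at this
    exact this.symm
  le x := by have := hle x; omega
  top := by
    obtain ⟨x, hx⟩ := ht
    exact ⟨⟨x, by simp; omega⟩, by simp [hx]⟩

lemma IsTail.two_le_of_cut (h : IsTail G r lay D) (hc : Cut G lay k) : 2 ≤ k := by
  obtain ⟨y, z, -, -, -, hu⟩ := hc
  obtain ⟨a, b, hab, he⟩ := Set.ncard_eq_two.1 h.deg_root
  have hm : ∀ x, G.Adj r x ↔ x = a ∨ x = b := fun x => by rw [← mem_neighborSet, he]; simp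
  have ha := (hm a).2 (by simp)
  have hb := (hm b).2 (by simp)
  have h0 := h.layered.root
  have hl : ∀ x, G.Adj r x → lay x = 1 := fun x hx => by
    have := h.layered.lip hx
    have := mt h.layered.eq_zero_iff.1 hx.ne'
    omega
  by_contra hk
  obtain rfl | rfl : k = 0 ∨ k = 1 := by omega
  · exact hab ((hu _ _ ha h0 (hl _ ha)).2.trans (hu _ _ hb h0 (hl _ hb)).2.symm)
  · obtain ⟨c, d, hcd, hc, hd, hac, had, -⟩ := exists_two_others (h.deg a ha.ne') ha.symm
    have h2 : ∀ x, x ≠ r → G.Adj a x → lay x = 2 := fun x hx hax => by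
      have h1 := h.layered.lip hax
      have h3 := mt h.layered.eq_zero_iff.1 hx
      have h4 : lay x ≠ 1 := fun e => by
        obtain ⟨w, hw, hw'⟩ := h.layered.back x hx
        obtain rfl := h.layered.eq_zero_iff.1 (show lay w = 0 by omega)
        exact h.sparse.tri ha hax hw
      have := hl a ha
      omega
    exact hcd ((hu _ _ hac (hl _ ha) (h2 _ hc hac)).2.trans
      (hu _ _ had (hl _ ha) (h2 _ hd had)).2.symm)

/-- The part of a tail before its first cut. -/
lemma IsTail.isMid_lower [Finite V] (h : IsTail G r lay D) (hyz : lay y = k ∧ lay z = k + 1)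
    (ha : ∀ a b, lay a ≤ k → ¬ lay b ≤ k → (G.Adj a b ↔ a = y ∧ b = z)) (hry : r ≠ y)
    (hmin : ∀ i < k, ¬ Cut G lay i) :
    IsMid (G.induce {a | lay a ≤ k}) ⟨r, by simp [h.layered.root]⟩ ⟨y, hyz.1.le⟩
      (fun a => lay a) k where
  layered := h.layered.lower
  sparse := h.sparse.induce _
  deg_root := by
    have := ncard_lower hyz.1.le (by omega) ha ⟨r, by simp [h.layered.root]⟩
    rw [if_neg hry, h.deg_root] at this
    exact this.symm
  deg_exit := by
    have := ncard_lower hyz.1.le (by omega) ha ⟨y, hyz.1.le⟩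
    rw [if_pos rfl, h.deg _ hry.symm] at this
    exact (Nat.succ.inj this).symm
  deg := fun x hx hx' => by
    have := ncard_lower hyz.1.le (by omega) ha x
    rw [if_neg fun e => hx' (Subtype.ext e), h.deg _ fun e => hx (Subtype.ext e)] at this
    exact this.symm
  le := fun x => x.2
  top := hyz.1
  not_cut := fun i hi => by
    rintro ⟨a, b, hab, h1, h2, h3⟩
    exact hmin i hi ⟨a, b, hab, h1, h2, fun a' b' hab' h1' h2' => by
      have := h3 ⟨a', by simp; omega⟩ ⟨b', by simp; omega⟩ hab' h1' h2'
      simpa only [Subtype.ext_iff] using this⟩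

lemma IsChain.cons (hy : lay y ≤ k) (hz : ¬ lay z ≤ k) (hr : lay r ≤ k)
    (h : ∀ a b, lay a ≤ k → ¬ lay b ≤ k → (G.Adj a b ↔ a = y ∧ b = z)) {l l' : ℕ}
    (h1 : IsLink (G.induce {a | lay a ≤ k}) ⟨r, hr⟩ ⟨y, hy⟩ l)
    (h2 : IsChain (G.induce {a | ¬ lay a ≤ k}) ⟨z, hz⟩ l') : IsChain G r (l + l') := by
  obtain ⟨M, rfl, φ, hφ1, hφ2⟩ := h1
  obtain ⟨L, E, rfl, ψ, hψ⟩ := h2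
  refine ⟨M :: L, E, by simp [mlen, add_assoc], (glueCongr φ ψ hφ2 hψ).trans
    (glueSplit (fun a => lay a ≤ k) hy hz h), ?_⟩
  exact congrArg Subtype.val hφ1

lemma count_cons {D k s₁ s₂ s c : ℕ} {P₁ P₂ P₃ : Prop} (hk : k < D) (hc : s₁ = c + c)
    (m₁ : 2 * k + 2 ≤ s₁) (m₂ : s₁ = 2 * k + 2 ∨ s₁ = 2 * k + 4 ∧ k ≠ 4 → P₁)
    (t₁ : 2 * (D - (k + 1)) + 5 ≤ s₂)
    (t₂ : s₂ = 2 * (D - (k + 1)) + 5 → (D - (k + 1) + 1) % 5 = 4 ∨ (D - (k + 1) + 1) % 5 = 0)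
    (t₃ : s₂ = 2 * (D - (k + 1)) + 5 ∨ s₂ = 2 * (D - (k + 1)) + 7 ∧ ((D - (k + 1) + 1) % 5 = 1 ∨
      (D - (k + 1) + 1) % 5 = 2 ∨ (D - (k + 1) + 1) % 5 = 3) → P₂)
    (hm : s₁ = 2 * k + 2 → k = 4) (hs : s₁ + s₂ = s) (hP : P₁ → P₂ → P₃) :
    2 * D + 5 ≤ s ∧ (s = 2 * D + 5 → (D + 1) % 5 = 4 ∨ (D + 1) % 5 = 0) ∧
      (s = 2 * D + 5 ∨ s = 2 * D + 7 ∧ ((D + 1) % 5 = 1 ∨ (D + 1) % 5 = 2 ∨ (D + 1) % 5 = 3) →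
        P₃) := by
  refine ⟨by omega, fun e => ?_, fun e => ?_⟩
  · have := hm (by omega)
    have := t₂ (by omega)
    omega
  · by_cases e1 : s₁ = 2 * k + 2
    · have := hm e1
      exact hP (m₂ (.inl e1)) (t₃ (by omega))
    · have := t₂ (by omega)
      exact hP (m₂ (.inr (by omega))) (t₃ (by omega))

theorem IsTail.classify {V : Type} [Finite V] {G : SimpleGraph V} {r : V} {lay : V → ℕ} {D : ℕ}
    (h : IsTail G r lay D) :
    2 * D + 5 ≤ Nat.card V ∧ (Nat.card V = 2 * D + 5 → (D + 1) % 5 = 4 ∨ (D + 1) % 5 = 0) ∧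
      (Nat.card V = 2 * D + 5 ∨ Nat.card V = 2 * D + 7 ∧
          ((D + 1) % 5 = 1 ∨ (D + 1) % 5 = 2 ∨ (D + 1) % 5 = 3) →
        IsChain G r (D + 1)) := by
  induction D using Nat.strong_induction_on generalizing V with
  | _ D ih =>
  by_cases hc : ∃ k, k < D ∧ Cut G lay k
  · obtain ⟨k, ⟨hk, hcut⟩, hmin⟩ : ∃ k, (k < D ∧ Cut G lay k) ∧ ∀ i < k, ¬ Cut G lay i := by
      classical
      exact ⟨_, Nat.find_spec hc, fun i hi hc' => Nat.find_min hc hi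
        ⟨hi.trans (Nat.find_spec hc).1, hc'⟩⟩
    have hk2 := h.two_le_of_cut hcut
    obtain ⟨y, z, hyz, hy, hz, hu⟩ := hcut
    have ha := h.layered.adj_iff_of_cut hyz hy hz hu
    have hT := h.layered.isTail_upper h.sparse h.deg ⟨hy, hz⟩ ha hk h.le h.top
    have hry : r ≠ y := by rintro rfl; have := h.layered.root; omega
    have hM := h.isMid_lower ⟨hy, hz⟩ ha hry hmin
    obtain ⟨m1, m2⟩ := hM.base hk2
    change _ → IsLink _ _ _ _ at m2
    obtain ⟨c, hc2⟩ := hM.even_card fun e => hry (congrArg Subtype.val e)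
    obtain ⟨t1, t2, t3⟩ := ih _ (by omega) hT
    have hcard := card_lower_add_upper (V := V) (lay := lay) (k := k)
    have hmid : Nat.card {a | lay a ≤ k} = 2 * k + 2 → k = 4 := fun e => by
      obtain ⟨M, hM1, φ, -⟩ := m2 (.inl e)
      have h1 := Nat.card_congr φ.toEquiv
      rw [Nat.card_fin, e] at h1
      have := mid_spec M
      clear m2 t2 t3
      split_ifs at this <;> omega
    have hjoin := IsChain.cons (l := k + 1) (l' := D - (k + 1) + 1) hy.le
      (by omega) (by rw [h.layered.root]; omega) ha
    rw [show k + 1 + (D - (k + 1) + 1) = D + 1 by omega] at hjoin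
    exact count_cons hk hc2 m1 m2 t1 t2 t3 hmid hcard hjoin
  · obtain ⟨h1, h2⟩ := h.base fun i hi hc' => hc ⟨i, hi, hc'⟩
    refine ⟨h1, fun e => ?_, fun e => ?_⟩
    · obtain ⟨E, hE, φ, -⟩ := h2 (.inl e)
      have h3 := Nat.card_congr φ.toEquiv
      rw [Nat.card_fin, e] at h3
      have := end_spec E
      split_ifs at this <;> omega
    · obtain ⟨E, hE, φ, hφ⟩ := h2 e
      exact ⟨[], E, by simpa [mlen] using hE, φ, hφ⟩

end Split

/-! ### Reversal -/

noncomputable section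

/-- The map with table `p` is an isomorphism from `A` to `B` with inverse `q`. -/
def isoB (A B : List (List ℕ)) (p q : List ℕ) : Bool :=
  Nat.beq (len A) (len B) && (allB (fun i => Nat.blt (ent 0 p i) (len A) &&
    (Nat.blt (ent 0 q i) (len A) && (Nat.beq (ent 0 q (ent 0 p i)) i &&
    (Nat.beq (ent 0 p (ent 0 q i)) i && (allB (fun j => memb (ent 0 p j) (row B (ent 0 p i)))
    (row A i) && allB (fun j => memb (ent 0 q j) (row A (ent 0 q i))) (row B i))))))
      (List.range (len A)))

end

lemma exists_iso_of_isoB {A B : List (List ℕ)} {p q : List ℕ} (hA : goodB A = true)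
    (hB : goodB B = true) (h : isoB A B p q = true) :
    ∃ φ : gr A ≃g gr B, ∀ i, (φ i).val = ent 0 p i := by
  simp only [isoB, Bool.and_eq_true, allB_eq, List.all_eq_true, List.mem_range, Nat.beq_eq,
    Nat.blt_eq, memb_iff, len_eq] at h
  obtain ⟨hl, h⟩ := h
  have oA := ord_eq hA
  have oB := ord_eq hB
  refine ⟨⟨⟨fun i => ⟨ent 0 p i, by have := (h i (by omega)).1; omega⟩,
    fun i => ⟨ent 0 q i, by have := (h i (by omega)).2.1; omega⟩,
    fun i => Fin.ext (h i (by omega)).2.2.1, fun i => Fin.ext (h i (by omega)).2.2.2.1⟩, ?_⟩,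
    fun _ => rfl⟩
  intro i j
  obtain ⟨-, -, h1, -, h2, -⟩ := h i (by omega)
  obtain ⟨hpi, -, h3, -⟩ := h j (by omega)
  rw [gr_adj hA, gr_adj hB]
  refine ⟨fun e => ?_, h2 _⟩
  have := (h _ (h i (by omega)).1).2.2.2.2.2 _ e
  simpa only [Equiv.coe_fn_mk, h1, h3] using this

/-- The middle piece traversed in the opposite direction. -/
def bar (M : Fin 10) : Fin 10 := if M = 2 then 6 else if M = 6 then 2 else M

/-- The isomorphisms between the middle pieces and their reversals. -/
def barTab : List (List ℕ) :=
  [[7, 8, 9, 3, 6, 5, 4, 0, 1, 2],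
   [7, 8, 9, 10, 11, 12, 13, 0, 1, 2, 3, 4, 5, 6],
   [7, 8, 9, 10, 11, 13, 12, 0, 1, 2, 3, 4, 5, 6],
   [7, 8, 9, 11, 10, 13, 12, 0, 1, 2, 4, 3, 6, 5],
   [7, 8, 9, 11, 10, 12, 13, 0, 1, 2, 4, 3, 5, 6],
   [7, 8, 9, 10, 11, 13, 12, 0, 1, 2, 3, 4, 6, 5],
   [7, 8, 9, 10, 11, 12, 13, 0, 1, 2, 3, 4, 6, 5],
   [7, 8, 9, 10, 11, 12, 13, 0, 1, 2, 3, 4, 5, 6],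
   [11, 12, 13, 14, 15, 17, 16, 9, 10, 7, 8, 0, 1, 2, 3, 4, 6, 5],
   [13, 14, 15, 16, 17, 19, 18, 11, 12, 9, 10, 7, 8, 0, 1, 2, 3, 4, 6, 5]]

lemma bar_bar (M : Fin 10) : bar (bar M) = M := by revert M; decide

lemma mL_bar (M : Fin 10) : mL (bar M) = mL M := by revert M; decide +kernel

lemma barTab_ok : ∀ M : Fin 10, isoB (mG M) (mG (bar M)) (ent [] barTab M) (ent [] barTab (bar M))
    = true ∧ ent 0 (ent [] barTab M) 0 = (mE (bar M)).val ∧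
      ent 0 (ent [] barTab M) (mE M).val = 0 := by
  decide +kernel

lemma good_mid (M : Fin 10) : goodB (mG M) = true := by
  have h := midTab_ok _ (mG_mem M)
  simp only [midB, Bool.and_eq_true] at h
  exact h.1

lemma exists_bar (M : Fin 10) :
    ∃ β : gr (mG M) ≃g gr (mG (bar M)), β 0 = mE (bar M) ∧ β (mE M) = 0 := by
  obtain ⟨h1, h2, h3⟩ := barTab_ok M
  obtain ⟨φ, hφ⟩ := exists_iso_of_isoB (good_mid _) (good_mid _) h1
  exact ⟨φ, Fin.ext ((hφ _).trans h2), Fin.ext ((hφ _).trans h3)⟩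

/-- The inclusion of `X`. -/
def emb {X : RG} : (L : List (Fin 10)) → X.V → (ext L X).V
  | [], v => v
  | _ :: L, v => .inr (emb L v)

lemma ext_append (L L' : List (Fin 10)) (X : RG) : ext (L ++ L') X = ext L (ext L' X) := by
  induction L with
  | nil => rfl
  | cons M L ih =>
    exact congrArg (fun Y : RG => (⟨Fin (ord (mG M)) ⊕ Y.V, glue (gr (mG M)) (mE M) Y.G Y.r,
      .inl 0⟩ : RG)) ih

/-- The list of the reversed pieces in reversed order. -/
def rv (L : List (Fin 10)) : List (Fin 10) := (L.map bar).reverse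

lemma rv_rv (L : List (Fin 10)) : rv (rv L) = L := by
  simp [rv, List.map_reverse, Function.comp_def, bar_bar]

lemma mlen_rv (L : List (Fin 10)) : mlen (rv L) = mlen L := by
  simp [mlen, rv, List.map_reverse, Function.comp_def, mL_bar, List.sum_reverse]

/-- Middle pieces can be moved from one side to the other. -/
lemma exists_slide {X : RG} (L : List (Fin 10)) (Y : RG) :
    ∃ φ : (ext L X).join Y ≃g X.join (ext (rv L) Y), ∀ v, φ (.inl (emb L v)) = .inl v := by
  induction L generalizing Y with
  | nil => exact ⟨Iso.refl, fun _ => rfl⟩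
  | cons M L ih =>
    obtain ⟨β, h1, h2⟩ := exists_bar M
    obtain ⟨φ, hφ⟩ := ih (ext [bar M] Y)
    have e : rv (M :: L) = rv L ++ [bar M] := by simp [rv]
    rw [e, ext_append]
    exact ⟨(glueSlide β h1 h2).trans φ, hφ⟩

/-- The graph made of the end pieces `E` and `E'` and the middle pieces `L`. -/
def word (E : Fin 72) (L : List (Fin 10)) (E' : Fin 72) :
    SimpleGraph ((endRG E).V ⊕ (tail L E').V) := (endRG E).join (tail L E')

lemma exists_reverse (E : Fin 72) (L : List (Fin 10)) (E' : Fin 72) :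
    ∃ φ : word E L E' ≃g word E' (rv L) E,
      ∀ v : (endRG E').V, φ (.inr (emb (X := endRG E') L v)) = .inl v := by
  obtain ⟨φ, hφ⟩ := exists_slide (X := endRG E') L (endRG E)
  exact ⟨glueComm.trans φ, hφ⟩

/-! ### Classification of the extremal graphs -/

/-- `G` is a chain with `l` layers between two end pieces. -/
def IsWord {V : Type} (G : SimpleGraph V) (l : ℕ) : Prop :=
  ∃ E L E', eL E + mlen L + eL E' = l ∧ Nonempty (word E L E' ≃g G)

section Whole

variable {V : Type} {G : SimpleGraph V} {r y z : V} {lay : V → ℕ} {d k : ℕ}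

lemma IsWord.of_chains (hy : lay y ≤ k) (hz : ¬ lay z ≤ k)
    (h : ∀ a b, lay a ≤ k → ¬ lay b ≤ k → (G.Adj a b ↔ a = y ∧ b = z)) {l l' : ℕ}
    (h1 : IsChain (G.induce {a | lay a ≤ k}) ⟨y, hy⟩ l)
    (h2 : IsChain (G.induce {a | ¬ lay a ≤ k}) ⟨z, hz⟩ l') : IsWord G (l + l') := by
  obtain ⟨L, E, rfl, φ, hφ⟩ := h1
  obtain ⟨L', E', rfl, ψ, hψ⟩ := h2
  obtain ⟨χ, -⟩ := exists_slide (X := endRG E) L (tail L' E')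
  refine ⟨E, rv L ++ L', E', ?_, ?_⟩
  · have h1 := mlen_rv L
    have h2 : mlen (rv L ++ L') = mlen (rv L) + mlen L' := by simp [mlen]
    omega
  · rw [word, tail, ext_append]
    exact ⟨χ.symm.trans ((glueCongr φ ψ hφ hψ).trans (glueSplit (fun a => lay a ≤ k) hy hz h))⟩

/-- The part of a layered cubic graph before a cut. -/
lemma Layered.isTail_lower [Finite V] (h : Layered G r lay) (hG : Sparse G)
    (hd : ∀ x, (G.neighborSet x).ncard = 3) (hyz : lay y = k ∧ lay z = k + 1)
    (ha : ∀ a b, lay a ≤ k → ¬ lay b ≤ k → (G.Adj a b ↔ a = y ∧ b = z)) (hk : k < d)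
    (hle : ∀ a b, G.dist a b ≤ d) (ht : ∃ x, lay x = d) :
    IsTail (G.induce {a | lay a ≤ k}) ⟨y, hyz.1.le⟩
      ((G.induce {a | lay a ≤ k}).dist ⟨y, hyz.1.le⟩) k := by
  have hS : (G.induce {a | lay a ≤ k}).Connected := (h.lower (k := k)).connected
  have hz : ¬ lay z ≤ k := by omega
  have hT := h.upper hyz.2 ha
  have hmax : ∀ a, (G.induce {a | lay a ≤ k}).dist ⟨y, hyz.1.le⟩ a ≤ k := fun a => by
    obtain ⟨b, hb⟩ := ht
    have h1 := hle (glueSplit (fun a => lay a ≤ k) hyz.1.le hz ha (.inl a))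
      (glueSplit (fun a => lay a ≤ k) hyz.1.le hz ha (.inr ⟨b, by simp; omega⟩))
    rw [Iso.dist_eq (glue_connected hS hT.connected), glue_dist_inl_inr hS hT.connected,
      hT.dist_eq, SimpleGraph.dist_comm] at h1
    simp only [hb] at h1
    omega
  refine ⟨layered_dist hS _, hG.induce _, ?_, fun x hx => ?_, hmax, ⟨⟨r, by simp [h.root]⟩, ?_⟩⟩
  · have := ncard_lower hyz.1.le hz ha ⟨y, hyz.1.le⟩
    rw [if_pos rfl, hd] at this
    exact (Nat.succ.inj this).symm
  · have := ncard_lower hyz.1.le hz ha x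
    rw [if_neg fun e => hx (Subtype.ext e), hd] at this
    exact this.symm
  · refine le_antisymm (hmax _) ?_
    have := (h.lower (k := k)).dist_eq ⟨y, hyz.1.le⟩
    rw [SimpleGraph.dist_comm, this, hyz.1]

end Whole

section Whole

variable {V : Type} {G : SimpleGraph V} {d : ℕ}

lemma clsG22_cases : ∀ A ∈ clsG22, goodB A = true ∧ (A ∈ soloTab ∨ diamB 5 A = true ∨
    ∃ i < 22, ∃ j < 22, A.length = 22 ∧ tb (ballM (masks A) 6 (Nat.pow 2 i)) j = false) := by
  decide +kernel

lemma soloTab_of_iso {A : List (List ℕ)} (hA : A ∈ clsG22) (φ : gr A ≃g G) (hc : G.Connected)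
    (hle : ∀ a b, G.dist a b ≤ 6) (ht : ∃ a b, G.dist a b = 6) : A ∈ soloTab := by
  obtain ⟨hg, h | h | ⟨i, hi, j, hj, hl, h⟩⟩ := clsG22_cases A hA
  · exact h
  · obtain ⟨a, b, hab⟩ := ht
    have := dist_le_of_diamB hg h (φ.symm a) (φ.symm b)
    rw [Iso.dist_eq hc, hab] at this
    omega
  · have hA' := φ.connected_iff.2 hc
    rw [← hl, ← ord_eq hg] at hi hj
    have := (dist_le_iff_tb hg hA' 6 ⟨i, hi⟩ ⟨j, hj⟩).1
    rw [h] at this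
    have h1 := hle (φ ⟨i, hi⟩) (φ ⟨j, hj⟩)
    rw [Iso.dist_eq hA'] at h1
    exact absurd (this h1) (by simp)

lemma even_card_of_cubic [Finite V] (hd : ∀ x, (G.neighborSet x).ncard = 3) :
    Even (Nat.card V) := by
  have := (even_three_mul_card_sub (G := G) ∅ fun x => by simp [hd]).1
  simpa [Nat.even_mul, show ¬ Even 3 by decide] using this

lemma count_whole {d k s t c : ℕ} {P Q R : Prop} (hk : k < d) (hs : Odd s) (ht : Odd t)
    (s1 : 2 * k + 5 ≤ s) (s2 : s = 2 * k + 5 → (k + 1) % 5 = 4 ∨ (k + 1) % 5 = 0)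
    (s3 : s = 2 * k + 5 ∨ s = 2 * k + 7 ∧ ((k + 1) % 5 = 1 ∨ (k + 1) % 5 = 2 ∨ (k + 1) % 5 = 3) → P)
    (t1 : 2 * (d - (k + 1)) + 5 ≤ t)
    (t2 : t = 2 * (d - (k + 1)) + 5 → (d - (k + 1) + 1) % 5 = 4 ∨ (d - (k + 1) + 1) % 5 = 0)
    (t3 : t = 2 * (d - (k + 1)) + 5 ∨ t = 2 * (d - (k + 1)) + 7 ∧ ((d - (k + 1) + 1) % 5 = 1 ∨
      (d - (k + 1) + 1) % 5 = 2 ∨ (d - (k + 1) + 1) % 5 = 3) → Q) (hc : s + t = c)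
    (hR : P → Q → R) : 2 * d + 8 ≤ c ∧
      (c = 2 * d + 8 → (d % 5 = 2 ∨ d % 5 = 3 ∨ d % 5 = 4) ∧ R) ∧
      (d % 5 = 0 ∨ d % 5 = 1 → c = 2 * d + 10 → R) := by
  obtain ⟨a, rfl⟩ := hs
  obtain ⟨b, rfl⟩ := ht
  have key : ∀ e f : Prop, (e → P) → (f → Q) → e ∧ f → R := fun e f he hf h => hR (he h.1) (hf h.2)
  have key := key _ _ s3 t3
  clear s3 t3 hR
  refine ⟨by omega, fun h => ⟨by omega, key ⟨by omega, by omega⟩⟩, fun h1 h2 => key ⟨?_, ?_⟩⟩ <;>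
    clear key <;> omega

/-- Cubic graphs of girth five and diameter `d` of small order. -/
theorem classify_cubic [Finite V] (hd6 : 6 ≤ d) (hG : Sparse G)
    (hd : ∀ x, (G.neighborSet x).ncard = 3) (hc : G.Connected) (hle : ∀ a b, G.dist a b ≤ d)
    (ht : ∃ a b, G.dist a b = d) : 2 * d + 8 ≤ Nat.card V ∧
      (Nat.card V = 2 * d + 8 → (d % 5 = 2 ∨ d % 5 = 3 ∨ d % 5 = 4) ∧ IsWord G (d + 1)) ∧
      (d % 5 = 0 ∨ d % 5 = 1 → Nat.card V = 2 * d + 10 →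
        IsWord G (d + 1) ∨ d = 6 ∧ ∃ A ∈ soloTab, Nonempty (gr A ≃g G)) := by
  obtain ⟨u, w, huw⟩ := ht
  have hl := layered_dist hc u
  by_cases hcut : ∃ k, k < d ∧ Cut G (G.dist u) k
  · obtain ⟨k, hk, y, z, hyz, hy, hz, hu⟩ := hcut
    have ha := hl.adj_iff_of_cut hyz hy hz hu
    have hS := hl.isTail_lower hG hd ⟨hy, hz⟩ ha hk hle ⟨w, huw⟩
    have hT := hl.isTail_upper hG (fun x _ => hd x) ⟨hy, hz⟩ ha hk (hle u) ⟨w, huw⟩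
    obtain ⟨s1, s2, s3⟩ := hS.classify
    obtain ⟨t1, t2, t3⟩ := hT.classify
    have hjoin := IsWord.of_chains (l := k + 1) (l' := d - (k + 1) + 1) hy.le (by omega) ha
    rw [show k + 1 + (d - (k + 1) + 1) = d + 1 by omega] at hjoin
    obtain ⟨h1, h2, h3⟩ := count_whole hk hS.odd_card hT.odd_card s1 s2 s3 t1 t2 t3
      card_lower_add_upper hjoin
    exact ⟨h1, h2, fun h h' => .inl (h3 h h')⟩
  · obtain ⟨L₁, c₁, n₁, o₁, b₁⟩ := exists_treeU hG (hd u) fun x _ => hd x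
    obtain ⟨L₂, c₂, n₂, o₂, b₂⟩ := exists_treeU hG (hd w) fun x _ => hd x
    have hcut' : ∀ k, k < d → ¬ Cut G (G.dist u) k := fun k hk h => hcut ⟨k, hk, h⟩
    obtain ⟨L, c, n, hm, hcol⟩ := exists_spine (m := d - 5) hl hG c₁ n₁ n₂
      (fun x hx => by have := (b₁ _ hl.lip x hx).1; rw [hl.root] at this; omega)
      (fun x hx => by have := (b₂ _ hl.lip x hx).2; omega)
      (fun i hi => by
        have := hl.exists_two (fun x => (hd x).le) (hcut' (2 + i) (by omega))
          (hcut' (2 + i + 1) (by omega)) (x := w) (by omega)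
        rwa [show 2 + i + 1 = 3 + i by omega] at this)
      (fun x _ _ _ => hd x)
    have hcard := length_le_card n
    simp only [List.length_append, c₁, c, c₂] at hcard hm
    refine ⟨by omega, fun h => by omega, fun h h' => .inr ?_⟩
    have := hm (by omega)
    obtain rfl : d = 6 := by omega
    refine ⟨rfl, ?_⟩
    have e1 : ∀ i < 22, dig probG22.deg i = 3 := by decide +kernel
    have e2 : ∀ i < 22, dig probG22.col i = if i < 10 then 0 else if i < 12 then (i - 10) / 2 + 1
        else 2 := by decide +kernel
    have o : On G (L₁ ++ L ++ L₂) (treeU 0 ++ treeU 12) := by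
      refine On.append ((o₁.append_left L).append_left L₂) ?_
      have := o₂.append_right (L₁ ++ L)
      rwa [treeU_map, List.length_append, c₁, c] at this
    have hlen : (L₁ ++ L ++ L₂).length = 22 := by simp [c₁, c, c₂]
    obtain ⟨A, hA, φ, -⟩ := classify (p := probG22) runG22 (by decide +kernel) (by decide)
      (by decide +kernel) hG n hlen (mem_of_card_le n (by rw [hlen, h']))
      (fun i hi => by rw [hd, e1 i (hlen ▸ hi)]) _ (layer_lip hl 1)
      (fun i hi => by rw [e2 i (hlen ▸ hi)]; exact hcol i hi) o
    exact ⟨A, soloTab_of_iso hA φ hc hle ⟨u, w, huw⟩, ⟨φ⟩⟩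

end Whole

/-! ### An isomorphism invariant -/

section Hash

open Classical in
/-- Colours of the vertices after `t` rounds of refinement of the colouring `c`. -/
noncomputable def refine {V : Type} [Fintype V] (G : SimpleGraph V) (c : V → ℕ) : ℕ → V → ℕ
  | 0 => c
  | t + 1 => fun w => 31 * refine G c t w +
      (∑ u, if G.Adj w u then refine G c t u ^ 2 + 1 else 0) ^ 2 + 7

open Classical in
lemma refine_succ {V : Type} [Fintype V] (G : SimpleGraph V) (c : V → ℕ) (t : ℕ) (w : V) :
    refine G c (t + 1) w = 31 * refine G c t w +
      (∑ u, if G.Adj w u then refine G c t u ^ 2 + 1 else 0) ^ 2 + 7 := rfl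

open Classical in
lemma refine_iso {V W : Type} [Fintype V] [Fintype W] {G : SimpleGraph V} {H : SimpleGraph W}
    (φ : G ≃g H) {c : V → ℕ} {c' : W → ℕ} (hc : ∀ v, c' (φ v) = c v) (t : ℕ) (v : V) :
    refine H c' t (φ v) = refine G c t v := by
  induction t generalizing v with
  | zero => exact hc v
  | succ t ih =>
    simp only [refine, ih]
    congr 3
    exact (Fintype.sum_equiv φ.toEquiv _ _ fun u => by
      change _ = if H.Adj (φ v) (φ u) then refine H c' t (φ u) ^ 2 + 1 else 0
      rw [ih, φ.map_adj_iff]).symm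

open Classical in
/-- An invariant of graphs with a weight on the vertices. -/
noncomputable def hash {V : Type} [Fintype V] (G : SimpleGraph V) (s : V → ℕ) : ℕ :=
  ∑ v, ((∑ w, (refine G (fun w => (if w = v then 1 else 0) + s w) 3 w ^ 2 + 1)) ^ 2 + 1)

open Classical in
lemma hash_iso {V W : Type} [Fintype V] [Fintype W] {G : SimpleGraph V} {H : SimpleGraph W}
    (φ : G ≃g H) {s : V → ℕ} {s' : W → ℕ} (hs : ∀ v, s' (φ v) = s v) : hash H s' = hash G s := by
  refine (Fintype.sum_equiv φ.toEquiv _ _ fun v => ?_).symm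
  congr 2
  refine Fintype.sum_equiv φ.toEquiv _ _ fun w => ?_
  congr 2
  exact (refine_iso φ (fun u => by
    rw [hs]; congr 1; exact if_congr (EmbeddingLike.apply_eq_iff_eq φ) rfl rfl) 3 w).symm

/-- `k l`, arranged so that the kernel evaluates the entries of `l` first. -/
def force {α : Type} (l : List ℕ) (k : List ℕ → α) : α := forceList (fun n k => forceNat k n) l k

lemma force_eq {α : Type} (l : List ℕ) (k : List ℕ → α) : force l k = k l :=
  forceList_eq (fun _ _ => forceNat_eq _ _) _ _

/-- Sum of the values `f x`, `x ∈ l`. -/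
def sumL {β : Type} (f : β → ℕ) (l : List β) : ℕ := lrec 0 (fun x _ ih => Nat.add (f x) ih) l

/-- Corresponding entries combined. -/
def zipL {β γ δ : Type} (f : β → γ → δ) (l : List β) : List γ → List δ :=
  lrec (fun _ => []) (fun x _ ih m => lrec [] (fun y m _ => f x y :: ih m) m) l

/-- Entries transformed. -/
def mapL {β γ : Type} (f : β → γ) (l : List β) : List γ := lrec [] (fun x _ ih => f x :: ih) l

/-- One round of refinement on tables. -/
def roundL {α : Type} (A : List (List ℕ)) (c : List ℕ) (k : List ℕ → α) : α :=
  force (mapL (fun x => Nat.succ (Nat.pow x 2)) c) fun q =>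
    force (zipL (fun r x => Nat.add (Nat.add (Nat.mul 31 x) (Nat.pow (sumL (ent 0 q) r) 2)) 7) A c) k

/-- The invariant of a table with weights. -/
def hashL (s : ℕ → ℕ) (A : List (List ℕ)) : ℕ :=
  sumL (fun v => Nat.succ (Nat.pow
    (force (mapL (fun w => Nat.add (br (Nat.beq w v) 1 0) (s w)) (List.range (len A))) fun c =>
      roundL A c fun c => roundL A c fun c => roundL A c fun c =>
        sumL (fun x => Nat.succ (Nat.pow x 2)) c) 2)) (List.range (len A))

/-- Whether there are no repetitions. -/
def nodupB (l : List ℕ) : Bool := lrec true (fun x t ih => br (memb x t) false ih) l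

lemma sumL_eq {β : Type} (f : β → ℕ) (l : List β) : sumL f l = (l.map f).sum := by
  induction l with
  | nil => rfl
  | cons x l ih => rw [List.map_cons, List.sum_cons, ← ih]; rfl

lemma zipL_eq {β γ δ : Type} (f : β → γ → δ) (l : List β) (m : List γ) :
    zipL f l m = List.zipWith f l m := by
  induction l generalizing m with
  | nil => rfl
  | cons x l ih => cases m with
    | nil => rfl
    | cons y m => rw [List.zipWith_cons_cons, ← ih]; rfl

lemma mapL_eq {β γ : Type} (f : β → γ) (l : List β) : mapL f l = l.map f := by
  induction l with
  | nil => rfl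
  | cons x l ih => rw [List.map_cons, ← ih]; rfl

lemma nodupB_iff {l : List ℕ} : nodupB l = true ↔ l.Nodup := by
  induction l with
  | nil => simp [nodupB, lrec]
  | cons x l ih =>
    rw [List.nodup_cons, ← ih, ← memb_iff]
    change br (memb x l) false (nodupB l) = true ↔ _
    rw [br_eq]
    cases memb x l <;> simp

lemma sum_ite_mem {n : ℕ} {l : List ℕ} (hl : l.Nodup) (h : ∀ x ∈ l, x < n) (F : ℕ → ℕ) :
    (∑ u : Fin n, if u.val ∈ l then F u else 0) = (l.map F).sum := by
  rw [Fin.sum_univ_eq_sum_range (fun u => if u ∈ l then F u else 0) n, ← Finset.sum_filter,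
    ← List.sum_toFinset _ hl]
  refine Finset.sum_congr (Finset.ext fun x => ?_) fun _ _ => rfl
  simpa using h x

variable {A : List (List ℕ)}

lemma refine_eq (hA : goodB A = true) (hn : ∀ r ∈ A, r.Nodup) {f : Fin (ord A) → ℕ} {c : List ℕ}
    {t : ℕ} (hl : c.length = A.length) (hc : ∀ i : Fin (ord A), refine (gr A) f t i = ent 0 c i) :
    ∃ c' : List ℕ, c'.length = A.length ∧ (∀ i : Fin (ord A), refine (gr A) f (t + 1) i = ent 0 c' i) ∧
      ∀ {α : Type} (k : List ℕ → α), roundL A c k = k c' := by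
  have ho := ord_eq hA
  refine ⟨_, ?_, fun i => ?_, fun k => by rw [roundL, force_eq, force_eq]⟩
  · rw [zipL_eq, List.length_zipWith, hl, min_self]
  · have hi : i.val < A.length := ho ▸ i.2
    have hr : row A i = A[i.val] := by
      rw [row, ent_eq, List.getD_eq_getElem _ _ hi]
    have hlt : ∀ x ∈ row A i, x < ord A := fun x hx => by
      rw [ho]; exact ((goodB_iff.1 hA).2 i hi x hx).1
    rw [zipL_eq, ent_eq, List.getD_eq_getElem _ _ (by rw [List.length_zipWith]; omega),
      List.getElem_zipWith, refine_succ, hc, sumL_eq, ent_eq, List.getD_eq_getElem _ _ (by omega), ← hr,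
      ← sum_ite_mem (n := ord A) (hr ▸ hn _ (List.getElem_mem hi)) hlt]
    change _ + _ ^ 2 + 7 = _ + _ ^ 2 + 7
    congr 3
    refine Finset.sum_congr rfl fun u _ => ?_
    have hu : u.val < A.length := ho ▸ u.2
    simp only [gr_adj hA, hc]
    congr 1
    rw [mapL_eq, ent_eq, ent_eq, List.getD_eq_getElem _ _ (by omega),
      List.getD_eq_getElem _ _ (by rw [List.length_map]; omega), List.getElem_map]
    rfl

lemma hash_eq (hA : goodB A = true) (hn : ∀ r ∈ A, r.Nodup) (s : ℕ → ℕ) :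
    hash (gr A) (fun i => s i) = hashL s A := by
  have ho := ord_eq hA
  have hs : ∀ (F : ℕ → ℕ), ∑ v : Fin (ord A), F v = ((List.range (len A)).map F).sum := fun F => by
    rw [Fin.sum_univ_eq_sum_range F, ho, len_eq]
    rfl
  rw [hashL, sumL_eq, ← hs]
  refine Finset.sum_congr rfl fun v _ => ?_
  change _ ^ 2 + 1 = _ ^ 2 + 1
  congr 2
  rw [force_eq]
  obtain ⟨c₁, l₁, h₁, e₁⟩ := refine_eq hA hn (t := 0)
    (f := fun w => @ite ℕ (w = v) (Classical.propDecidable _) 1 0 + s w)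
    (c := mapL (fun w => Nat.add (br (Nat.beq w v) 1 0) (s w)) (List.range (len A)))
    (by rw [mapL_eq, List.length_map, List.length_range, len_eq]) (fun i => by
      rw [mapL_eq, ent_eq, List.getD_eq_getElem _ _ (by rw [List.length_map, List.length_range, len_eq, ← ho]; exact i.2), List.getElem_map,
        List.getElem_range, refine, br_eq, Nat.add_eq]
      congr 1
      by_cases h : i = v
      · simp [h]
      · have : Nat.beq i v = false := beq_eq_false.2 fun e => h (Fin.ext e)
        simp [h, this])
  obtain ⟨c₂, l₂, h₂, e₂⟩ := refine_eq hA hn l₁ h₁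
  obtain ⟨c₃, l₃, h₃, e₃⟩ := refine_eq hA hn l₂ h₂
  rw [e₁, e₂, e₃, sumL_eq]
  have : c₃ = (List.range (len A)).map (ent 0 c₃) := by
    refine List.ext_getElem (by simp [l₃, len_eq]) fun i h _ => ?_
    rw [List.getElem_map, List.getElem_range, ent_eq, List.getD_eq_getElem _ _ h]
  rw [this, List.map_map, ← hs]
  clear this
  exact Finset.sum_congr rfl fun w _ => congrArg (fun x => x ^ 2 + 1) (h₃ w)

/-- The weight of the root. -/
def rootW (i : ℕ) : ℕ := br (Nat.beq i 0) 2 0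

lemma hashL_eq_of_iso {B : List (List ℕ)} (hA : goodB A = true) (hA' : ∀ r ∈ A, r.Nodup)
    (hB : goodB B = true) (hB' : ∀ r ∈ B, r.Nodup) (φ : gr A ≃g gr B) (h : φ 0 = 0) :
    hashL rootW A = hashL rootW B := by
  rw [← hash_eq hA hA', ← hash_eq hB hB', ← hash_iso φ]
  intro v
  have h1 : (φ v).val = 0 ↔ v.val = 0 := by
    rw [Fin.val_eq_zero_iff, Fin.val_eq_zero_iff, ← h, EmbeddingLike.apply_eq_iff_eq]
  simp only [rootW, br_eq]
  congr 1
  by_cases h2 : v.val = 0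
  · rw [h2, h1.2 h2]
  · rw [beq_eq_false.2 h2, beq_eq_false.2 (h1.not.2 h2)]

lemma hashL_eq_of_iso' {B : List (List ℕ)} (hA : goodB A = true) (hA' : ∀ r ∈ A, r.Nodup)
    (hB : goodB B = true) (hB' : ∀ r ∈ B, r.Nodup) (φ : gr A ≃g gr B) :
    hashL (fun _ => 0) A = hashL (fun _ => 0) B := by
  rw [← hash_eq hA hA', ← hash_eq hB hB', ← hash_iso φ]
  exact fun _ => rfl

end Hash

/-- The rows of the tables and the invariants have no repetitions. -/
def distinctB (s : ℕ → ℕ) (l : List (List (List ℕ))) : Bool :=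
  allB (allB nodupB) l && force (mapL (hashL s) l) nodupB

lemma distinctB_iff {s : ℕ → ℕ} {l : List (List (List ℕ))} : distinctB s l = true ↔
    (∀ A ∈ l, ∀ r ∈ A, r.Nodup) ∧ (l.map (hashL s)).Nodup := by
  simp only [distinctB, Bool.and_eq_true, allB_eq, List.all_eq_true, nodupB_iff, force_eq, mapL_eq]

lemma endTab_distinct : distinctB rootW (endTab.map Prod.snd) = true := by decide +kernel

lemma midTab_distinct : distinctB rootW (midTab.map fun M => M.2.2) = true := by decide +kernel

lemma soloTab_distinct : distinctB (fun _ => 0) soloTab = true := by decide +kernel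

/-! ### Properties of the pieces -/

/-- Numbers of vertices at distance at most three from the last layer of an end piece. -/
def endBall3 (l : ℕ) : ℕ := ent 0 [0, 0, 0, 0, 11, 12, 14, 12, 12] l

/-- Numbers of vertices at distance at most four from the last layer of an end piece. -/
def endBall4 (l : ℕ) : ℕ := ent 0 [0, 0, 0, 0, 11, 13, 16, 16, 14] l

/-- Numbers of vertices at distance at most five from the root of a middle piece. -/
def midBall5 (l : ℕ) : ℕ := ent 0 [0, 0, 0, 0, 0, 10, 14, 0, 15, 13] l

/-- Check of the sizes of the balls in an end piece. -/
def endBallB (E : ℕ × List (List ℕ)) : Bool :=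
  force (masks E.2) fun ms =>
    anyB (fun i => !tb (ballM ms (Nat.pred (Nat.pred E.1)) (Nat.pow 2 0)) i) (List.range (len E.2))
    && allB (fun i => br (tb (ballM ms (Nat.pred (Nat.pred E.1)) (Nat.pow 2 0)) i) true
      (Nat.beq (pop (len E.2) (ballM ms 3 (Nat.pow 2 i))) (endBall3 E.1) &&
        Nat.beq (pop (len E.2) (ballM ms 4 (Nat.pow 2 i))) (endBall4 E.1))) (List.range (len E.2))

/-- Check of the sizes of the balls in a middle piece. -/
def midBallB (M : ℕ × ℕ × List (List ℕ)) : Bool :=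
  Nat.beq (pop (len M.2.2) (ballM (masks M.2.2) 5 (Nat.pow 2 0))) (midBall5 M.1)

lemma endTab_ball : allB endBallB endTab = true := by decide +kernel

lemma midTab_ball : allB midBallB midTab = true := by decide +kernel

section Ends

variable (E : Fin 72)

lemma good_end : goodB (eG E) = true := by
  have h := endTab_ok _ (eG_mem E)
  simp only [endB, Bool.and_eq_true] at h
  exact h.1

lemma sparse_end : Sparse (gr (eG E)) := by
  have h := endTab_ok _ (eG_mem E)
  simp only [endB, Bool.and_eq_true] at h
  exact sparse_of_sparseB h.1 h.2.1

lemma five_end : ∃ a b c d e, (gr (eG E)).Adj a b ∧ (gr (eG E)).Adj b c ∧ (gr (eG E)).Adj c d ∧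
    (gr (eG E)).Adj d e ∧ (gr (eG E)).Adj e a ∧ a ≠ c ∧ a ≠ d ∧ b ≠ d ∧ b ≠ e ∧ c ≠ e := by
  have h := endTab_ok _ (eG_mem E)
  simp only [endB, Bool.and_eq_true] at h
  exact exists_five_of_fiveB h.1 h.2.2.1

lemma ncard_end (i : Fin (ord (eG E))) :
    ((gr (eG E)).neighborSet i).ncard + (if i = 0 then 1 else 0) = 3 := by
  have h := endTab_ok _ (eG_mem E)
  simp only [endB, Bool.and_eq_true] at h
  have := ncard_of_degB h.1 h.2.2.2.1 i
  rw [← this, br_eq]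
  congr 1
  by_cases hi : i = 0
  · simp [hi]
  · have hi' : i.val ≠ 0 := fun e => hi (Fin.ext e)
    rw [beq_eq_false.2 hi', if_neg hi]; rfl

lemma diam_end (i j : Fin (ord (eG E))) : (gr (eG E)).dist i j ≤ eL E - 1 := by
  have h := endTab_ok _ (eG_mem E)
  simp only [endB, Bool.and_eq_true] at h
  exact dist_le_of_diamB h.1 h.2.2.2.2.1 i j

lemma connected_end : (gr (eG E)).Connected := by
  have h := endTab_ok _ (eG_mem E)
  simp only [endB, Bool.and_eq_true] at h
  exact connected_of_diamB h.1 h.2.2.2.2.1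

lemma exists_far_end : ∃ i, (gr (eG E)).dist 0 i = eL E - 1 := by
  have h := endTab_ball
  rw [allB_eq, List.all_eq_true] at h
  have h := h _ (eG_mem E)
  simp only [endBallB, force_eq, Bool.and_eq_true, anyB_eq, List.any_eq_true, List.mem_range,
    len_eq, ← ord_eq (good_end E), Bool.not_eq_true'] at h
  obtain ⟨i, hi, hf⟩ := h.1
  refine ⟨⟨i, hi⟩, le_antisymm (diam_end E _ _) ?_⟩
  by_contra h'
  have h2 := (dist_le_iff_tb (good_end E) (connected_end E) (Nat.pred (Nat.pred (eL E))) 0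
    ⟨i, hi⟩).1 (by simp only [Nat.pred_eq_sub_one]; omega)
  rw [Fin.val_zero] at h2
  exact Bool.false_ne_true (hf.symm.trans h2)

lemma ball_end {i : Fin (ord (eG E))} (hi : (gr (eG E)).dist 0 i = eL E - 1) :
    {j | (gr (eG E)).dist i j ≤ 3}.ncard = endBall3 (eL E) ∧
      {j | (gr (eG E)).dist i j ≤ 4}.ncard = endBall4 (eL E) := by
  have h := endTab_ball
  rw [allB_eq, List.all_eq_true] at h
  have h := h _ (eG_mem E)
  simp only [endBallB, force_eq, Bool.and_eq_true, allB_eq, List.all_eq_true, List.mem_range,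
    br_eq, len_eq, ← ord_eq (good_end E)] at h
  have h := h.2 i i.2
  have hf : tb (ballM (masks (eG E)) (Nat.pred (Nat.pred (eL E))) (Nat.pow 2 0)) i = false := by
    rw [Bool.eq_false_iff]
    intro h'
    have := (dist_le_iff_tb (good_end E) (connected_end E) _ 0 i).2 h'
    have := (end_spec E).1
    simp only [Nat.pred_eq_sub_one] at *
    omega
  rw [hf, cond_false, Bool.and_eq_true, Nat.beq_eq, Nat.beq_eq] at h
  rw [ncard_dist_le (good_end E) (connected_end E), ncard_dist_le (good_end E) (connected_end E)]
  exact h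

lemma end_inj {E F : Fin 72} (φ : gr (eG E) ≃g gr (eG F)) (h : φ 0 = 0) : E = F := by
  obtain ⟨h1, h2⟩ := distinctB_iff.1 endTab_distinct
  have hE : E.val < endTab.length := by rw [endTab_length]; exact E.2
  have hF : F.val < endTab.length := by rw [endTab_length]; exact F.2
  have := hashL_eq_of_iso (good_end E) (h1 _ (List.mem_map_of_mem (eG_mem E))) (good_end F)
    (h1 _ (List.mem_map_of_mem (eG_mem F))) φ h
  rw [eG, eG, ent_eq, ent_eq, List.getD_eq_getElem _ _ hE, List.getD_eq_getElem _ _ hF] at this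
  exact Fin.ext ((h2.getElem_inj_iff (hi := by simpa using hE) (hj := by simpa using hF)).1
    (by simpa using this))

end Ends

section Mids

variable (M : Fin 10)

lemma sparse_mid : Sparse (gr (mG M)) := by
  have h := midTab_ok _ (mG_mem M)
  simp only [midB, Bool.and_eq_true] at h
  exact sparse_of_sparseB h.1 h.2.1

lemma val_mE : (mE M).val = (ent (0, 0, []) midTab M).2.1 := by
  have h := midTab_ok _ (mG_mem M)
  simp only [midB, Bool.and_eq_true, Nat.blt_eq, len_eq] at h
  exact Nat.mod_eq_of_lt (ord_eq h.1 ▸ h.2.2.1)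

lemma diam_mid (i j : Fin (ord (mG M))) : (gr (mG M)).dist i j ≤ mL M - 1 := by
  have h := midTab_ok _ (mG_mem M)
  simp only [midB, Bool.and_eq_true] at h
  exact dist_le_of_diamB h.1 h.2.2.2.2.1 i j

lemma connected_mid : (gr (mG M)).Connected := by
  have h := midTab_ok _ (mG_mem M)
  simp only [midB, Bool.and_eq_true] at h
  exact connected_of_diamB h.1 h.2.2.2.2.1

lemma dist_exit : (gr (mG M)).dist 0 (mE M) = mL M - 1 := by
  have h := midTab_ok _ (mG_mem M)
  simp only [midB, Bool.and_eq_true, Bool.not_eq_true', ← val_mE] at h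
  refine le_antisymm (diam_mid M _ _) ?_
  by_contra h'
  have h2 := (dist_le_iff_tb h.1 (connected_mid M) (Nat.pred (Nat.pred (mL M))) 0 (mE M)).1 (by
    simp only [Nat.pred_eq_sub_one]; omega)
  have h3 := h.2.2.2.2.2.1
  rw [Fin.val_zero] at h2
  exact Bool.false_ne_true (h3.symm.trans h2)

lemma mE_ne : mE M ≠ 0 := fun e => by
  have h := dist_exit M
  rw [e, SimpleGraph.dist_self] at h
  have := (mid_spec M).1
  omega

lemma ncard_mid (i : Fin (ord (mG M))) : ((gr (mG M)).neighborSet i).ncard +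
    ((if i = mE M then 1 else 0) + if i = 0 then 1 else 0) = 3 := by
  have h := midTab_ok _ (mG_mem M)
  simp only [midB, Bool.and_eq_true, ← val_mE] at h
  have := ncard_of_degB h.1 h.2.2.2.1 i
  rw [← this, br_eq, br_eq]
  congr 1
  have h0 := mE_ne M
  by_cases hi : i = 0
  · rw [if_pos hi, hi, if_neg h0.symm]; rfl
  · have hi' : i.val ≠ 0 := fun e => hi (Fin.ext e)
    rw [beq_eq_false.2 hi', if_neg hi, add_zero, cond_false]
    by_cases hj : i = mE M
    · simp [hj]
    · rw [beq_eq_false.2 fun e => hj (Fin.ext e), if_neg hj]; rfl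

lemma ball_mid : {j | (gr (mG M)).dist 0 j ≤ 5}.ncard = midBall5 (mL M) := by
  have h := midTab_ball
  rw [allB_eq, List.all_eq_true] at h
  have h := h _ (mG_mem M)
  simp only [midBallB, Nat.beq_eq, len_eq, ← ord_eq (good_mid M)] at h
  rw [ncard_dist_le (good_mid M) (connected_mid M)]
  exact h

lemma mid_inj {M N : Fin 10} (φ : gr (mG M) ≃g gr (mG N)) (h : φ 0 = 0) : M = N := by
  obtain ⟨h1, h2⟩ := distinctB_iff.1 midTab_distinct
  have hM : M.val < midTab.length := by rw [midTab_length]; exact M.2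
  have hN : N.val < midTab.length := by rw [midTab_length]; exact N.2
  have := hashL_eq_of_iso (good_mid M) (h1 _ (List.mem_map_of_mem (mG_mem M))) (good_mid N)
    (h1 _ (List.mem_map_of_mem (mG_mem N))) φ h
  rw [mG, mG, ent_eq, ent_eq, List.getD_eq_getElem _ _ hM, List.getD_eq_getElem _ _ hN] at this
  exact Fin.ext ((h2.getElem_inj_iff (hi := by simpa using hM) (hj := by simpa using hN)).1
    (by simpa using this))

end Mids

/-- Graph number `i` among the remaining ones. -/
def sG (i : Fin 6) : List (List ℕ) := ent [] soloTab i

lemma soloTab_length : soloTab.length = 6 := by decide +kernel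

lemma sG_eq (i : Fin 6) : sG i = soloTab[i.val]'(by rw [soloTab_length]; exact i.2) := by
  rw [sG, ent_eq, List.getD_eq_getElem]

lemma sG_mem (i : Fin 6) : sG i ∈ soloTab := sG_eq i ▸ List.getElem_mem _

lemma exists_solo {A : List (List ℕ)} (h : A ∈ soloTab) : ∃ i, sG i = A := by
  obtain ⟨i, hi, rfl⟩ := List.getElem_of_mem h
  exact ⟨⟨i, soloTab_length ▸ hi⟩, sG_eq _⟩

lemma good_solo (i : Fin 6) : goodB (sG i) = true := by
  have h := soloTab_ok _ (sG_mem i)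
  simp only [soloB, Bool.and_eq_true] at h
  exact h.1

lemma solo_inj {i j : Fin 6} (φ : gr (sG i) ≃g gr (sG j)) : i = j := by
  obtain ⟨h1, h2⟩ := distinctB_iff.1 soloTab_distinct
  have := hashL_eq_of_iso' (good_solo i) (h1 _ (sG_mem i)) (good_solo j) (h1 _ (sG_mem j)) φ
  rw [sG_eq, sG_eq] at this
  exact Fin.ext ((h2.getElem_inj_iff (hi := by simp [soloTab_length])
    (hj := by simp [soloTab_length])).1 (by simpa using this))

/-! ### Properties of the chains -/

section Tails

variable (L : List (Fin 10)) (E : Fin 72)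

/-- Twice the number of layers of a middle piece is exceeded by this by its order. -/
def exM (M : Fin 10) : ℕ := if mL M ≤ 5 then 0 else 2

/-- Twice the number of layers of an end piece is exceeded by this by its order. -/
def exE (E : Fin 72) : ℕ := if eL E ≤ 5 then 3 else 5

lemma tail_connected : (tail L E).G.Connected := by
  induction L with
  | nil => exact connected_end E
  | cons M L ih => exact glue_connected (connected_mid M) ih

lemma tail_sparse : Sparse (tail L E).G := by
  induction L with
  | nil => exact sparse_end E
  | cons M L ih => exact (sparse_mid M).glue ih

lemma ncard_endRG (v : (endRG E).V) :
    (v = (endRG E).r → ((endRG E).G.neighborSet v).ncard = 2) ∧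
      (v ≠ (endRG E).r → ((endRG E).G.neighborSet v).ncard = 3) := by
  have h (i : Fin (ord (eG E))) : (i = 0 → ((gr (eG E)).neighborSet i).ncard = 2) ∧
      (i ≠ 0 → ((gr (eG E)).neighborSet i).ncard = 3) := by
    have h := ncard_end E i
    split_ifs at h with e
    · exact ⟨fun _ => Nat.succ.inj h, fun h' => absurd e h'⟩
    · exact ⟨fun h' => absurd h' e, fun _ => h⟩
  exact h v

lemma ncard_tail (v : (tail L E).V) :
    (v = (tail L E).r → ((tail L E).G.neighborSet v).ncard = 2) ∧
      (v ≠ (tail L E).r → ((tail L E).G.neighborSet v).ncard = 3) := by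
  classical
  induction L with
  | nil => exact ncard_endRG E v
  | cons M L ih =>
    obtain v | v := v
    · have h1 : ((tail (M :: L) E).G.neighborSet (.inl v)).ncard = _ := ncard_glue_inl v
      have h2 := ncard_mid M v
      refine ⟨fun e => ?_, fun e => ?_⟩
      · have e : v = 0 := Sum.inl_injective e
        rw [if_pos e] at h2
        omega
      · have e : v ≠ 0 := fun h => e (congrArg _ h)
        rw [if_neg e] at h2
        omega
    · refine ⟨fun e => absurd e Sum.inr_ne_inl, fun _ => ?_⟩
      have h1 : ((tail (M :: L) E).G.neighborSet (.inr v)).ncard = _ := ncard_glue_inr v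
      rw [h1]
      split_ifs with e
      · exact congrArg (· + 1) ((ih v).1 e)
      · exact (ih v).2 e

lemma mlen_cons (M : Fin 10) : mlen (M :: L) = mL M + mlen L := by simp [mlen]

lemma card_tail : Nat.card (tail L E).V = 2 * (mlen L + eL E) + ((L.map exM).sum + exE E) := by
  induction L with
  | nil =>
    have h := (end_spec E).2.2
    simpa [tail, ext, endRG, mlen, exE] using h
  | cons M L ih =>
    have h := (mid_spec M).2
    have h2 : Nat.card (tail (M :: L) E).V = ord (mG M) + Nat.card (tail L E).V := by
      change Nat.card (Fin _ ⊕ (tail L E).V) = _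
      rw [Nat.card_sum, Nat.card_fin]
    rw [h2, ih, h, mlen_cons, List.map_cons, List.sum_cons, exM]
    ring

lemma tail_dist_le (u v : (tail L E).V) : (tail L E).G.dist u v ≤ mlen L + eL E - 1 := by
  have hE := (end_spec E).1
  induction L with
  | nil => exact (diam_end E u v).trans (by simp [mlen])
  | cons M L ih =>
    have hM := (mid_spec M).1
    have c1 := connected_mid M
    have c2 := tail_connected L E
    rw [mlen_cons]
    obtain u | u := u <;> obtain v | v := v
    · have h := glue_dist_inl (x := mE M) (y := (tail L E).r) c1 c2 u v
      have := diam_mid M u v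
      refine h.le.trans ?_
      omega
    · have h := glue_dist_inl_inr (x := mE M) (y := (tail L E).r) c1 c2 u v
      have := diam_mid M u (mE M)
      have := ih (tail L E).r v
      refine h.le.trans ?_
      omega
    · have h := glue_dist_inl_inr (x := mE M) (y := (tail L E).r) c1 c2 v u
      have := diam_mid M v (mE M)
      have := ih (tail L E).r u
      refine (SimpleGraph.dist_comm.trans h).le.trans ?_
      omega
    · have h := glue_dist_inr (x := mE M) (y := (tail L E).r) c1 c2 u v
      have := ih u v
      refine h.le.trans ?_
      omega

lemma tail_dist_inl (M : Fin 10) (i : Fin (ord (mG M))) :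
    (tail (M :: L) E).G.dist (tail (M :: L) E).r (.inl i) = (gr (mG M)).dist 0 i :=
  glue_dist_inl (connected_mid M) (tail_connected L E) 0 i

lemma tail_dist_inr (M : Fin 10) (v : (tail L E).V) :
    (tail (M :: L) E).G.dist (tail (M :: L) E).r (.inr v) =
      mL M + (tail L E).G.dist (tail L E).r v := by
  have h := glue_dist_inl_inr (x := mE M) (y := (tail L E).r) (connected_mid M)
    (tail_connected L E) 0 v
  have := (mid_spec M).1
  rw [dist_exit, Nat.sub_add_cancel (by omega)] at h
  exact h

lemma tail_dist_emb (v : (endRG E).V) : (tail L E).G.dist (tail L E).r (emb (X := endRG E) L v) =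
    mlen L + (gr (eG E)).dist 0 v := by
  induction L with
  | nil => simp [mlen]; rfl
  | cons M L ih =>
    rw [mlen_cons, add_assoc, ← ih]
    exact tail_dist_inr L E M _

lemma exists_emb {v : (tail L E).V}
    (h : (tail L E).G.dist (tail L E).r v = mlen L + eL E - 1) :
    ∃ a, v = emb (X := endRG E) L a ∧ (gr (eG E)).dist 0 a = eL E - 1 := by
  suffices ∃ a, v = emb (X := endRG E) L a by
    obtain ⟨a, rfl⟩ := this
    refine ⟨a, rfl, ?_⟩
    rw [tail_dist_emb] at h
    have := (end_spec E).1
    omega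
  have hE := (end_spec E).1
  induction L with
  | nil => exact ⟨v, rfl⟩
  | cons M L ih =>
    rw [mlen_cons] at h
    have hM := (mid_spec M).1
    obtain v | v := v
    · rw [tail_dist_inl] at h
      have := diam_mid M 0 v
      omega
    · have h' := tail_dist_inr L E M v
      obtain ⟨a, rfl⟩ := ih (v := v) (by omega)
      exact ⟨a, rfl⟩

end Tails

section Words

variable (E : Fin 72) (L : List (Fin 10)) (E' : Fin 72)

lemma word_connected : (word E L E').Connected :=
  glue_connected (connected_end E) (tail_connected L E')

lemma card_word : Nat.card ((endRG E).V ⊕ (tail L E').V) =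
    2 * (eL E + mlen L + eL E') + (exE E + (L.map exM).sum + exE E') := by
  have h := (end_spec E).2.2
  have h2 : Nat.card (endRG E).V = ord (eG E) := Nat.card_fin _
  rw [Nat.card_sum, card_tail, h2, h, ← exE]
  ring

lemma word_dist_inl (a b : (endRG E).V) :
    (word E L E').dist (.inl a) (.inl b) = (gr (eG E)).dist a b :=
  glue_dist_inl (connected_end E) (tail_connected L E') a b

lemma word_dist_inl_inr (a : (endRG E).V) (b : (tail L E').V) :
    (word E L E').dist (.inl a) (.inr b) =
      (gr (eG E)).dist 0 a + 1 + (tail L E').G.dist (tail L E').r b := by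
  refine (glue_dist_inl_inr (connected_end E) (tail_connected L E') a b).trans ?_
  congr 2
  exact SimpleGraph.dist_comm

lemma word_dist_inr (a b : (tail L E').V) :
    (word E L E').dist (.inr a) (.inr b) = (tail L E').G.dist a b :=
  glue_dist_inr (connected_end E) (tail_connected L E') a b

lemma word_dist_le (u v) : (word E L E').dist u v ≤ eL E + mlen L + eL E' - 1 := by
  have := (end_spec E).1
  have := (end_spec E').1
  obtain u | u := u <;> obtain v | v := v
  · rw [word_dist_inl]; have := diam_end E u v; omega
  · rw [word_dist_inl_inr]
    have := diam_end E 0 u; have := tail_dist_le L E' (tail L E').r v; omega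
  · rw [SimpleGraph.dist_comm, word_dist_inl_inr]
    have := diam_end E 0 v; have := tail_dist_le L E' (tail L E').r u; omega
  · rw [word_dist_inr]; have := tail_dist_le L E' u v; omega

/-- `u` and `v` are in the last layers of the first and of the second end piece. -/
def IsFar (u v : (endRG E).V ⊕ (tail L E').V) : Prop :=
  ∃ a b, (gr (eG E)).dist 0 a = eL E - 1 ∧ (gr (eG E')).dist 0 b = eL E' - 1 ∧
    u = .inl a ∧ v = .inr (emb (X := endRG E') L b)

variable {E L E'}

lemma IsFar.dist {u v} (h : IsFar E L E' u v) :
    (word E L E').dist u v = eL E + mlen L + eL E' - 1 := by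
  obtain ⟨a, b, ha, hb, rfl, rfl⟩ := h
  have := (end_spec E).1
  have := (end_spec E').1
  refine (word_dist_inl_inr E L E' a _).trans ?_
  have h := tail_dist_emb L E' b
  rw [ha]
  omega

lemma isFar_of_dist {u v} (h : (word E L E').dist u v = eL E + mlen L + eL E' - 1) :
    IsFar E L E' u v ∨ IsFar E L E' v u := by
  have := (end_spec E).1
  have := (end_spec E').1
  have key : ∀ a b, (word E L E').dist (.inl a) (.inr b) = eL E + mlen L + eL E' - 1 →
      IsFar E L E' (.inl a) (.inr b) := fun a b h => by
    rw [word_dist_inl_inr] at h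
    have h1 := diam_end E 0 a
    have h2 := tail_dist_le L E' (tail L E').r b
    obtain ⟨b, rfl, hb⟩ := exists_emb L E' (v := b) (by omega)
    exact ⟨a, b, by omega, hb, rfl, rfl⟩
  obtain u | u := u <;> obtain v | v := v
  · rw [word_dist_inl] at h; have := diam_end E u v; omega
  · exact .inl (key _ _ h)
  · exact .inr (key _ _ (SimpleGraph.dist_comm.trans h))
  · rw [word_dist_inr] at h; have := tail_dist_le L E' u v; omega

variable (E L E')

lemma exists_isFar : ∃ u v, IsFar E L E' u v := by
  obtain ⟨a, ha⟩ := exists_far_end E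
  obtain ⟨b, hb⟩ := exists_far_end E'
  exact ⟨_, _, a, b, ha, hb, rfl, rfl⟩

lemma ncard_word (v) : ((word E L E').neighborSet v).ncard = 3 := by
  classical
  obtain v | v := v
  · have h : ((word E L E').neighborSet (.inl v)).ncard = _ := ncard_glue_inl v
    rw [h]
    split_ifs with e
    · rw [(ncard_endRG E v).1 e]
    · exact (ncard_endRG E v).2 e
  · have h : ((word E L E').neighborSet (.inr v)).ncard = _ := ncard_glue_inr v
    rw [h]
    split_ifs with e
    · rw [(ncard_tail L E' v).1 e]
    · exact (ncard_tail L E' v).2 e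

lemma isKGDGraph_word {d : ℕ} (h : eL E + mlen L + eL E' = d + 1) :
    IsKGDGraph 3 5 d (word E L E') := by
  have : Nonempty ((endRG E).V ⊕ (tail L E').V) := ⟨.inl (endRG E).r⟩
  refine ⟨ncard_word E L E', ?_, ?_⟩
  · obtain ⟨a, b, c, d, e, h1, h2, h3, h4, h5, h6, h7, h8, h9, h10⟩ := five_end E
    exact egirth_eq_five ((sparse_end E).glue (tail_sparse L E')) (a := .inl a) (b := .inl b)
      (c := .inl c) (d := .inl d) (e := .inl e) h1 h2 h3 h4 h5 (Sum.inl_injective.ne h6)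
      (Sum.inl_injective.ne h7) (Sum.inl_injective.ne h8) (Sum.inl_injective.ne h9)
      (Sum.inl_injective.ne h10)
  · rw [ediam_eq_coe_iff]
    obtain ⟨u, v, huv⟩ := exists_isFar E L E'
    refine ⟨word_connected E L E', fun x y => ?_, u, v, ?_⟩
    · have := word_dist_le E L E' x y; omega
    · rw [huv.dist]; omega

end Words

/-! ### Isomorphisms between chains -/

lemma ncard_sum {α β : Type*} [Finite α] [Finite β] (S : Set (α ⊕ β)) :
    S.ncard = (Sum.inl ⁻¹' S).ncard + (Sum.inr ⁻¹' S).ncard := by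
  rw [← Set.ncard_image_of_injective (Sum.inl ⁻¹' S) Sum.inl_injective,
    ← Set.ncard_image_of_injective (Sum.inr ⁻¹' S) Sum.inr_injective, ← Set.ncard_union_eq]
  · rw [Set.image_preimage_inl_union_image_preimage_inr]
  · rw [Set.disjoint_left]
    rintro _ ⟨a, -, rfl⟩ ⟨b, -, h⟩
    exact Sum.inr_ne_inl h

lemma le_iff_of_eq {x y k : ℕ} (h : x = y) : x ≤ k ↔ y ≤ k := by rw [h]

lemma ncard_ball_iso {V W : Type*} {G : SimpleGraph V} {H : SimpleGraph W} (hG : G.Connected)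
    (f : G ≃g H) (x : V) (k : ℕ) : {y | H.dist (f x) y ≤ k}.ncard = {y | G.dist x y ≤ k}.ncard := by
  rw [← Set.ncard_image_of_injective _ f.injective]
  congr 1
  ext y
  obtain ⟨y, rfl⟩ := f.surjective y
  simp [Iso.dist_eq hG]

/-- The number of vertices within distance five of the root of a chain. -/
def tailBall (M : Fin 10) : ℕ := midBall5 (mL M) + if mL M ≤ 5 then 1 else 0

lemma mL_eq_of_tailBall : ∀ M N : Fin 10, tailBall M = tailBall N → mL M = mL N := by
  decide +kernel

lemma ncard_tailBall (M : Fin 10) (L : List (Fin 10)) (E : Fin 72) :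
    {v | (tail (M :: L) E).G.dist (tail (M :: L) E).r v ≤ 5}.ncard = tailBall M := by
  refine (ncard_sum (α := Fin (ord (mG M))) (β := (tail L E).V) _).trans ?_
  rw [tailBall, ← ball_mid]
  have hM := (mid_spec M).1
  congr 1
  · congr 1
    ext i
    exact le_iff_of_eq (tail_dist_inl L E M i)
  · have h : ∀ v : (tail L E).V, v ∈ Sum.inr ⁻¹'
        {v | (tail (M :: L) E).G.dist (tail (M :: L) E).r v ≤ 5} ↔
          mL M + (tail L E).G.dist (tail L E).r v ≤ 5 :=
      fun v => le_iff_of_eq (tail_dist_inr L E M v)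
    split_ifs with h5
    · rw [Set.ncard_eq_one]
      refine ⟨(tail L E).r, Set.ext fun v => (h v).trans ?_⟩
      rw [Set.mem_singleton_iff, eq_comm, ← (tail_connected L E).dist_eq_zero_iff]
      omega
    · rw [Set.ncard_eq_zero]
      exact Set.eq_empty_of_forall_notMem fun v hv => by have := (h v).1 hv; omega

lemma height_eq {L K : List (Fin 10)} {E F : Fin 72} (f : (tail L E).G ≃g (tail K F).G)
    (h : f (tail L E).r = (tail K F).r) : mlen L + eL E ≤ mlen K + eL F := by
  obtain ⟨a, ha⟩ := exists_far_end E
  have h1 := tail_dist_emb L E a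
  have h2 := Iso.dist_eq (tail_connected L E) f (tail L E).r (emb (X := endRG E) L a)
  rw [h] at h2
  have h3 := tail_dist_le K F (tail K F).r (f (emb (X := endRG E) L a))
  have := (end_spec E).1
  have := (end_spec F).1
  omega

lemma tail_inj {L K : List (Fin 10)} {E F : Fin 72} (f : (tail L E).G ≃g (tail K F).G)
    (h : f (tail L E).r = (tail K F).r) : L = K ∧ E = F := by
  have hh1 := height_eq f h
  have hh2 := height_eq f.symm (by rw [← h]; exact f.symm_apply_apply _)
  have hE := end_spec E
  have hF := end_spec F
  induction L generalizing K with
  | nil =>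
    cases K with
    | nil => exact ⟨rfl, end_inj (E := E) (F := F) f h⟩
    | cons N K =>
      rw [mlen_cons] at hh2
      have := (mid_spec N).1
      simp only [mlen, List.map_nil, List.sum_nil] at hh2
      omega
  | cons M L ih =>
    cases K with
    | nil =>
      rw [mlen_cons] at hh1
      have := (mid_spec M).1
      simp only [mlen, List.map_nil, List.sum_nil] at hh1
      omega
    | cons N K =>
      have hb := ncard_ball_iso (tail_connected (M :: L) E) f (tail (M :: L) E).r 5
      rw [h, ncard_tailBall, ncard_tailBall] at hb
      have hMN := (mL_eq_of_tailBall _ _ hb).symm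
      have hd := Iso.dist_eq (tail_connected (M :: L) E) f (tail (M :: L) E).r
      rw [h] at hd
      have hM := (mid_spec M).1
      have f1 : ∀ a, ∃ b, f (.inl a) = .inl b := fun a => by
        have h1 := (hd (.inl a)).trans (tail_dist_inl L E M a)
        have h2 := diam_mid M 0 a
        rcases e : f (.inl a) with b | b
        · exact ⟨b, rfl⟩
        · have h3 := tail_dist_inr K F N b
          have h4 := congrArg ((tail (N :: K) F).G.dist (tail (N :: K) F).r) e
          omega
      have f2 : ∀ a, ∃ b, f (.inr a) = .inr b := fun a => by
        have h1 := (hd (.inr a)).trans (tail_dist_inr L E M a)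
        rcases e : f (.inr a) with b | b
        · have h3 := tail_dist_inl K F N b
          have h2 := diam_mid N 0 b
          have h4 := congrArg ((tail (N :: K) F).G.dist (tail (N :: K) F).r) e
          omega
        · exact ⟨b, rfl⟩
      obtain ⟨φ, ψ, -, hψ, hφ⟩ := exists_iso_of_glue (G := gr (mG M)) (G' := gr (mG N))
        (H := (tail L E).G) (H' := (tail K F).G) (x := mE M) (x' := mE N) (y := (tail L E).r)
        (y' := (tail K F).r) f f1 f2
      have h0 : φ 0 = 0 := Sum.inl_injective ((hφ 0).symm.trans h)
      obtain rfl := mid_inj φ h0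
      rw [mlen_cons, mlen_cons] at hh1 hh2
      obtain ⟨rfl, rfl⟩ := ih ψ hψ (by omega) (by omega)
      exact ⟨rfl, rfl⟩

section Words

variable {E F E' F' : Fin 72} {L K : List (Fin 10)}

lemma ncard_wordBall3 (L : List (Fin 10)) (E' : Fin 72) {a : (endRG E).V}
    (ha : (gr (eG E)).dist 0 a = eL E - 1) :
    {v | (word E L E').dist (.inl a) v ≤ 3}.ncard = endBall3 (eL E) := by
  refine (ncard_sum _).trans ?_
  have hE := (end_spec E).1
  rw [← (ball_end E ha).1]
  have h : Sum.inr ⁻¹' {v | (word E L E').dist (.inl a) v ≤ 3} = ∅ :=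
    Set.eq_empty_of_forall_notMem fun v hv => by
      have := word_dist_inl_inr E L E' a v
      change (word E L E').dist (.inl a) (.inr v) ≤ 3 at hv
      omega
  rw [h, Set.ncard_empty, add_zero]
  congr 1
  ext i
  exact le_iff_of_eq (word_dist_inl E L E' a i)

lemma ncard_wordBall4 (L : List (Fin 10)) (E' : Fin 72) {a : (endRG E).V}
    (ha : (gr (eG E)).dist 0 a = eL E - 1) :
    {v | (word E L E').dist (.inl a) v ≤ 4}.ncard =
      endBall4 (eL E) + if eL E ≤ 4 then 1 else 0 := by
  refine (ncard_sum _).trans ?_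
  have hE := (end_spec E).1
  rw [← (ball_end E ha).2]
  congr 1
  · congr 1
    ext i
    exact le_iff_of_eq (word_dist_inl E L E' a i)
  · have h : ∀ v : (tail L E').V, v ∈ Sum.inr ⁻¹' {v | (word E L E').dist (.inl a) v ≤ 4} ↔
        (gr (eG E)).dist 0 a + 1 + (tail L E').G.dist (tail L E').r v ≤ 4 :=
      fun v => le_iff_of_eq (word_dist_inl_inr E L E' a v)
    split_ifs with h4
    · rw [Set.ncard_eq_one]
      refine ⟨(tail L E').r, Set.ext fun v => (h v).trans ?_⟩
      rw [Set.mem_singleton_iff, eq_comm, ← (tail_connected L E').dist_eq_zero_iff]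
      omega
    · rw [Set.ncard_eq_zero]
      exact Set.eq_empty_of_forall_notMem fun v hv => by have := (h v).1 hv; omega

lemma eL_eq_of_balls {m n : ℕ} (hm : 4 ≤ m) (hm' : m ≤ 8) (hn : 4 ≤ n) (hn' : n ≤ 8)
    (h3 : endBall3 m = endBall3 n)
    (h4 : (endBall4 m + if m ≤ 4 then 1 else 0) = endBall4 n + if n ≤ 4 then 1 else 0) :
    m = n := by
  interval_cases m <;> interval_cases n <;> revert h3 h4 <;> decide

lemma word_inj_of_inl (f : word E L E' ≃g word F K F') {a : (endRG E).V} {b : (endRG F).V}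
    (ha : (gr (eG E)).dist 0 a = eL E - 1) (hb : (gr (eG F)).dist 0 b = eL F - 1)
    (hf : f (.inl a) = .inl b) : E = F ∧ L = K ∧ E' = F' := by
  have h3 := ncard_ball_iso (word_connected E L E') f (.inl a) 3
  have h4 := ncard_ball_iso (word_connected E L E') f (.inl a) 4
  rw [hf, ncard_wordBall3 _ _ ha, ncard_wordBall3 _ _ hb] at h3
  rw [hf, ncard_wordBall4 _ _ ha, ncard_wordBall4 _ _ hb] at h4
  have hE := end_spec E
  have hF := end_spec F
  have hEF := eL_eq_of_balls hE.1 hE.2.1 hF.1 hF.2.1 h3.symm h4.symm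
  have hd := Iso.dist_eq (word_connected E L E') f (.inl a)
  rw [hf] at hd
  have f1 : ∀ i, ∃ j, f (.inl i) = .inl j := fun i => by
    have h1 := (hd (.inl i)).trans (word_dist_inl E L E' a i)
    have h2 := diam_end E a i
    rcases e : f (.inl i) with j | j
    · exact ⟨j, rfl⟩
    · have h3 := word_dist_inl_inr F K F' b j
      have h4 := congrArg ((word F K F').dist (.inl b)) e
      omega
  have f2 : ∀ i, ∃ j, f (.inr i) = .inr j := fun i => by
    have h1 := (hd (.inr i)).trans (word_dist_inl_inr E L E' a i)
    rcases e : f (.inr i) with j | j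
    · have h3 := word_dist_inl F K F' b j
      have h2 := diam_end F b j
      have h4 := congrArg ((word F K F').dist (.inl b)) e
      omega
    · exact ⟨j, rfl⟩
  obtain ⟨φ, ψ, hφ, hψ, -⟩ := exists_iso_of_glue (G := gr (eG E)) (G' := gr (eG F))
    (H := (tail L E').G) (H' := (tail K F').G) (x := 0) (x' := 0) (y := (tail L E').r)
    (y' := (tail K F').r) f f1 f2
  exact ⟨end_inj φ hφ, tail_inj ψ hψ⟩

theorem word_iso_iff (h : eL E + mlen L + eL E' = eL F + mlen K + eL F') :
    Nonempty (word E L E' ≃g word F K F') ↔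
      (E = F ∧ L = K ∧ E' = F') ∨ (E = F' ∧ L = rv K ∧ E' = F) := by
  constructor
  · rintro ⟨f⟩
    obtain ⟨u, v, huv⟩ := exists_isFar E L E'
    have h1 := Iso.dist_eq (word_connected E L E') f u v
    rw [huv.dist, h] at h1
    obtain ⟨a, -, ha, -, rfl, -⟩ := huv
    obtain ⟨b, -, hb, -, hb', -⟩ | ⟨-, b, -, hb, -, hb'⟩ := isFar_of_dist h1
    · exact .inl (word_inj_of_inl f ha hb hb')
    · obtain ⟨φ, hφ⟩ := exists_reverse F K F'
      exact .inr (word_inj_of_inl (f.trans φ) ha hb ((congrArg φ hb').trans (hφ b)))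
  · rintro (⟨rfl, rfl, rfl⟩ | ⟨rfl, rfl, rfl⟩)
    · exact ⟨Iso.refl⟩
    · obtain ⟨φ, -⟩ := exists_reverse E' K E
      exact ⟨φ.symm⟩

end Words

set_option linter.constructorNameAsVariable false

/-! ### Counting the chains -/

/-- The first end piece, the middle pieces and the second end piece of a chain. -/
abbrev Code : Type := Fin 72 × List (Fin 10) × Fin 72

/-- The chain traversed in the opposite direction. -/
def rev (w : Code) : Code := (w.2.2, rv w.2.1, w.1)

/-- The number of layers of a chain. -/
def wlen (w : Code) : ℕ := eL w.1 + mlen w.2.1 + eL w.2.2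

/-- Twice the number of layers of a chain is exceeded by this by its order. -/
def wex (w : Code) : ℕ := exE w.1 + (w.2.1.map exM).sum + exE w.2.2

lemma rev_rev (w : Code) : rev (rev w) = w := by simp [rev, rv_rv]

lemma exM_spec : ∀ M : Fin 10, (exM M = 0 ∧ M = 0 ∧ mL M = 5) ∨
    (exM M = 2 ∧ M ≠ 0 ∧ 6 ≤ mL M ∧ mL M ≤ 9) := by
  decide +kernel

lemma exE_spec : ∀ E : Fin 72, (exE E = 3 ∧ 4 ≤ eL E ∧ eL E ≤ 5) ∨
    (exE E = 5 ∧ 6 ≤ eL E ∧ eL E ≤ 8) := by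
  decide +kernel

lemma bar_zero : bar 0 = 0 := by decide

lemma exM_bar (M : Fin 10) : exM (bar M) = exM M := by rw [exM, exM, mL_bar]

lemma wlen_rev (w : Code) : wlen (rev w) = wlen w := by
  simp only [wlen, rev, mlen_rv]; ring

lemma wex_rev (w : Code) : wex (rev w) = wex w := by
  simp only [wex, rev, rv, List.map_reverse, List.sum_reverse, List.map_map, Function.comp_def,
    exM_bar]
  ring

/-- `n` copies of the smallest middle piece. -/
abbrev pes (n : ℕ) : List (Fin 10) := List.replicate n 0

lemma rv_pes (n : ℕ) : rv (pes n) = pes n := by simp [rv, bar_zero]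

lemma rv_special (a b : ℕ) (M : Fin 10) :
    rv (pes a ++ M :: pes b) = pes b ++ bar M :: pes a := by
  simp [rv, bar_zero]

lemma mlen_pes (n : ℕ) : mlen (pes n) = 5 * n := by
  have h : mL 0 = 5 := by decide +kernel
  simp [mlen, h, mul_comm]

lemma mlen_special (a b : ℕ) (M : Fin 10) :
    mlen (pes a ++ M :: pes b) = 5 * a + mL M + 5 * b := by
  rw [← mlen_pes, ← mlen_pes]
  simp [mlen, add_assoc]

lemma sum_exM_pes (n : ℕ) : ((pes n).map exM).sum = 0 := by
  have h : exM 0 = 0 := by decide +kernel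
  simp [h]

lemma sum_exM_special (a b : ℕ) (M : Fin 10) :
    ((pes a ++ M :: pes b).map exM).sum = exM M := by
  rw [List.map_append, List.sum_append, List.map_cons, List.sum_cons, sum_exM_pes, sum_exM_pes,
    zero_add, add_zero]

lemma eq_pes_of_sum {L : List (Fin 10)} (h : (L.map exM).sum = 0) : L = pes L.length := by
  induction L with
  | nil => rfl
  | cons M L ih =>
    rw [List.map_cons, List.sum_cons, Nat.add_eq_zero_iff] at h
    obtain ⟨-, rfl, -⟩ | ⟨h', -⟩ := exM_spec M
    · exact congrArg _ (ih h.2)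
    · omega

lemma eq_special_of_sum {L : List (Fin 10)} (h : (L.map exM).sum ≠ 0)
    (h3 : (L.map exM).sum ≤ 3) : ∃ a M b, exM M = 2 ∧ L = pes a ++ M :: pes b := by
  induction L with
  | nil => simp at h
  | cons M L ih =>
    rw [List.map_cons, List.sum_cons] at h h3
    obtain ⟨h0, rfl, -⟩ | ⟨h2, -⟩ := exM_spec M
    · obtain ⟨a, N, b, hN, rfl⟩ := ih (by omega) (by omega)
      exact ⟨a + 1, N, b, hN, rfl⟩
    · by_cases hL : (L.map exM).sum = 0
      · exact ⟨0, M, L.length, h2, congrArg _ (eq_pes_of_sum hL)⟩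
      · obtain ⟨a, N, b, hN, rfl⟩ := ih hL (by omega)
        rw [sum_exM_special] at h3
        omega

lemma special_inj {a b a' b' : ℕ} {M M' : Fin 10} (hM : M ≠ 0) (hM' : M' ≠ 0)
    (h : pes a ++ M :: pes b = pes a' ++ M' :: pes b') : a = a' ∧ M = M' := by
  induction a generalizing a' with
  | zero =>
    cases a' with
    | zero => simpa using And.left (List.cons.inj h)
    | succ a' => exact absurd (List.cons.inj h).1 hM
  | succ a ih =>
    cases a' with
    | zero => exact absurd (List.cons.inj h).1.symm hM'
    | succ a' =>
      exact (ih (List.cons.inj h).2).imp_left (congrArg Nat.succ)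

/-- The pairs of end pieces with `c` layers and excess `x`. -/
def endPairs (c x : ℕ) : Finset (Fin 72 × Fin 72) :=
  Finset.univ.filter fun p => eL p.1 + eL p.2 = c ∧ exE p.1 + exE p.2 = x

/-- The triples of two small end pieces and a large middle piece with `c` layers. -/
def endTriples (c : ℕ) : Finset (Fin 10 × Fin 72 × Fin 72) :=
  ((Finset.univ.filter fun M => exM M = 2) ×ˢ
    (Finset.univ.filter fun p : Fin 72 × Fin 72 => exE p.1 = 3 ∧ exE p.2 = 3)).filter
      fun t => eL t.2.1 + mL t.1 + eL t.2.2 = c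

/-- The chains with `Q` middle pieces all of which are as small as possible. -/
def plain (Q c x : ℕ) : Finset Code := (endPairs c x).image fun p => (p.1, pes Q, p.2)

/-- The chains with `Q` middle pieces all but one of which are as small as possible. -/
def special (Q c : ℕ) : Finset Code :=
  (endTriples c ×ˢ Finset.range Q).image fun t =>
    (t.1.2.1, pes t.2 ++ t.1.1 :: pes (Q - 1 - t.2), t.1.2.2)

lemma mem_plain {Q c x : ℕ} {E E' : Fin 72} {L : List (Fin 10)} : (E, L, E') ∈ plain Q c x ↔
    eL E + eL E' = c ∧ exE E + exE E' = x ∧ L = pes Q := by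
  simp only [plain, endPairs, Finset.mem_image, Finset.mem_filter, Finset.mem_univ, true_and,
    Prod.exists, Prod.mk.injEq]
  constructor
  · rintro ⟨_, _, ⟨h1, h2⟩, rfl, rfl, rfl⟩; exact ⟨h1, h2, rfl⟩
  · rintro ⟨h1, h2, rfl⟩; exact ⟨_, _, ⟨h1, h2⟩, rfl, rfl, rfl⟩

lemma mem_special {Q c : ℕ} {E E' : Fin 72} {L : List (Fin 10)} : (E, L, E') ∈ special Q c ↔
    exE E = 3 ∧ exE E' = 3 ∧ ∃ a M b, a + b + 1 = Q ∧ exM M = 2 ∧ eL E + mL M + eL E' = c ∧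
      L = pes a ++ M :: pes b := by
  simp only [special, endTriples, Finset.mem_image, Finset.mem_filter, Finset.mem_univ, true_and,
    Prod.exists, Prod.mk.injEq, Finset.mem_product, Finset.mem_range]
  constructor
  · rintro ⟨M, _, _, a, ⟨⟨⟨h1, h2, h3⟩, h4⟩, h5⟩, rfl, rfl, rfl⟩
    exact ⟨h2, h3, a, M, _, by omega, h1, h4, rfl⟩
  · rintro ⟨h1, h2, a, M, b, rfl, h3, h4, rfl⟩
    exact ⟨M, E, E', a, ⟨⟨⟨h3, h1, h2⟩, h4⟩, by omega⟩, rfl, by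
      rw [show a + b + 1 - 1 - a = b by omega], rfl⟩

lemma mem_plain_iff {Q c : ℕ} (hc : 8 ≤ c) (hc' : c ≤ 10) (w : Code) :
    w ∈ plain Q c 6 ↔ wlen w = 5 * Q + c ∧ wex w = 6 := by
  obtain ⟨E, L, E'⟩ := w
  rw [mem_plain, wlen, wex]
  have hE := exE_spec E
  have hE' := exE_spec E'
  constructor
  · rintro ⟨h1, h2, rfl⟩
    rw [mlen_pes, sum_exM_pes]
    dsimp only
    omega
  · rintro ⟨h1, h2⟩
    dsimp only at h1 h2
    have hL := eq_pes_of_sum (L := L) (by omega)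
    rw [hL, mlen_pes] at h1
    rw [hL] at h2 ⊢
    rw [show L.length = Q by omega]
    exact ⟨by omega, by omega, rfl⟩

lemma mem_plain_union_special_iff {Q c : ℕ} (hc : c = 11 ∨ c = 12) (w : Code) :
    w ∈ plain Q c 8 ∪ special Q (c + 5) ↔ wlen w = 5 * Q + c ∧ wex w = 8 := by
  obtain ⟨E, L, E'⟩ := w
  rw [Finset.mem_union, mem_plain, mem_special, wlen, wex]
  have hE := exE_spec E
  have hE' := exE_spec E'
  constructor
  · rintro (⟨h1, h2, rfl⟩ | ⟨h1, h2, a, M, b, h3, h4, h5, rfl⟩)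
    · rw [mlen_pes, sum_exM_pes]
      dsimp only
      omega
    · rw [mlen_special, sum_exM_special]
      dsimp only
      omega
  · rintro ⟨h1, h2⟩
    dsimp only at h1 h2
    by_cases h0 : (L.map exM).sum = 0
    · left
      have hL := eq_pes_of_sum h0
      rw [hL, mlen_pes] at h1
      rw [h0] at h2
      rw [hL, show L.length = Q by omega]
      exact ⟨by omega, by omega, rfl⟩
    · right
      obtain ⟨a, M, b, hM, rfl⟩ := eq_special_of_sum h0 (by omega)
      rw [sum_exM_special] at h2
      rw [mlen_special] at h1
      have hM' := exM_spec M
      have hs : eL E + mL M + eL E' = c + 5 := by omega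
      exact ⟨by omega, by omega, a, M, b, by omega, hM, hs, rfl⟩

lemma plain_injective (Q : ℕ) :
    Function.Injective fun p : Fin 72 × Fin 72 => ((p.1, pes Q, p.2) : Code) := by
  rintro ⟨E, E'⟩ ⟨F, F'⟩ h
  simpa using h

lemma special_injOn (Q c : ℕ) :
    Set.InjOn (fun t : (Fin 10 × Fin 72 × Fin 72) × ℕ =>
      ((t.1.2.1, pes t.2 ++ t.1.1 :: pes (Q - 1 - t.2), t.1.2.2) : Code))
      (endTriples c ×ˢ Finset.range Q : Finset _) := by
  rintro ⟨⟨M, E, E'⟩, a⟩ h1 ⟨⟨N, F, F'⟩, b⟩ h2 h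
  simp only [endTriples, Finset.coe_product, Set.mem_prod, Finset.mem_coe, Finset.mem_filter,
    Finset.mem_product, Finset.mem_univ, true_and] at h1 h2
  simp only [Prod.mk.injEq] at h
  have hM := exM_spec M
  have hN := exM_spec N
  obtain ⟨rfl, rfl⟩ := special_inj (by omega) (by omega) h.2.1
  obtain ⟨rfl, -, rfl⟩ := h
  rfl

lemma card_plain (Q c x : ℕ) : (plain Q c x).card = (endPairs c x).card :=
  Finset.card_image_of_injective _ (plain_injective Q)

lemma card_special (Q c : ℕ) : (special Q c).card = (endTriples c).card * Q := by
  rw [special, Finset.card_image_of_injOn (special_injOn Q c), Finset.card_product,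
    Finset.card_range]

lemma card_plain_fixed (Q c x : ℕ) : ((plain Q c x).filter fun w => rev w = w).card =
    ((endPairs c x).filter fun p => p.2 = p.1).card := by
  rw [plain, Finset.filter_image, Finset.card_image_of_injective _ (plain_injective Q)]
  refine congrArg Finset.card (Finset.filter_congr fun p _ => ?_)
  rw [rev, rv_pes]
  exact ⟨fun h => congrArg Prod.fst h, fun h => by rw [h]⟩

lemma card_range_fixed (Q : ℕ) : ((Finset.range Q).filter fun a => Q - 1 - a = a).card = Q % 2 := by
  obtain h | h := Nat.mod_two_eq_zero_or_one Q
  · rw [h, Finset.card_eq_zero, Finset.filter_eq_empty_iff]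
    intro a ha
    rw [Finset.mem_range] at ha
    omega
  · rw [h, Finset.card_eq_one]
    refine ⟨Q / 2, Finset.ext fun a => ?_⟩
    rw [Finset.mem_filter, Finset.mem_range, Finset.mem_singleton]
    omega

lemma card_special_fixed (Q c : ℕ) : ((special Q c).filter fun w => rev w = w).card =
    ((endTriples c).filter fun t => t.2.2 = t.2.1 ∧ bar t.1 = t.1).card * (Q % 2) := by
  rw [special, Finset.filter_image, Finset.card_image_of_injOn, ← card_range_fixed,
    ← Finset.card_product, ← Finset.filter_product]
  · refine congrArg Finset.card (Finset.filter_congr ?_)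
    rintro ⟨⟨M, E, E'⟩, a⟩ h
    simp only [endTriples, Finset.mem_product, Finset.mem_filter, Finset.mem_univ, true_and,
      Finset.mem_range] at h
    rw [rev, rv_special]
    have hM := exM_spec M
    have hM' := exM_spec (bar M)
    have hb := exM_bar M
    constructor
    · intro h1
      have hM0 : M ≠ 0 := by omega
      have hb0 : bar M ≠ 0 := by omega
      obtain ⟨h4, h5⟩ := special_inj hb0 hM0 (congrArg (fun w => w.2.1) h1)
      exact ⟨⟨congrArg Prod.fst h1, h5⟩, h4⟩
    · rintro ⟨⟨h1, h2⟩, h3⟩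
      dsimp only at h1 h2 h3
      dsimp only
      rw [h1, h2, h3]
  · exact (special_injOn Q c).mono (Finset.coe_subset.2 (Finset.filter_subset _ _))

lemma disjoint_plain_special (Q c c' : ℕ) : Disjoint (plain Q c 8) (special Q c') := by
  rw [Finset.disjoint_left]
  rintro ⟨E, L, E'⟩ h1 h2
  rw [mem_plain] at h1
  rw [mem_special] at h2
  omega

/-- Chains up to reversal. -/
def SameCode (S : Finset Code) (x y : S) : Prop := x = y ∨ x.1 = rev y.1

lemma two_mul_card_quot (S : Finset Code) (hS : ∀ w ∈ S, rev w ∈ S) :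
    2 * Nat.card (Quot (SameCode S)) = S.card + (S.filter fun w => rev w = w).card := by
  classical
  have hequiv : Equivalence (SameCode S) := by
    refine ⟨fun _ => .inl rfl, ?_, ?_⟩
    · rintro x y (rfl | h)
      · exact .inl rfl
      · exact .inr (by rw [h, rev_rev])
    · rintro x y z (rfl | h) (rfl | h')
      · exact .inl rfl
      · exact .inr h'
      · exact .inr h
      · exact .inl (Subtype.ext (by rw [h, h', rev_rev]))
  have hmk : ∀ x y : S, Quot.mk (SameCode S) x = Quot.mk (SameCode S) y ↔ SameCode S x y :=
    fun x y => ⟨fun h => hequiv.eqvGen_iff.1 (Quot.eqvGen_exact h), Quot.sound⟩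
  have : Fintype (Quot (SameCode S)) := Fintype.ofFinite _
  have h1 : S.card = ∑ q : Quot (SameCode S), (S.attach.filter fun x => Quot.mk _ x = q).card := by
    rw [← Finset.card_attach]
    exact Finset.card_eq_sum_card_fiberwise fun _ _ => Finset.mem_coe.2 (Finset.mem_univ _)
  have h2 : (S.filter fun w => rev w = w).card = ∑ q : Quot (SameCode S),
      ((S.attach.filter fun x => rev x.1 = x.1).filter fun x => Quot.mk _ x = q).card := by
    refine Eq.trans ?_ (Finset.card_eq_sum_card_fiberwise (f := Quot.mk (SameCode S))
      fun _ _ => Finset.mem_coe.2 (Finset.mem_univ _))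
    rw [← Finset.card_map (Function.Embedding.subtype _)]
    congr 1
    ext w
    simp only [Finset.mem_filter, Finset.mem_map, Finset.mem_attach, true_and,
      Function.Embedding.subtype_apply]
    exact ⟨fun ⟨h, h'⟩ => ⟨⟨w, h⟩, h', rfl⟩, fun ⟨x, h, hx⟩ => hx ▸ ⟨x.2, h⟩⟩
  rw [h1, h2, ← Finset.sum_add_distrib, Nat.card_eq_fintype_card, mul_comm, ← smul_eq_mul,
    ← Finset.card_univ, ← Finset.sum_const]
  refine Finset.sum_congr rfl fun q _ => ?_
  induction q using Quot.ind with
  | mk x =>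
  have hf : (S.attach.filter fun y => Quot.mk (SameCode S) y = Quot.mk _ x) =
      {x, ⟨rev x.1, hS _ x.2⟩} := by
    ext y
    rw [Finset.mem_filter, Finset.mem_insert, Finset.mem_singleton, hmk]
    exact ⟨fun h => h.2.imp id fun h' => Subtype.ext h', fun h =>
      ⟨Finset.mem_attach _ _, h.imp id fun h' => congrArg Subtype.val h'⟩⟩
  rw [Finset.filter_comm, hf]
  by_cases hx : rev x.1 = x.1
  · rw [show (⟨rev x.1, hS _ x.2⟩ : S) = x from Subtype.ext hx, Finset.pair_eq_singleton,
      Finset.filter_true_of_mem fun y hy => by rwa [Finset.mem_singleton.1 hy]]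
    rfl
  · have hx' : rev (rev x.1) ≠ rev x.1 := by rw [rev_rev]; exact fun h => hx h.symm
    rw [Finset.card_pair fun h => hx (congrArg Subtype.val h).symm, Finset.filter_eq_empty_iff.2]
    · rfl
    · intro y hy
      rw [Finset.mem_insert, Finset.mem_singleton] at hy
      obtain rfl | rfl := hy
      · exact hx
      · exact hx'

lemma card_quot_plain {Q c n : ℕ} (hc : 8 ≤ c) (hc' : c ≤ 10)
    (h : (endPairs c 6).card + ((endPairs c 6).filter fun p => p.2 = p.1).card = 2 * n) :
    Nat.card (Quot (SameCode (plain Q c 6))) = n := by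
  have := two_mul_card_quot (plain Q c 6) fun w hw => by
    rw [mem_plain_iff hc hc'] at hw ⊢
    rwa [wlen_rev, wex_rev]
  rw [card_plain, card_plain_fixed] at this
  omega

lemma card_quot_eight (Q : ℕ) : Nat.card (Quot (SameCode (plain Q 8 6))) = 1 :=
  card_quot_plain (by norm_num) (by norm_num) (by decide +kernel)

lemma card_quot_nine (Q : ℕ) : Nat.card (Quot (SameCode (plain Q 9 6))) = 4 :=
  card_quot_plain (by norm_num) (by norm_num) (by decide +kernel)

lemma card_quot_ten (Q : ℕ) : Nat.card (Quot (SameCode (plain Q 10 6))) = 10 :=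
  card_quot_plain (by norm_num) (by norm_num) (by decide +kernel)

lemma two_mul_card_quot_union {Q c : ℕ} (hc : c = 11 ∨ c = 12) :
    2 * Nat.card (Quot (SameCode (plain Q c 8 ∪ special Q (c + 5)))) =
      (endPairs c 8).card + (endTriples (c + 5)).card * Q +
        (((endPairs c 8).filter fun p => p.2 = p.1).card +
          ((endTriples (c + 5)).filter fun t => t.2.2 = t.2.1 ∧ bar t.1 = t.1).card * (Q % 2)) := by
  rw [two_mul_card_quot _ fun w hw => by
    rw [mem_plain_union_special_iff hc] at hw ⊢
    rwa [wlen_rev, wex_rev], Finset.filter_union,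
    Finset.card_union_of_disjoint (disjoint_plain_special _ _ _),
    Finset.card_union_of_disjoint (Finset.disjoint_filter_filter (disjoint_plain_special _ _ _)),
    card_plain, card_special, card_plain_fixed, card_special_fixed]

lemma two_mul_card_quot_eleven (Q : ℕ) :
    2 * Nat.card (Quot (SameCode (plain Q 11 8 ∪ special Q 16))) =
      482 + 113 * Q + 21 * (Q % 2) := by
  rw [two_mul_card_quot_union (.inl rfl), show (endPairs 11 8).card = 482 by decide +kernel,
    show (endTriples (11 + 5)).card = 113 by decide +kernel,
    show ((endPairs 11 8).filter fun p => p.2 = p.1).card = 0 by decide +kernel,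
    show ((endTriples (11 + 5)).filter fun t => t.2.2 = t.2.1 ∧ bar t.1 = t.1).card = 21 by
      decide +kernel, zero_add]

lemma two_mul_card_quot_twelve (Q : ℕ) :
    2 * Nat.card (Quot (SameCode (plain Q 12 8 ∪ special Q 17))) = 20 + 9 * Q + Q % 2 := by
  rw [two_mul_card_quot_union (.inr rfl), show (endPairs 12 8).card = 20 by decide +kernel,
    show (endTriples (12 + 5)).card = 9 by decide +kernel,
    show ((endPairs 12 8).filter fun p => p.2 = p.1).card = 0 by decide +kernel,
    show ((endTriples (12 + 5)).filter fun t => t.2.2 = t.2.1 ∧ bar t.1 = t.1).card = 1 by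
      decide +kernel, zero_add, one_mul]

/-! ### Counting isomorphism classes -/

lemma isKGDGraph_of_iso {V W : Type} [Finite V] [Nonempty V] {k g d : ℕ} {G : SimpleGraph V}
    {H : SimpleGraph W} (φ : G ≃g H) (h : IsKGDGraph k g d G) : IsKGDGraph k g d H := by
  have : Finite W := Finite.of_equiv V φ.toEquiv
  have : Nonempty W := φ.toEquiv.nonempty_congr.1 inferInstance
  obtain ⟨h1, h2, h3⟩ := h
  refine ⟨fun w => ?_, φ.egirth_eq ▸ h2, ?_⟩
  · obtain ⟨v, rfl⟩ := φ.surjective w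
    rw [ncard_map_iso]
    exact h1 v
  · rw [ediam_eq_coe_iff] at h3 ⊢
    obtain ⟨hc, hle, x, y, hxy⟩ := h3
    refine ⟨φ.connected_iff.1 hc, fun a b => ?_, φ x, φ y, (Iso.dist_eq hc φ x y).trans hxy⟩
    obtain ⟨a, rfl⟩ := φ.surjective a
    obtain ⟨b, rfl⟩ := φ.surjective b
    exact (Iso.dist_eq hc φ a b).trans_le (hle a b)

/-- A family `Φ` of representatives determines the number of cages. -/
lemma numCages_eq {ι : Type} [Nonempty ι] {V : ι → Type} [∀ i, Finite (V i)]
    [∀ i, Nonempty (V i)] (Φ : ∀ i, SimpleGraph (V i)) {k g d N : ℕ} {R : ι → ι → Prop}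
    (hΦ : ∀ i, IsKGDGraph k g d (Φ i)) (hN : ∀ i, Nat.card (V i) = N)
    (hlow : ∀ n (G : SimpleGraph (Fin n)), IsKGDGraph k g d G → N ≤ n)
    (hiso : ∀ i j, Nonempty (Φ i ≃g Φ j) ↔ R i j)
    (hsurj : ∀ G : SimpleGraph (Fin N), IsKGDGraph k g d G → ∃ i, Nonempty (Φ i ≃g G)) :
    numCages k g d = Nat.card (Quot R) := by
  have e (i) : V i ≃ Fin N := Finite.equivFinOfCardEq (hN i)
  let G (i) : {G : SimpleGraph (Fin N) // IsKGDGraph k g d G} :=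
    ⟨(Φ i).map (e i).toEmbedding, isKGDGraph_of_iso (Iso.map (e i) (Φ i)) (hΦ i)⟩
  have φ (i) : Φ i ≃g (G i).1 := Iso.map (e i) (Φ i)
  have hmin : minOrderKGD k g d = N := by
    obtain ⟨i⟩ := ‹Nonempty ι›
    apply le_antisymm
    · exact Nat.sInf_le ⟨_, (G i).2⟩
    · exact le_csInf ⟨N, _, (G i).2⟩ fun n ⟨H, hH⟩ => hlow n H hH
  rw [numCages, hmin]
  let S (G H : {G : SimpleGraph (Fin N) // IsKGDGraph k g d G}) : Prop := Nonempty (G.1 ≃g H.1)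
  have hS : Equivalence S :=
    ⟨fun _ => ⟨Iso.refl⟩, fun ⟨f⟩ => ⟨f.symm⟩, fun ⟨f⟩ ⟨f'⟩ => ⟨f.trans f'⟩⟩
  have hR (i j) : R i j ↔ S (G i) (G j) := by
    rw [← hiso]
    exact ⟨fun ⟨f⟩ => ⟨((φ i).symm.trans f).trans (φ j)⟩,
      fun ⟨f⟩ => ⟨((φ i).trans f).trans (φ j).symm⟩⟩
  refine (Nat.card_eq_of_bijective (Quot.map G fun i j h => (hR i j).1 h :
    Quot R → Quot S) ⟨?_, ?_⟩).symm
  · rintro ⟨i⟩ ⟨j⟩ h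
    exact Quot.sound ((hR i j).2 (hS.eqvGen_iff.1 (Quot.eqvGen_exact h)))
  · rintro ⟨H⟩
    obtain ⟨i, ⟨f⟩⟩ := hsurj H.1 H.2
    exact ⟨Quot.mk _ i, Quot.sound ⟨(φ i).symm.trans f⟩⟩

variable {d n : ℕ}

lemma classify_isKGDGraph (hd : 6 ≤ d) {G : SimpleGraph (Fin n)} (h : IsKGDGraph 3 5 d G) :
    Even n ∧ 2 * d + 8 ≤ n ∧
      (n = 2 * d + 8 → (d % 5 = 2 ∨ d % 5 = 3 ∨ d % 5 = 4) ∧ IsWord G (d + 1)) ∧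
      (d % 5 = 0 ∨ d % 5 = 1 → n = 2 * d + 10 →
        IsWord G (d + 1) ∨ d = 6 ∧ ∃ A ∈ soloTab, Nonempty (gr A ≃g G)) := by
  obtain ⟨h1, h2, h3⟩ := h
  have h1 : ∀ x, (G.neighborSet x).ncard = 3 := h1
  have : Nonempty (Fin n) := by
    by_contra hn
    rw [not_nonempty_iff] at hn
    simp [SimpleGraph.egirth_eq_top.2 (fun v => isEmptyElim v)] at h2
  obtain ⟨hc, hle, ht⟩ := ediam_eq_coe_iff.1 h3
  have h4 := even_card_of_cubic h1
  have h5 := classify_cubic hd (sparse_of_egirth h2) h1 hc hle ht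
  rw [Nat.card_eq_fintype_card, Fintype.card_fin] at h4 h5
  exact ⟨h4, h5⟩

lemma numCages_eq_of_words {S : Finset Code} {x : ℕ} (hS : S.Nonempty)
    (hmem : ∀ w, w ∈ S ↔ wlen w = d + 1 ∧ wex w = x)
    (hlow : ∀ n (G : SimpleGraph (Fin n)), IsKGDGraph 3 5 d G → 2 * (d + 1) + x ≤ n)
    (hword : ∀ G : SimpleGraph (Fin (2 * (d + 1) + x)), IsKGDGraph 3 5 d G → IsWord G (d + 1)) :
    numCages 3 5 d = Nat.card (Quot (SameCode S)) := by
  have : Nonempty S := hS.to_subtype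
  have (w : S) : Finite ((endRG w.1.1).V ⊕ (tail w.1.2.1 w.1.2.2).V) := inferInstance
  have (w : S) : Nonempty ((endRG w.1.1).V ⊕ (tail w.1.2.1 w.1.2.2).V) := ⟨.inl (endRG w.1.1).r⟩
  have hl (w : S) := ((hmem w.1).1 w.2).1
  refine numCages_eq (fun w : S => word w.1.1 w.1.2.1 w.1.2.2) (fun w => isKGDGraph_word _ _ _ (hl w))
    (fun w => ?_) hlow (fun w w' => ?_) fun G hG => ?_
  · obtain ⟨h1, h2⟩ := (hmem w.1).1 w.2
    rw [wlen] at h1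
    rw [wex] at h2
    rw [card_word, h1, h2]
  · rw [word_iso_iff ((hl w).trans (hl w').symm)]
    obtain ⟨⟨E, L, E'⟩, hw⟩ := w
    obtain ⟨⟨F, K, F'⟩, hw'⟩ := w'
    simp [SameCode, rev]
  · obtain ⟨E, L, E', hE, ⟨φ⟩⟩ := hword G hG
    refine ⟨⟨(E, L, E'), (hmem _).2 ⟨hE, ?_⟩⟩, ⟨φ⟩⟩
    have := Nat.card_congr φ.toEquiv
    rw [card_word, hE, Nat.card_eq_fintype_card, Fintype.card_fin] at this
    exact Nat.add_left_cancel this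

lemma numCages_eq_of_plain {Q c : ℕ} (hd : 6 ≤ d) (hc : 8 ≤ c) (hc' : c ≤ 10)
    (h : d + 1 = 5 * Q + c) (hn : Nat.card (Quot (SameCode (plain Q c 6))) ≠ 0) :
    numCages 3 5 d = Nat.card (Quot (SameCode (plain Q c 6))) := by
  refine numCages_eq_of_words (x := 6) ?_ (fun w => ?_) (fun n G hG => ?_) fun G hG => ?_
  · rw [Finset.nonempty_iff_ne_empty]
    rintro e
    rw [e] at hn
    simp at hn
  · rw [mem_plain_iff hc hc', h]
  · have := (classify_isKGDGraph hd hG).2.1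
    omega
  · exact ((classify_isKGDGraph hd hG).2.2.1 (by omega)).2

lemma isKGDGraph_lower (hd : 6 ≤ d) (h5 : d % 5 = 0 ∨ d % 5 = 1) {G : SimpleGraph (Fin n)}
    (hG : IsKGDGraph 3 5 d G) : 2 * d + 10 ≤ n := by
  obtain ⟨⟨m, rfl⟩, h1, h2, -⟩ := classify_isKGDGraph hd hG
  by_contra h
  have := (h2 (by omega)).1
  omega

lemma numCages_eq_of_union {Q c : ℕ} (hd : 7 ≤ d) (hc : c = 11 ∨ c = 12) (h : d + 1 = 5 * Q + c)
    (hn : 0 < 2 * Nat.card (Quot (SameCode (plain Q c 8 ∪ special Q (c + 5))))) :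
    numCages 3 5 d = Nat.card (Quot (SameCode (plain Q c 8 ∪ special Q (c + 5)))) := by
  refine numCages_eq_of_words (x := 8) ?_ (fun w => ?_) (fun n G hG => ?_) fun G hG => ?_
  · rw [Finset.nonempty_iff_ne_empty]
    rintro e
    rw [e] at hn
    simp at hn
  · rw [mem_plain_union_special_iff hc, h]
  · have := isKGDGraph_lower (by omega) (by omega) hG
    omega
  · obtain h | h := (classify_isKGDGraph (by omega) hG).2.2.2 (by omega) (by omega)
    · exact h
    · omega

/-- Some distance exceeds five. -/
def farB (A : List (List ℕ)) : Bool :=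
  anyB (fun i => anyB (fun j => !(tb (ballM (masks A) 5 (Nat.pow 2 i)) j)) (List.range (len A)))
    (List.range (len A))

lemma soloTab_far : allB farB soloTab = true := by decide +kernel

lemma ord_solo (i : Fin 6) : ord (sG i) = 22 := by
  have h := soloTab_ok _ (sG_mem i)
  simp only [soloB, Bool.and_eq_true, Nat.beq_eq, len_eq] at h
  rw [ord_eq h.1, h.2.2.2.2.2.2]

lemma isKGDGraph_solo (i : Fin 6) : IsKGDGraph 3 5 6 (gr (sG i)) := by
  have h := soloTab_ok _ (sG_mem i)
  simp only [soloB, Bool.and_eq_true] at h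
  obtain ⟨h1, h2, h3, h4, h5, -⟩ := h
  have hc := connected_of_diamB h1 h5
  refine ⟨fun v => ncard_of_degB h1 h4 v, ?_, ?_⟩
  · obtain ⟨a, b, c, d, e, g1, g2, g3, g4, g5, g6, g7, g8, g9, g10⟩ := exists_five_of_fiveB h1 h3
    exact egirth_eq_five (sparse_of_sparseB h1 h2) g1 g2 g3 g4 g5 g6 g7 g8 g9 g10
  · have : Nonempty (Fin (ord (sG i))) := ⟨0⟩
    refine ediam_eq_coe_iff.2 ⟨hc, dist_le_of_diamB h1 h5, ?_⟩
    have hf := soloTab_far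
    rw [allB_eq, List.all_eq_true] at hf
    have := hf _ (sG_mem i)
    simp only [farB, anyB_eq, List.any_eq_true, len_eq, List.mem_range, Bool.not_eq_true'] at this
    obtain ⟨a, ha, b, hb, hab⟩ := this
    rw [← ord_eq h1] at ha hb
    have hle := dist_le_of_diamB h1 h5 ⟨a, ha⟩ ⟨b, hb⟩
    have hlt := (dist_le_iff_tb h1 hc 5 ⟨a, ha⟩ ⟨b, hb⟩).not.2 (ne_true_of_eq_false hab)
    exact ⟨⟨a, ha⟩, ⟨b, hb⟩, by omega⟩

lemma numCages_six : numCages 3 5 6 = 6 := by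
  have (i : Fin 6) : Nonempty (Fin (ord (sG i))) := ⟨0⟩
  rw [numCages_eq (N := 22) (R := Eq) (fun i : Fin 6 => gr (sG i)) isKGDGraph_solo
    (fun i => ?_) (fun n G hG => ?_) (fun i j => ?_) fun G hG => ?_]
  · rw [← Nat.card_eq_of_bijective (Quot.mk Eq) ⟨fun i j h => ?_, Quot.mk_surjective⟩,
      Nat.card_eq_fintype_card, Fintype.card_fin]
    exact congrArg (Quot.lift id fun _ _ h => h) h
  · rw [Nat.card_eq_fintype_card, Fintype.card_fin, ord_solo]
  · exact isKGDGraph_lower le_rfl (.inr rfl) hG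
  · exact ⟨fun ⟨φ⟩ => solo_inj φ, fun h => h ▸ ⟨Iso.refl⟩⟩
  · obtain h | ⟨-, A, hA, hφ⟩ := (classify_isKGDGraph le_rfl hG).2.2.2 (.inr rfl) rfl
    · obtain ⟨E, L, E', h, -⟩ := h
      have h1 := exE_spec E
      have h2 := exE_spec E'
      omega
    · obtain ⟨i, rfl⟩ := exists_solo hA
      exact ⟨i, hφ⟩

end CageCount

open CageCount in
theorem count_cages_three_five (d : ℕ) (hd : 6 ≤ d) :
    (d % 5 = 1 → numCages 3 5 d = d - d / 10) ∧
    (d % 5 = 2 → numCages 3 5 d = 1) ∧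
    (d % 5 = 3 → numCages 3 5 d = 4) ∧
    (d % 5 = 4 → numCages 3 5 d = 10) ∧
    (d % 10 = 0 → numCages 3 5 d = (1280 + 113 * d) / 10) ∧
    (d % 10 = 5 → numCages 3 5 d = (1385 + 113 * d) / 10) := by
  have key : d % 5 = 0 → 2 * numCages 3 5 d =
      482 + 113 * ((d - 10) / 5) + 21 * ((d - 10) / 5 % 2) := fun h => by
    have hQ := two_mul_card_quot_eleven ((d - 10) / 5)
    rw [← hQ, numCages_eq_of_union (c := 11) (Q := (d - 10) / 5) (by omega) (.inl rfl) (by omega)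
      (Nat.lt_of_lt_of_eq (by omega) hQ.symm)]
  refine ⟨fun h => ?_, fun h => ?_, fun h => ?_, fun h => ?_, fun h => ?_, fun h => ?_⟩
  · obtain rfl | h6 := hd.eq_or_lt
    · exact numCages_six
    · have hQ := two_mul_card_quot_twelve ((d - 11) / 5)
      rw [← numCages_eq_of_union (d := d) (c := 12) (Q := (d - 11) / 5) (by omega) (.inr rfl)
        (by omega) (Nat.lt_of_lt_of_eq (by omega) hQ.symm)] at hQ
      omega
  · have hQ := card_quot_eight ((d - 7) / 5)
    rw [numCages_eq_of_plain (Q := (d - 7) / 5) (c := 8) hd (by omega) (by omega) (by omega)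
      (by omega), hQ]
  · have hQ := card_quot_nine ((d - 8) / 5)
    rw [numCages_eq_of_plain (Q := (d - 8) / 5) (c := 9) hd (by omega) (by omega) (by omega)
      (by omega), hQ]
  · have hQ := card_quot_ten ((d - 9) / 5)
    rw [numCages_eq_of_plain (Q := (d - 9) / 5) (c := 10) hd (by omega) (by omega) (by omega)
      (by omega), hQ]
  · have := key (by omega)
    omega
  · have := key (by omega)
    omega
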